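/- arXiv:2301.04084 — 2 statements merged into one kernel-verified Lean document; each statement's English description precedes it below -/
import Mathlib

section
/- For n ≥ 1, s ∈ (0, n), C₀ > 1, let M = M(n,s,C₀) be sufficiently large and let E ⊂ ℝ^{n+1} be an (s,C₀)-AD regular compact set. Let ν be a finite Borel measure supported on E and c₁ ∈ (0,1) such that for all x ∈ E and 0 < r ≤ diam(E), there exists a ball B(y,ρ) with y ∈ B(x,r) ∩ E and c₁r ≤ ρ ≤ r satisfying either ν(B(y,ρ))/ρ^s ≥ M·ν(B(x,r))/r^s or ν(B(y,ρ))/ρ^s ≤ M^{−1}·ν(B(x,r))/r^s. Then dim ν < s. -/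
open Set Metric MeasureTheory ENNReal

noncomputable section

/-- A set `E` in a metric space is `(s, C₀)`-Ahlfors–David regular. -/
def ADRegular {X : Type*} [MetricSpace X] [MeasurableSpace X] [BorelSpace X]
    (s C₀ : ℝ) (E : Set X) : Prop :=
  ∀ x ∈ E, ∀ r : ℝ, 0 < r → r ≤ Metric.diam E →
    ENNReal.ofReal (C₀⁻¹ * r ^ s) ≤ μH[s] (E ∩ Metric.closedBall x r) ∧
    μH[s] (E ∩ Metric.closedBall x r) ≤ ENNReal.ofReal (C₀ * r ^ s)

/-- The (Hausdorff) dimension of a measure: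
`dim ν = inf { dim_H F : F Borel, ν(Fᶜ) = 0 }`. -/
def measDim {X : Type*} [EMetricSpace X] [MeasurableSpace X] [BorelSpace X]
    (ν : Measure X) : ℝ≥0∞ :=
  ⨅ (F : Set X) (_ : MeasurableSet F) (_ : ν Fᶜ = 0), dimH F

theorem measureReal_mono_of_inter_subset {X : Type*} [MeasurableSpace X] {E : Set X}
    {ν : Measure X} [IsFiniteMeasure ν] (hν : ν Eᶜ = 0)
    {U V : Set X} (h : U ∩ E ⊆ V) : ν.real U ≤ ν.real V := by
  refine ENNReal.toReal_mono (measure_ne_top ν V) (measure_mono_ae ?_)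
  have : ∀ᵐ y ∂ν, y ∈ E := hν
  filter_upwards [this] with y hy hU using h ⟨hU, hy⟩

section CellMaps

variable {X : Type*} [MetricSpace X]

/-- A compact set admits a measurable nearest-point map onto a finite maximal separated net. -/
theorem exists_net_projection [MeasurableSpace X] [BorelSpace X] {E : Set X} (hE : IsCompact E)
    (hne : E.Nonempty) {r : ℝ} (hr : 0 < r) :
    ∃ (N : Finset X) (p : X → X), Measurable p ∧ ↑N ⊆ E ∧ (∀ y, p y ∈ N) ∧
      (∀ y ∈ E, dist (p y) y ≤ r) ∧ ∀ x ∈ N, ∀ y, dist y x < r / 2 → p y = x := by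
  classical
  obtain ⟨ε, hε⟩ : ∃ ε : NNReal, (ε : ℝ) = r / 2 := ⟨⟨r / 2, by positivity⟩, rfl⟩
  have hfin : packingNumber (2 * ε) E ≠ ⊤ := by
    refine ne_top_of_le_ne_top ?_ (packingNumber_two_mul_le_externalCoveringNumber ε E)
    obtain ⟨t, -, htf, htc⟩ := Metric.exists_finite_isCover_of_totallyBounded
      (ε := ε) (by rw [← NNReal.coe_ne_zero, hε]; positivity) hE.totallyBounded
    exact ne_top_of_le_ne_top (Set.encard_ne_top_iff.2 htf) htc.externalCoveringNumber_le_encard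
  have hr2 : ((2 * ε : NNReal) : ℝ) = r := by push_cast; rw [hε]; ring
  have hNfin : (maximalSeparatedSet (2 * ε) E).Finite := by
    rw [← Set.encard_ne_top_iff, encard_maximalSeparatedSet hfin]; exact hfin
  have hsub : maximalSeparatedSet (2 * ε) E ⊆ E := maximalSeparatedSet_subset
  have hsep := isSeparated_maximalSeparatedSet (ε := 2 * ε) (A := E)
  have hcov := isCover_maximalSeparatedSet hfin
  set S := maximalSeparatedSet (2 * ε) E
  have hcov' : ∀ y ∈ E, ∃ x ∈ S, dist y x ≤ r := by
    intro y hy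
    obtain ⟨x, hx, hxy⟩ := hcov hy
    refine ⟨x, hx, ?_⟩
    rw [← hr2]
    have : edist y x ≤ ((2 * ε : NNReal) : ℝ≥0∞) := hxy
    rwa [edist_nndist, ENNReal.coe_le_coe, ← NNReal.coe_le_coe, coe_nndist] at this
  have hSne : S.Nonempty := by
    obtain ⟨y, hy⟩ := hne
    obtain ⟨x, hx, -⟩ := hcov' y hy
    exact ⟨x, hx⟩
  obtain ⟨e, he⟩ := hNfin.countable.exists_eq_range hSne
  have hk : ∀ x, ∃ k, x ∈ S → e k = x := by
    intro x
    by_cases hx : x ∈ S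
    · rw [he] at hx
      exact ⟨hx.choose, fun _ => hx.choose_spec⟩
    · exact ⟨0, fun h => absurd h hx⟩
  choose k hk using hk
  set m := hNfin.toFinset.sup k
  have hmin : ∀ x ∈ S, ∀ y, dist (SimpleFunc.nearestPt e m y) y ≤ dist x y := by
    intro x hx y
    have := SimpleFunc.edist_nearestPt_le e y
      (show k x ≤ m from Finset.le_sup (f := k) (hNfin.mem_toFinset.2 hx))
    rw [hk x hx, edist_dist, edist_dist] at this
    exact (ENNReal.ofReal_le_ofReal_iff dist_nonneg).1 this
  have hmem : ∀ y, SimpleFunc.nearestPt e m y ∈ S := by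
    intro y
    rw [he]
    exact ⟨SimpleFunc.nearestPtInd e m y, rfl⟩
  refine ⟨hNfin.toFinset, SimpleFunc.nearestPt e m, SimpleFunc.measurable _, by simpa using hsub,
    by simpa using hmem, ?_, ?_⟩
  · intro y hy
    obtain ⟨x, hx, hxy⟩ := hcov' y hy
    exact (hmin x hx y).trans (by rwa [dist_comm])
  · intro x hx y hxy
    rw [Set.Finite.mem_toFinset] at hx
    by_contra hne
    have h1 : ((2 * ε : NNReal) : ℝ≥0∞) < edist _ _ := hsep (hmem y) hx hne
    rw [edist_nndist, ENNReal.coe_lt_coe, ← NNReal.coe_lt_coe, coe_nndist, hr2] at h1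
    have h2 := hmin x hx y
    have h3 := dist_triangle (SimpleFunc.nearestPt e m y) y x
    rw [dist_comm x y] at h2
    linarith

/-- A measurable map sorting `E` into finitely many round cells of size comparable to `r`,
centred at the points of `N`. -/
structure IsCellMap [MeasurableSpace X] (E : Set X) (r : ℝ) (N : Finset X) (q : X → X) : Prop where
  measurable : Measurable q
  subset : ↑N ⊆ E
  mem : ∀ y, q y ∈ N
  dist_le : ∀ y ∈ E, dist (q y) y ≤ 2 * r
  eq_of_dist_lt : ∀ x ∈ N, ∀ y ∈ E, dist y x < r / 4 → q y = x

variable [MeasurableSpace X] {E : Set X} {r r' : ℝ} {N N' : Finset X} {q q' : X → X}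

theorem exists_isCellMap [BorelSpace X] (hE : IsCompact E) (hne : E.Nonempty) (hr : 0 < r) :
    ∃ N q, IsCellMap E r N q := by
  obtain ⟨N, p, hpm, hN, hp, hd, he⟩ := exists_net_projection hE hne hr
  exact ⟨N, p, hpm, hN, hp, fun y hy => (hd y hy).trans (by linarith),
    fun x hx y _ hxy => he x hx y (by linarith)⟩

/-- Every cell map is refined from a cell map at any much coarser scale. -/
theorem IsCellMap.exists_coarse [BorelSpace X] (hq : IsCellMap E r' N' q') (hE : IsCompact E)
    (hne : E.Nonempty) (hr : 0 < r) (hrr : r' ≤ r / 8) :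
    ∃ N p, IsCellMap E r N (p ∘ q') := by
  obtain ⟨N, p, hpm, hN, hp, hd, he⟩ := exists_net_projection hE hne hr
  refine ⟨N, p, hpm.comp hq.measurable, hN, fun y => hp _, fun y hy => ?_, fun x hx y hy hxy => ?_⟩
  · have h1 := hd (q' y) (hq.subset (hq.mem y))
    have h2 := hq.dist_le y hy
    have h3 := dist_triangle (p (q' y)) (q' y) y
    simp only [Function.comp_apply]
    linarith
  · refine he x hx _ ?_
    have h2 := hq.dist_le y hy
    have h3 := dist_triangle (q' y) y x
    linarith

/-- If `ν ≤ l μ` on the cells of `S`, then the same holds between a set and an enlargement of it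
that contains all cells of `S` that it meets. -/
theorem IsCellMap.measureReal_le [BorelSpace X] {ν μ : Measure X} [IsFiniteMeasure ν]
    [IsFiniteMeasure μ] (hq : IsCellMap E r N q) (hν : ν Eᶜ = 0) (hμ : μ Eᶜ = 0) {S : Finset X}
    {l : ℝ} (hl : 0 ≤ l) (hS : ∀ z ∈ S, ν.real (q ⁻¹' {z}) ≤ l * μ.real (q ⁻¹' {z}))
    {U V : Set X} (hU : ∀ u ∈ U ∩ E, q u ∈ S)
    (hUV : ∀ u ∈ U ∩ E, ∀ v ∈ E, q u = q v → v ∈ V) :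
    ν.real U ≤ l * μ.real V := by
  classical
  set T := S.filter fun z => ∃ u ∈ U ∩ E, q u = z
  have hmeas : ∀ z ∈ T, MeasurableSet (q ⁻¹' {z}) := fun z _ =>
    hq.measurable (measurableSet_singleton z)
  calc ν.real U ≤ ν.real (q ⁻¹' T) := by
        refine measureReal_mono_of_inter_subset hν fun u hu => ?_
        simp only [T, Set.mem_preimage, Finset.mem_coe, Finset.mem_filter]
        exact ⟨hU u hu, u, hu, rfl⟩
    _ = ∑ z ∈ T, ν.real (q ⁻¹' {z}) := (sum_measureReal_preimage_singleton T hmeas).symm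
    _ ≤ ∑ z ∈ T, l * μ.real (q ⁻¹' {z}) :=
        Finset.sum_le_sum fun z hz => hS z (Finset.mem_filter.1 hz).1
    _ = l * μ.real (q ⁻¹' T) := by
        rw [← Finset.mul_sum, sum_measureReal_preimage_singleton T hmeas]
    _ ≤ l * μ.real V := by
        refine mul_le_mul_of_nonneg_left (measureReal_mono_of_inter_subset hμ ?_) hl
        rintro v ⟨hv, hvE⟩
        simp only [T, Set.mem_preimage, Finset.mem_coe, Finset.mem_filter] at hv
        obtain ⟨-, u, hu, huv⟩ := hv
        exact hUV u hu v hvE huv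

end CellMaps

section Hellinger

theorem sum_mul_le_of_unbalanced {ι : Type*} {S : Finset ι} {u v : ι → ℝ} {z : ι} {p : ℝ}
    (hz : z ∈ S) (hv : ∀ i ∈ S, 0 ≤ v i) (hu1 : ∑ i ∈ S, u i ^ 2 = 1)
    (hv1 : ∑ i ∈ S, v i ^ 2 = 1) (hgap : 2 * v z ≤ u z ∨ 2 * u z ≤ v z) (hp : p ≤ v z ^ 2) :
    ∑ i ∈ S, u i * v i ≤ 1 - p / 8 := by
  have h1 : ∑ i ∈ S, (u i - v i) ^ 2 = 2 - 2 * ∑ i ∈ S, u i * v i := by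
    calc ∑ i ∈ S, (u i - v i) ^ 2 = ∑ i ∈ S, (u i ^ 2 + v i ^ 2 - 2 * (u i * v i)) :=
          Finset.sum_congr rfl fun i _ => by ring
      _ = _ := by
          rw [Finset.sum_sub_distrib, Finset.sum_add_distrib, ← Finset.mul_sum, hu1, hv1]
          ring
  have h2 : (u z - v z) ^ 2 ≤ ∑ i ∈ S, (u i - v i) ^ 2 :=
    Finset.single_le_sum (f := fun i => (u i - v i) ^ 2) (fun i _ => sq_nonneg _) hz
  have h3 : v z ^ 2 / 4 ≤ (u z - v z) ^ 2 := by
    have := hv z hz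
    rcases hgap with h | h <;> nlinarith
  linarith

/-- Quantitative Cauchy–Schwarz: a gain when one of the ratios `a i / b i` is far from the
average one. -/
theorem sum_sqrt_mul_le_of_unbalanced {ι : Type*} {S : Finset ι} {a b : ι → ℝ} {z : ι} {p : ℝ}
    (hz : z ∈ S) (ha : ∀ i ∈ S, 0 ≤ a i) (hb : ∀ i ∈ S, 0 ≤ b i) (hA : 0 < ∑ i ∈ S, a i)
    (hB : 0 < ∑ i ∈ S, b i)
    (hgap : 4 * (∑ i ∈ S, a i) * b z ≤ (∑ i ∈ S, b i) * a z ∨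
      4 * (∑ i ∈ S, b i) * a z ≤ (∑ i ∈ S, a i) * b z)
    (hp : p * ∑ i ∈ S, b i ≤ b z) :
    ∑ i ∈ S, √(a i * b i) ≤ (1 - p / 8) * √((∑ i ∈ S, a i) * ∑ i ∈ S, b i) := by
  set A := ∑ i ∈ S, a i with hAdef
  set B := ∑ i ∈ S, b i with hBdef
  have key : ∑ i ∈ S, √(a i / A) * √(b i / B) ≤ 1 - p / 8 := by
    refine sum_mul_le_of_unbalanced hz (fun i _ => Real.sqrt_nonneg _) ?_ ?_ ?_ ?_
    · rw [Finset.sum_congr rfl fun i hi => Real.sq_sqrt (div_nonneg (ha i hi) hA.le),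
        ← Finset.sum_div, ← hAdef, div_self hA.ne']
    · rw [Finset.sum_congr rfl fun i hi => Real.sq_sqrt (div_nonneg (hb i hi) hB.le),
        ← Finset.sum_div, ← hBdef, div_self hB.ne']
    · have h4 : ∀ t : ℝ, 2 * √t = √(4 * t) := fun t => by
        rw [Real.sqrt_mul (by norm_num), show (4 : ℝ) = 2 ^ 2 by norm_num,
          Real.sqrt_sq (by norm_num)]
      rw [h4, h4]
      refine hgap.imp (fun h => Real.sqrt_le_sqrt ?_) (fun h => Real.sqrt_le_sqrt ?_)
      · rw [← mul_div_assoc, div_le_div_iff₀ hB hA]; linarith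
      · rw [← mul_div_assoc, div_le_div_iff₀ hA hB]; linarith
    · rw [Real.sq_sqrt (div_nonneg (hb z hz) hB.le), le_div_iff₀ hB]; exact hp
  calc ∑ i ∈ S, √(a i * b i) = (∑ i ∈ S, √(a i / A) * √(b i / B)) * √(A * B) := by
        rw [Finset.sum_mul]
        refine Finset.sum_congr rfl fun i hi => ?_
        rw [← Real.sqrt_mul (div_nonneg (ha i hi) hA.le), ← Real.sqrt_mul
          (mul_nonneg (div_nonneg (ha i hi) hA.le) (div_nonneg (hb i hi) hB.le))]
        congr 1
        field_simp
    _ ≤ _ := mul_le_mul_of_nonneg_right key (Real.sqrt_nonneg _)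

end Hellinger

section Regular

variable {X : Type*} [MetricSpace X] [MeasurableSpace X]

/-- `μ` lives on `E` and its balls centred on `E` have measure comparable to `r ^ s`. -/
structure IsADRegularMeasure (μ : Measure X) (E : Set X) (s C₀ : ℝ) : Prop where
  null_compl : μ Eᶜ = 0
  le_real : ∀ x ∈ E, ∀ r : ℝ, 0 < r → r ≤ Metric.diam E →
    C₀⁻¹ * r ^ s ≤ μ.real (closedBall x r)
  real_le : ∀ x ∈ E, ∀ r : ℝ, 0 < r → r ≤ Metric.diam E →
    μ.real (closedBall x r) ≤ C₀ * r ^ s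

/-- At every location and scale of `E`, the `s`-density of `ν` changes by a factor `M` on some
ball of comparable size. -/
def HasDensityJumps (ν : Measure X) (E : Set X) (s M c₁ : ℝ) : Prop :=
  ∀ x ∈ E, ∀ r : ℝ, 0 < r → r ≤ Metric.diam E →
    ∃ y ρ, y ∈ Metric.ball x r ∩ E ∧ c₁ * r ≤ ρ ∧ ρ ≤ r ∧
      (M * ((ν (Metric.ball x r)).toReal / r ^ s) ≤ (ν (Metric.ball y ρ)).toReal / ρ ^ s ∨
        (ν (Metric.ball y ρ)).toReal / ρ ^ s ≤ M⁻¹ * ((ν (Metric.ball x r)).toReal / r ^ s))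

/-- The Hellinger affinity of `ν` and `μ` over the cells of `q`. -/
def cellAffinity (ν μ : Measure X) (N : Finset X) (q : X → X) : ℝ :=
  ∑ x ∈ N, √(ν.real (q ⁻¹' {x}) * μ.real (q ⁻¹' {x}))

variable {E : Set X} {s C₀ c₁ r r' : ℝ} {N N' : Finset X} {p q q' : X → X}
  {ν μ : Measure X} [IsFiniteMeasure ν] [IsFiniteMeasure μ]

theorem IsCellMap.le_measureReal_fiber (hq : IsCellMap E r N q)
    (hμ : IsADRegularMeasure μ E s C₀) (hr : 0 < r) (hrE : r ≤ diam E) {x : X} (hx : x ∈ N) :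
    C₀⁻¹ * (r / 8) ^ s ≤ μ.real (q ⁻¹' {x}) := by
  refine (hμ.le_real x (hq.subset hx) (r / 8) (by linarith) (by linarith)).trans
    (measureReal_mono_of_inter_subset hμ.null_compl ?_)
  rintro y ⟨hy, hyE⟩
  exact hq.eq_of_dist_lt x hx y hyE ((mem_closedBall.1 hy).trans_lt (by linarith))

theorem IsCellMap.measureReal_fiber_le (hq : IsCellMap E r N q)
    (hμ : IsADRegularMeasure μ E s C₀) (hr : 0 < r) (hrE : r ≤ diam E / 2) {x : X} (hx : x ∈ N) :
    μ.real (q ⁻¹' {x}) ≤ C₀ * (2 * r) ^ s := by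
  refine (measureReal_mono_of_inter_subset hμ.null_compl ?_).trans
    (hμ.real_le x (hq.subset hx) (2 * r) (by linarith) (by linarith))
  rintro y ⟨hy, hyE⟩
  have := hq.dist_le y hyE
  rw [show q y = x from hy, dist_comm] at this
  exact this

theorem IsCellMap.density_le [BorelSpace X] (hq : IsCellMap E r N q)
    (hν : ν Eᶜ = 0) (hμ : IsADRegularMeasure μ E s C₀) {S : Finset X} {l : ℝ} (hl : 0 ≤ l)
    (hS : ∀ z ∈ S, ν.real (q ⁻¹' {z}) ≤ l * μ.real (q ⁻¹' {z})) {y : X} (hy : y ∈ E) {ρ : ℝ}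
    (hρ : 0 < ρ) (hrρ : 4 * r ≤ ρ) (hρE : 2 * ρ ≤ diam E)
    (hyS : ∀ u ∈ ball y ρ ∩ E, q u ∈ S) :
    ν.real (ball y ρ) / ρ ^ s ≤ l * (C₀ * 2 ^ s) := by
  have h : ν.real (ball y ρ) ≤ l * μ.real (closedBall y (2 * ρ)) := by
    refine hq.measureReal_le hν hμ.null_compl hl hS hyS ?_
    rintro u ⟨hu, huE⟩ v hvE huv
    have h1 := hq.dist_le u huE
    have h2 := hq.dist_le v hvE
    rw [huv] at h1
    have h3 := dist_triangle_left v u (q v)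
    have h4 := dist_triangle v u y
    have h5 := mem_ball.1 hu
    rw [mem_closedBall]
    linarith
  rw [div_le_iff₀ (Real.rpow_pos_of_pos hρ s)]
  refine h.trans ((mul_le_mul_of_nonneg_left
    (hμ.real_le y hy (2 * ρ) (by linarith) hρE) hl).trans_eq ?_)
  rw [Real.mul_rpow (by norm_num) hρ.le]
  ring

theorem IsCellMap.le_density [BorelSpace X] (hq : IsCellMap E r N q) (hr : 0 < r)
    (hν : ν Eᶜ = 0) (hμ : IsADRegularMeasure μ E s C₀) {S : Finset X} {l : ℝ} (hl : 0 ≤ l)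
    (hS : ∀ z ∈ S, μ.real (q ⁻¹' {z}) ≤ l * ν.real (q ⁻¹' {z})) {y : X} (hy : y ∈ E) {ρ : ℝ}
    (hρ : 0 < ρ) (hrρ : 8 * r ≤ ρ) (hρE : ρ ≤ diam E)
    (hyS : ∀ u ∈ ball y ρ ∩ E, q u ∈ S) :
    C₀⁻¹ / 4 ^ s ≤ l * (ν.real (ball y ρ) / ρ ^ s) := by
  have h : μ.real (closedBall y (ρ / 4)) ≤ l * ν.real (ball y ρ) := by
    refine hq.measureReal_le hμ.null_compl hν hl hS
      (fun u hu => hyS u ⟨(mem_closedBall.1 hu.1).trans_lt (by linarith), hu.2⟩) ?_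
    rintro u ⟨hu, huE⟩ v hvE huv
    have h1 := hq.dist_le u huE
    have h2 := hq.dist_le v hvE
    rw [huv] at h1
    have h3 := dist_triangle_left v u (q v)
    have h4 := dist_triangle v u y
    have h5 := mem_closedBall.1 hu
    rw [mem_ball]
    linarith
  rw [← mul_div_assoc, le_div_iff₀ (Real.rpow_pos_of_pos hρ s)]
  refine le_trans (le_of_eq ?_) ((hμ.le_real y hy (ρ / 4) (by linarith) (by linarith)).trans h)
  rw [Real.div_rpow hρ.le (by norm_num)]
  ring

/-- Inside any cell, some subcell at a comparable finer scale has an unbalanced density. -/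
theorem exists_unbalanced_subcell [BorelSpace X] (hC₀ : 0 < C₀)
    (hν : ν Eᶜ = 0) (hμ : IsADRegularMeasure μ E s C₀) (hc : 0 < c₁)
    (hjump : HasDensityJumps ν E s (17 * C₀ ^ 2 * 8 ^ s) c₁) (hc1 : c₁ < 1)
    (hr : 0 < r) (hrE : r ≤ diam E / 2) (hq : IsCellMap E r N (p ∘ q'))
    (hq' : IsCellMap E (c₁ / 128 * r) N' q') {x : X} (hx : x ∈ N) {S : Finset X}
    (hS : ∀ y, p (q' y) = x → q' y ∈ S) {A B : ℝ} (hA : 0 < A) (hB : 0 < B) :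
    ∃ z ∈ S, 4 * A * μ.real (q' ⁻¹' {z}) ≤ B * ν.real (q' ⁻¹' {z}) ∨
      4 * B * ν.real (q' ⁻¹' {z}) ≤ A * μ.real (q' ⁻¹' {z}) := by
  by_contra! hbal
  have hl1 : ∀ z ∈ S, ν.real (q' ⁻¹' {z}) ≤ 4 * A / B * μ.real (q' ⁻¹' {z}) := by
    intro z hz
    rw [div_mul_eq_mul_div, le_div_iff₀ hB]
    linarith [(hbal z hz).1]
  have hl2 : ∀ z ∈ S, μ.real (q' ⁻¹' {z}) ≤ 4 * B / A * ν.real (q' ⁻¹' {z}) := by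
    intro z hz
    rw [div_mul_eq_mul_div, le_div_iff₀ hA]
    linarith [(hbal z hz).2]
  have hxE := hq.subset hx
  have hrc : 0 < c₁ * r := mul_pos hc hr
  have hrc1 : c₁ * r < r := by nlinarith
  have hball : ∀ y ∈ ball x (r / 16) ∩ E, ∀ ρ, ρ ≤ r / 16 → ∀ u ∈ ball y ρ ∩ E, q' u ∈ S := by
    intro y hy ρ hρ u hu
    refine hS u (hq.eq_of_dist_lt x hx u hu.2 ?_)
    have h1 := mem_ball.1 hy.1
    have h2 := mem_ball.1 hu.1
    have h3 := dist_triangle u y x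
    linarith
  have hbounds : ∀ y ∈ ball x (r / 16) ∩ E, ∀ ρ, c₁ * (r / 16) ≤ ρ → ρ ≤ r / 16 →
      ν.real (ball y ρ) / ρ ^ s ≤ 4 * A / B * (C₀ * 2 ^ s) ∧
      C₀⁻¹ / 4 ^ s ≤ 4 * B / A * (ν.real (ball y ρ) / ρ ^ s) := fun y hy ρ hρ1 hρ2 =>
    ⟨hq'.density_le hν hμ (by positivity) hl1 hy.2 (by linarith) (by linarith) (by linarith)
      (hball y hy ρ hρ2),
    hq'.le_density (by linarith) hν hμ (by positivity) hl2 hy.2 (by linarith) (by linarith)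
      (by linarith) (hball y hy ρ hρ2)⟩
  obtain ⟨y, ρ, hy, hρ1, hρ2, hor⟩ := hjump x hxE (r / 16) (by linarith) (by linarith)
  obtain ⟨hu1, hl1⟩ := hbounds x ⟨mem_ball_self (by linarith), hxE⟩ (r / 16) (by linarith) le_rfl
  obtain ⟨hu2, hl2⟩ := hbounds y hy ρ hρ1 hρ2
  rw [← measureReal_def, ← measureReal_def] at hor
  set t₁ := ν.real (ball x (r / 16)) / (r / 16) ^ s
  set t₂ := ν.real (ball y ρ) / ρ ^ s
  have hratio : ∀ t t' : ℝ, t ≤ 4 * A / B * (C₀ * 2 ^ s) → C₀⁻¹ / 4 ^ s ≤ 4 * B / A * t' →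
      ¬ 17 * C₀ ^ 2 * 8 ^ s * t' ≤ t := by
    intro t t' ht ht' h
    have h2 : (0 : ℝ) < 2 ^ s := by positivity
    have h4 : (0 : ℝ) < 4 ^ s := by positivity
    have h8 : (8 : ℝ) ^ s = 2 ^ s * 4 ^ s := by
      rw [← Real.mul_rpow (by norm_num) (by norm_num)]; norm_num
    rw [h8] at h
    have e1 : A / (4 * B) * (C₀⁻¹ / 4 ^ s) ≤ t' := by
      calc A / (4 * B) * (C₀⁻¹ / 4 ^ s) ≤ A / (4 * B) * (4 * B / A * t') :=
            mul_le_mul_of_nonneg_left ht' (by positivity)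
        _ = t' := by field_simp
    have e2 : 17 * C₀ ^ 2 * (2 ^ s * 4 ^ s) * (A / (4 * B) * (C₀⁻¹ / 4 ^ s)) ≤
        4 * A / B * (C₀ * 2 ^ s) :=
      (mul_le_mul_of_nonneg_left e1 (by positivity)).trans (h.trans ht)
    have e3 : 17 * C₀ ^ 2 * (2 ^ s * 4 ^ s) * (A / (4 * B) * (C₀⁻¹ / 4 ^ s)) =
        17 / 16 * (4 * A / B * (C₀ * 2 ^ s)) := by
      field_simp
      ring
    have e4 : 0 < 4 * A / B * (C₀ * 2 ^ s) := by positivity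
    linarith
  rcases hor with h | h
  · exact hratio _ _ hu2 hl1 h
  · refine hratio _ _ hu1 hl2 ?_
    have hM : 0 < 17 * C₀ ^ 2 * 8 ^ s := by positivity
    rwa [← div_eq_inv_mul, le_div_iff₀ hM, mul_comm] at h

/-- Refining the cells by a factor `c₁ / 128` decreases the affinity by a definite factor. -/
theorem cellAffinity_le_mul [BorelSpace X] (hC₀ : 0 < C₀) (hν : ν Eᶜ = 0)
    (hμ : IsADRegularMeasure μ E s C₀) (hc : 0 < c₁) (hc1 : c₁ < 1)
    (hjump : HasDensityJumps ν E s (17 * C₀ ^ 2 * 8 ^ s) c₁)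
    (hr : 0 < r) (hrE : r ≤ diam E / 2) (hq : IsCellMap E r N (p ∘ q'))
    (hq' : IsCellMap E (c₁ / 128 * r) N' q') :
    cellAffinity ν μ N' q' ≤
      (1 - C₀⁻¹ ^ 2 * (c₁ / 2048) ^ s / 8) * cellAffinity ν μ N (p ∘ q') := by
  classical
  have hr' : 0 < c₁ / 128 * r := by positivity
  have hr'E : c₁ / 128 * r ≤ diam E := by nlinarith
  have hmaps : ∀ z ∈ N', p z ∈ N := by
    intro z hz
    have := hq.mem z
    rwa [Function.comp_apply, hq'.eq_of_dist_lt z hz z (hq'.subset hz)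
      (by rw [dist_self]; linarith)] at this
  unfold cellAffinity
  rw [← Finset.sum_fiberwise_of_maps_to hmaps, Finset.mul_sum]
  refine Finset.sum_le_sum fun x hx => ?_
  set S := N'.filter fun z => p z = x
  have hfib : ∀ m : Measure X, IsFiniteMeasure m →
      ∑ z ∈ S, m.real (q' ⁻¹' {z}) = m.real ((p ∘ q') ⁻¹' {x}) := by
    intro m _
    rw [sum_measureReal_preimage_singleton S fun z _ =>
      hq'.measurable (measurableSet_singleton z)]
    congr 1
    ext y
    simp [S, hq'.mem y]
  have hSmem : ∀ y, p (q' y) = x → q' y ∈ S := fun y hy =>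
    Finset.mem_filter.2 ⟨hq'.mem y, hy⟩
  have hBpos : 0 < μ.real ((p ∘ q') ⁻¹' {x}) :=
    lt_of_lt_of_le (by positivity) (hq.le_measureReal_fiber hμ hr (by linarith) hx)
  rcases (measureReal_nonneg (μ := ν) (s := (p ∘ q') ⁻¹' {x})).eq_or_lt with hA | hA
  · have hz : ∀ z ∈ S, ν.real (q' ⁻¹' {z}) = 0 := by
      rw [← Finset.sum_eq_zero_iff_of_nonneg fun z _ => measureReal_nonneg, hfib ν inferInstance,
        hA]
    rw [Finset.sum_eq_zero fun z hz' => by rw [hz z hz', zero_mul, Real.sqrt_zero], ← hA]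
    simp
  · obtain ⟨z, hz, hgap⟩ := exists_unbalanced_subcell hC₀ hν hμ hc hjump hc1 hr hrE hq hq' hx
      hSmem hA hBpos
    rw [← hfib ν inferInstance, ← hfib μ inferInstance] at hgap ⊢
    rw [← hfib ν inferInstance] at hA
    have hBpos' := hBpos
    rw [← hfib μ inferInstance] at hBpos'
    refine sum_sqrt_mul_le_of_unbalanced hz (fun _ _ => measureReal_nonneg)
      (fun _ _ => measureReal_nonneg) hA hBpos' hgap ?_
    rw [hfib μ inferInstance]
    calc C₀⁻¹ ^ 2 * (c₁ / 2048) ^ s * μ.real ((p ∘ q') ⁻¹' {x})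
        ≤ C₀⁻¹ ^ 2 * (c₁ / 2048) ^ s * (C₀ * (2 * r) ^ s) :=
          mul_le_mul_of_nonneg_left (hq.measureReal_fiber_le hμ hr hrE hx) (by positivity)
      _ = C₀⁻¹ * (c₁ / 128 * r / 8) ^ s := by
          rw [show c₁ / 128 * r / 8 = c₁ / 2048 * (2 * r) by ring,
            Real.mul_rpow (x := c₁ / 2048) (by positivity) (by positivity)]
          generalize (c₁ / 2048) ^ s = t, (2 * r) ^ s = t'
          field_simp
      _ ≤ _ := hq'.le_measureReal_fiber hμ hr' hr'E (Finset.mem_filter.1 hz).1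

theorem cellAffinity_le_sqrt [BorelSpace X] (hq : IsCellMap E r N q) :
    cellAffinity ν μ N q ≤ √(ν.real univ) * √(μ.real univ) := by
  have h : ∀ m : Measure X, IsFiniteMeasure m → ∑ z ∈ N, m.real (q ⁻¹' {z}) ≤ m.real univ := by
    intro m _
    rw [sum_measureReal_preimage_singleton N fun z _ =>
      hq.measurable (measurableSet_singleton z)]
    exact measureReal_mono (subset_univ _)
  unfold cellAffinity
  calc ∑ x ∈ N, √(ν.real (q ⁻¹' {x}) * μ.real (q ⁻¹' {x}))
      = ∑ x ∈ N, √(ν.real (q ⁻¹' {x})) * √(μ.real (q ⁻¹' {x})) :=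
        Finset.sum_congr rfl fun x _ => Real.sqrt_mul measureReal_nonneg _
    _ ≤ √(∑ x ∈ N, ν.real (q ⁻¹' {x})) * √(∑ x ∈ N, μ.real (q ⁻¹' {x})) :=
        Real.sum_sqrt_mul_sqrt_le _ (fun _ => measureReal_nonneg) fun _ => measureReal_nonneg
    _ ≤ _ := mul_le_mul (Real.sqrt_le_sqrt (h ν inferInstance))
        (Real.sqrt_le_sqrt (h μ inferInstance)) (Real.sqrt_nonneg _) (Real.sqrt_nonneg _)

/-- The affinity decays geometrically with the scale. -/
theorem cellAffinity_le_pow [BorelSpace X] (hC₀ : 0 < C₀) (hE : IsCompact E) (hne : E.Nonempty)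
    (hν : ν Eᶜ = 0) (hμ : IsADRegularMeasure μ E s C₀) (hc : 0 < c₁) (hc1 : c₁ < 1)
    (hjump : HasDensityJumps ν E s (17 * C₀ ^ 2 * 8 ^ s) c₁) (hr : 0 < r)
    (hrE : r ≤ diam E / 2) (hθ : 0 ≤ 1 - C₀⁻¹ ^ 2 * (c₁ / 2048) ^ s / 8) (k : ℕ)
    (hq : IsCellMap E ((c₁ / 128) ^ k * r) N q) :
    cellAffinity ν μ N q ≤
      (1 - C₀⁻¹ ^ 2 * (c₁ / 2048) ^ s / 8) ^ k * (√(ν.real univ) * √(μ.real univ)) := by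
  induction k generalizing N q with
  | zero => simpa using cellAffinity_le_sqrt hq
  | succ k ih =>
    have hpos : 0 < (c₁ / 128) ^ k * r := by positivity
    have hle : (c₁ / 128) ^ k * r ≤ diam E / 2 :=
      (mul_le_of_le_one_left hr.le (pow_le_one₀ (by positivity) (by linarith))).trans hrE
    rw [show (c₁ / 128) ^ (k + 1) * r = c₁ / 128 * ((c₁ / 128) ^ k * r) by ring] at hq
    obtain ⟨N₁, p, hp⟩ := hq.exists_coarse hE hne hpos (by nlinarith)
    refine (cellAffinity_le_mul hC₀ hν hμ hc hc1 hjump hpos hle hp hq).trans ?_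
    rw [pow_succ' (1 - _) k, mul_assoc]
    exact mul_le_mul_of_nonneg_left (ih hp) hθ

end Regular

section Dimension

open Filter Topology

variable {X : Type*} [MetricSpace X] [MeasurableSpace X] [BorelSpace X]

theorem measDim_eq_zero_of_subsingleton {E : Set X} {ν : Measure X}
    (hE : E.Subsingleton) (hν : ν Eᶜ = 0) : measDim ν = 0 :=
  nonpos_iff_eq_zero.1 <| iInf_le_of_le E <| iInf_le_of_le hE.measurableSet <|
    iInf_le_of_le hν (dimH_subsingleton hE).le

theorem dimH_le_of_card_mul_pow_le {F : Set X} {d : NNReal} {C : ℝ} {ρ : ℕ → ℝ}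
    (hρ : Tendsto ρ atTop (𝓝 0)) (hρ0 : ∀ k, 0 ≤ ρ k) {G : ℕ → Finset X}
    (hF : ∀ᶠ k in atTop, F ⊆ ⋃ x : G k, closedBall (x : X) (ρ k))
    (hC : ∀ k, ((G k).card : ℝ) * (2 * ρ k) ^ (d : ℝ) ≤ C) : dimH F ≤ d := by
  refine dimH_le_of_hausdorffMeasure_ne_top (ne_top_of_le_ne_top (b := ENNReal.ofReal C)
    ENNReal.ofReal_ne_top ?_)
  have hdiam : ∀ k, ∀ x : G k, ediam (closedBall (x : X) (ρ k)) ≤ ENNReal.ofReal (2 * ρ k) := by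
    intro k x
    refine Metric.ediam_le_of_forall_dist_le fun y hy z hz => ?_
    have := dist_triangle_right y z x
    rw [mem_closedBall] at hy hz
    linarith
  refine (Measure.hausdorffMeasure_le_liminf_sum (l := atTop) d F
    (fun k => ENNReal.ofReal (2 * ρ k)) ?_
    (fun k (x : G k) => closedBall (x : X) (ρ k)) (Eventually.of_forall hdiam) hF).trans ?_
  · simpa using ENNReal.tendsto_ofReal (hρ.const_mul 2)
  · refine liminf_le_of_le (by isBoundedDefault) fun b hb => ?_
    obtain ⟨k, hk⟩ := hb.exists
    refine hk.trans (le_trans ?_ (ENNReal.ofReal_le_ofReal (hC k)))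
    calc ∑ x : G k, ediam (closedBall (x : X) (ρ k)) ^ (d : ℝ)
        ≤ ∑ _x : G k, ENNReal.ofReal (2 * ρ k) ^ (d : ℝ) :=
          Finset.sum_le_sum fun x _ => ENNReal.rpow_le_rpow (hdiam k x) d.coe_nonneg
      _ = ENNReal.ofReal ((G k).card * (2 * ρ k) ^ (d : ℝ)) := by
          rw [Finset.sum_const, Finset.card_univ, Fintype.card_coe, nsmul_eq_mul,
            ENNReal.ofReal_rpow_of_nonneg (by linarith [hρ0 k]) d.coe_nonneg,
            ENNReal.ofReal_mul (by positivity), ENNReal.ofReal_natCast]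

variable {E : Set X} {s C₀ c₁ r t : ℝ} {N : Finset X} {q : X → X}
  {ν μ : Measure X} [IsFiniteMeasure ν] [IsFiniteMeasure μ]

theorem IsCellMap.measureReal_light_le (hq : IsCellMap E r N q)
    (hμ : IsADRegularMeasure μ E s C₀) (hC₀ : 0 < C₀) (hr : 0 < r) (hrE : r ≤ diam E) :
    ν.real (q ⁻¹' (N.filter fun x => ν.real (q ⁻¹' {x}) ≤ t)) ≤
      √(t / (C₀⁻¹ * (r / 8) ^ s)) * cellAffinity ν μ N q := by
  rw [← sum_measureReal_preimage_singleton _ fun z _ =>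
    hq.measurable (measurableSet_singleton z), cellAffinity, Finset.mul_sum]
  refine le_trans (Finset.sum_le_sum fun x hx => ?_) (Finset.sum_le_sum_of_subset_of_nonneg
    (Finset.filter_subset _ N) fun x _ _ => by positivity)
  obtain ⟨hxN, hxt⟩ := Finset.mem_filter.1 hx
  have hm : 0 < C₀⁻¹ * (r / 8) ^ s := by positivity
  have hle := hq.le_measureReal_fiber hμ hr hrE hxN
  have h0 : 0 ≤ ν.real (q ⁻¹' {x}) := measureReal_nonneg
  have ht : 0 ≤ t := h0.trans hxt
  rw [← Real.sqrt_mul (by positivity)]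
  refine Real.le_sqrt_of_sq_le ?_
  rw [sq, mul_comm (_ / _), mul_assoc]
  refine mul_le_mul_of_nonneg_left (hxt.trans ?_) h0
  rw [mul_div_assoc', le_div_iff₀ hm, mul_comm]
  exact mul_le_mul_of_nonneg_right hle ht

theorem IsCellMap.card_heavy_mul_le (hq : IsCellMap E r N q) :
    ((N.filter fun x => ¬ ν.real (q ⁻¹' {x}) ≤ t).card : ℝ) * t ≤ ν.real univ := by
  calc _ ≤ ∑ x ∈ N.filter fun x => ¬ ν.real (q ⁻¹' {x}) ≤ t, ν.real (q ⁻¹' {x}) := by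
        rw [← nsmul_eq_mul]
        exact Finset.card_nsmul_le_sum _ _ _ fun x hx => (not_le.1 (Finset.mem_filter.1 hx).2).le
    _ = _ := sum_measureReal_preimage_singleton _ fun z _ =>
        hq.measurable (measurableSet_singleton z)
    _ ≤ _ := measureReal_mono (subset_univ _)

theorem exists_exponent_lt {δ θ : ℝ} (hδ : 0 < δ) (hs : 0 < s) (hθ1 : θ < 1) :
    ∃ d : NNReal, (d : ℝ) < s ∧ √(δ ^ ((d : ℝ) - s)) * θ < 1 := by
  have hcont : ContinuousAt (fun d : ℝ => √(δ ^ (d - s)) * θ) s :=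
    ((Real.continuous_sqrt.comp (Real.continuous_const_rpow hδ.ne' |>.comp
      (continuous_id.sub continuous_const))).mul continuous_const).continuousAt
  have hev : ∀ᶠ d in 𝓝[<] s, √(δ ^ (d - s)) * θ < 1 :=
    (hcont.eventually_lt_const (by simpa using hθ1)).filter_mono nhdsWithin_le_nhds
  have hpos : ∀ᶠ d in 𝓝[<] s, 0 < d := (lt_mem_nhds hs).filter_mono nhdsWithin_le_nhds
  obtain ⟨d, ⟨hd1, hd0⟩, hds⟩ := ((hev.and hpos).and self_mem_nhdsWithin).exists
  exact ⟨⟨d, hd0.le⟩, hds, hd1⟩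

theorem measDim_lt_of_hasDensityJumps (hs : 0 < s) (hC₀ : 1 ≤ C₀) (hE : IsCompact E)
    (hdiam : 0 < diam E) (hν : ν Eᶜ = 0) (hμ : IsADRegularMeasure μ E s C₀) (hc : 0 < c₁)
    (hc1 : c₁ < 1) (hjump : HasDensityJumps ν E s (17 * C₀ ^ 2 * 8 ^ s) c₁) :
    measDim ν < ENNReal.ofReal s := by
  have hC0 : 0 < C₀ := by linarith
  have hne : E.Nonempty := by
    rw [Set.nonempty_iff_ne_empty]
    rintro rfl
    simp at hdiam
  set δ := c₁ / 128 with hδdef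
  have hδ : 0 < δ := by positivity
  have hδ1 : δ < 1 := by linarith
  set θ := 1 - C₀⁻¹ ^ 2 * (c₁ / 2048) ^ s / 8 with hθdef
  have hgain : 0 < C₀⁻¹ ^ 2 * (c₁ / 2048) ^ s := by positivity
  have hgain1 : C₀⁻¹ ^ 2 * (c₁ / 2048) ^ s ≤ 1 :=
    mul_le_one₀ (pow_le_one₀ (by positivity) (inv_le_one_of_one_le₀ hC₀)) (by positivity)
      (Real.rpow_le_one (by positivity) (by linarith) hs.le)
  have hθ0 : 0 ≤ θ := by linarith
  have hθ1 : θ < 1 := by linarith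
  obtain ⟨d, hds, hκ⟩ := exists_exponent_lt hδ hs hθ1
  set D := diam E / 2 with hD
  have hDpos : 0 < D := by positivity
  set R : ℕ → ℝ := fun k => δ ^ k * D with hR
  have hRpos : ∀ k, 0 < R k := fun k => by positivity
  have hRle : ∀ k, R k ≤ diam E := fun k =>
    (mul_le_of_le_one_left hDpos.le (pow_le_one₀ hδ.le hδ1.le)).trans (by linarith)
  choose N q hq using fun k => exists_isCellMap hE hne (hRpos k)
  set light : ℕ → Set X := fun k =>
    q k ⁻¹' ((N k).filter fun x => ν.real (q k ⁻¹' {x}) ≤ R k ^ (d : ℝ)) with hlight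
  have hlightm : ∀ k, MeasurableSet (light k) := fun k =>
    (hq k).measurable (Finset.measurableSet _)
  set T := √(ν.real univ) * √(μ.real univ)
  set A := √(C₀ * 8 ^ s * D ^ ((d : ℝ) - s)) * T with hA
  have hmass : ∀ k, ν.real (light k) ≤ A * (√(δ ^ ((d : ℝ) - s)) * θ) ^ k := by
    intro k
    refine ((hq k).measureReal_light_le hμ hC0 (hRpos k) (hRle k)).trans ?_
    refine (mul_le_mul_of_nonneg_left (cellAffinity_le_pow hC0 hE hne hν hμ hc hc1 hjump hDpos
      le_rfl hθ0 k (hq k)) (Real.sqrt_nonneg _)).trans_eq ?_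
    have e1 : R k ^ (d : ℝ) / (C₀⁻¹ * (R k / 8) ^ s) =
        C₀ * 8 ^ s * D ^ ((d : ℝ) - s) * (δ ^ ((d : ℝ) - s)) ^ k := by
      have e2 : R k ^ ((d : ℝ) - s) = (δ ^ ((d : ℝ) - s)) ^ k * D ^ ((d : ℝ) - s) := by
        rw [hR, Real.mul_rpow (by positivity) hDpos.le, ← Real.rpow_natCast,
          ← Real.rpow_natCast, ← Real.rpow_mul hδ.le, ← Real.rpow_mul hδ.le, mul_comm (k : ℝ)]
      rw [mul_assoc (C₀ * 8 ^ s), mul_comm (D ^ _), ← e2, Real.rpow_sub (hRpos k),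
        Real.div_rpow (hRpos k).le (by norm_num)]
      have := Real.rpow_pos_of_pos (hRpos k) s
      field_simp
    have e3 : √((δ ^ ((d : ℝ) - s)) ^ k) = √(δ ^ ((d : ℝ) - s)) ^ k := by
      rw [Real.sqrt_eq_iff_mul_self_eq (by positivity) (by positivity), ← mul_pow,
        Real.mul_self_sqrt (by positivity)]
    rw [e1, Real.sqrt_mul (by positivity), e3, mul_pow, hA]
    ring
  have hsum : ∑' k, ν (light k) ≠ ∞ := by
    have hκ0 : 0 ≤ √(δ ^ ((d : ℝ) - s)) * θ := by positivity
    refine ne_top_of_le_ne_top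
      ((summable_geometric_of_lt_one hκ0 hκ).mul_left A).tsum_ofReal_ne_top
      (ENNReal.tsum_le_tsum fun k => ?_)
    rw [← ofReal_measureReal]
    exact ENNReal.ofReal_le_ofReal (hmass k)
  have hlim := measure_limsup_atTop_eq_zero hsum
  set F := E ∩ (limsup light atTop)ᶜ
  have hFm : MeasurableSet F :=
    hE.measurableSet.inter (MeasurableSet.measurableSet_limsup hlightm).compl
  have hFnull : ν Fᶜ = 0 := by
    rw [Set.compl_inter, compl_compl]
    exact measure_union_null hν hlim
  have hFdim : dimH F ≤ d := by
    have hFsub : F ⊆ ⋃ m : ℕ, {y ∈ E | ∀ k ≥ m, y ∉ light k} := by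
      rintro y ⟨hyE, hy⟩
      rw [Set.mem_compl_iff, mem_limsup_iff_frequently_mem, not_frequently,
        eventually_atTop] at hy
      obtain ⟨m, hm⟩ := hy
      exact Set.mem_iUnion.2 ⟨m, hyE, hm⟩
    refine (dimH_mono hFsub).trans ?_
    rw [dimH_iUnion]
    refine iSup_le fun m => ?_
    refine dimH_le_of_card_mul_pow_le (C := 4 ^ (d : ℝ) * ν.real univ) (ρ := fun k => 2 * R k)
      (G := fun k => (N k).filter fun x => ¬ ν.real (q k ⁻¹' {x}) ≤ R k ^ (d : ℝ)) ?_
      (fun k => by linarith [hRpos k]) ?_ fun k => ?_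
    · simpa using ((tendsto_pow_atTop_nhds_zero_of_lt_one hδ.le hδ1).mul_const D).const_mul 2
    · filter_upwards [eventually_ge_atTop m] with k hk y hy
      have hyl := hy.2 k hk
      simp only [hlight, Set.mem_preimage, Finset.mem_coe, Finset.mem_filter,
        (hq k).mem y, true_and] at hyl
      refine Set.mem_iUnion.2 ⟨⟨q k y, Finset.mem_filter.2 ⟨(hq k).mem y, hyl⟩⟩, ?_⟩
      rw [mem_closedBall, dist_comm]
      exact (hq k).dist_le y hy.1
    · rw [show 2 * (2 * R k) = 4 * R k by ring, Real.mul_rpow (by norm_num) (hRpos k).le,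
        mul_left_comm]
      exact mul_le_mul_of_nonneg_left (hq k).card_heavy_mul_le (by positivity)
  calc measDim ν ≤ dimH F := iInf_le_of_le F (iInf_le_of_le hFm (iInf_le _ hFnull))
    _ ≤ d := hFdim
    _ < ENNReal.ofReal s := by rwa [← ENNReal.ofReal_coe_nnreal, ENNReal.ofReal_lt_ofReal_iff hs]

theorem ADRegular.exists_isADRegularMeasure (hE : ADRegular s C₀ E) (hEc : IsCompact E)
    (hdiam : 0 < diam E) (hC₀ : 0 < C₀) :
    ∃ μ : Measure X, IsFiniteMeasure μ ∧ IsADRegularMeasure μ E s C₀ := by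
  obtain ⟨x, hx⟩ : E.Nonempty := by
    rw [Set.nonempty_iff_ne_empty]
    rintro rfl
    simp at hdiam
  have hfin : μH[s] E < ∞ := by
    have hsub : E ⊆ E ∩ closedBall x (diam E) := fun y hy =>
      ⟨hy, dist_le_diam_of_mem hEc.isBounded hy hx⟩
    exact (measure_mono hsub).trans_lt
      ((hE x hx _ hdiam le_rfl).2.trans_lt ENNReal.ofReal_lt_top)
  have hfinite : IsFiniteMeasure ((μH[s] : Measure X).restrict E) :=
    ⟨by rwa [Measure.restrict_apply_univ]⟩
  have happ : ∀ y ρ, ((μH[s] : Measure X).restrict E) (closedBall y ρ) =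
      μH[s] (E ∩ closedBall y ρ) := fun y ρ => by
    rw [Measure.restrict_apply measurableSet_closedBall, Set.inter_comm]
  refine ⟨(μH[s] : Measure X).restrict E, hfinite, ?_, fun y hy ρ hρ hρE => ?_,
    fun y hy ρ hρ hρE => ?_⟩
  · rw [Measure.restrict_apply hEc.measurableSet.compl, Set.compl_inter_self, measure_empty]
  · have h := (hE y hy ρ hρ hρE).1
    rw [← happ] at h
    exact (ENNReal.ofReal_le_iff_le_toReal (measure_ne_top _ _)).1 h
  · have h := (hE y hy ρ hρ hρE).2
    rw [← happ] at h
    exact ENNReal.toReal_le_of_le_ofReal (by positivity) h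

end Dimension


/-- Bourgain's dimension-drop criterion. If at every location and scale
a measure `ν` on an `(s,C₀)`-AD regular set `E` has a ball of comparable size on which
its `s`-density jumps up by a factor `M` or drops by `M⁻¹`, then `dim ν < s`. -/
theorem stmt13 (n : ℕ) (hn : 1 ≤ n) (s C₀ : ℝ) (hs : 0 < s) (hsn : s < n) (hC₀ : 1 < C₀) :
    ∃ M : ℝ, 1 < M ∧
      ∀ E : Set (EuclideanSpace ℝ (Fin (n + 1))), IsCompact E → ADRegular s C₀ E →
        ∀ ν : Measure (EuclideanSpace ℝ (Fin (n + 1))), IsFiniteMeasure ν → ν Eᶜ = 0 →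
          ∀ c₁ ∈ Set.Ioo (0 : ℝ) 1,
            (∀ x ∈ E, ∀ r : ℝ, 0 < r → r ≤ Metric.diam E →
              ∃ y ρ, y ∈ Metric.ball x r ∩ E ∧ c₁ * r ≤ ρ ∧ ρ ≤ r ∧
                (M * ((ν (Metric.ball x r)).toReal / r ^ s) ≤
                    (ν (Metric.ball y ρ)).toReal / ρ ^ s ∨
                  (ν (Metric.ball y ρ)).toReal / ρ ^ s ≤
                    M⁻¹ * ((ν (Metric.ball x r)).toReal / r ^ s))) →
            measDim ν < ENNReal.ofReal s := by
  have h8 : 1 ≤ (8 : ℝ) ^ s := Real.one_le_rpow (by norm_num) hs.le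
  refine ⟨17 * C₀ ^ 2 * 8 ^ s, by nlinarith [one_lt_pow₀ hC₀ two_ne_zero], ?_⟩
  intro E hEc hE ν hνfin hν c₁ hc hjump
  rcases (Metric.diam_nonneg (s := E)).eq_or_lt with hdiam | hdiam
  · have hsub : E.Subsingleton := fun x hx y hy =>
      dist_le_zero.1 ((dist_le_diam_of_mem hEc.isBounded hx hy).trans hdiam.ge)
    rw [measDim_eq_zero_of_subsingleton hsub hν]
    exact ENNReal.ofReal_pos.2 hs
  · obtain ⟨μ, hμfin, hμ⟩ := hE.exists_isADRegularMeasure hEc hdiam (by linarith)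
    exact measDim_lt_of_hasDensityJumps hs hC₀.le hEc hdiam hν hμ hc.1 hc.2 hjump
end
end

section
/- Let n > 1, r > 0, E = (B(0,2r) \ B(0,r)) ∩ (ℝⁿ × {0}) ⊂ ℝ^{n+1}, and Ω = ℝ^{n+1} \ E. Let B be a ball centered in E with radius ρ ≤ r/2 satisfying ρ ≈ dist(B, ∂B(0,r)) (with fixed comparability constants). Then the harmonic measure with pole at the origin satisfies ω⁰(B) ≥ c·(ρ/r)^{n−1/2}, where c > 0 depends only on n and the comparability constants. -/
open Set Metric MeasureTheory ENNReal Filter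

noncomputable section

/-- A function is harmonic on a set `s ⊆ ℝ^m`. -/
def IsHarmonicOn {m : ℕ} (f : EuclideanSpace ℝ (Fin m) → ℝ)
    (s : Set (EuclideanSpace ℝ (Fin m))) : Prop :=
  ContDiffOn ℝ 2 f s ∧
  ∀ x ∈ s,
    ∑ i : Fin m,
      fderiv ℝ (fun y => fderiv ℝ f y (EuclideanSpace.single i 1)) x
        (EuclideanSpace.single i 1) = 0

/-- `ω` is the harmonic measure of the open set `Ω ⊆ ℝ^m` with pole `p ∈ Ω`:
it is a (sub)probability measure carried by `∂Ω` reproducing at `p` the boundary values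
of bounded harmonic functions (which, when `m ≥ 3`, vanish at infinity). -/
def IsHarmonicMeasure {m : ℕ} (Ω : Set (EuclideanSpace ℝ (Fin m)))
    (p : EuclideanSpace ℝ (Fin m)) (ω : Measure (EuclideanSpace ℝ (Fin m))) : Prop :=
  ω (frontier Ω)ᶜ = 0 ∧ ω Set.univ ≤ 1 ∧
  ∀ f : EuclideanSpace ℝ (Fin m) → ℝ, Continuous f → Bornology.IsBounded (Set.range f) →
    IsHarmonicOn f Ω →
    (3 ≤ m → Tendsto f (Bornology.cobounded (EuclideanSpace ℝ (Fin m))) (nhds 0)) →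
    f p = ∫ x, f x ∂ω

open scoped Topology

section SecondDerivatives

/-- `f` is differentiable near `0` with first derivative `a` and second derivative `b` at `0`. -/
def HasSecondDeriv {F : Type*} [NormedAddCommGroup F] [NormedSpace ℝ F]
    (f : ℝ → F) (a b : F) : Prop :=
  ∃ d : ℝ → F, (∀ᶠ s in 𝓝 0, HasDerivAt f (d s) s) ∧ d 0 = a ∧ HasDerivAt d b 0

namespace HasSecondDeriv

variable {F : Type*} [NormedAddCommGroup F] [NormedSpace ℝ F] {f g : ℝ → F} {a b a' b' : F}

lemma const (c : F) : HasSecondDeriv (fun _ => c) 0 0 :=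
  ⟨fun _ => 0, .of_forall fun s => hasDerivAt_const s c, rfl, hasDerivAt_const 0 0⟩

lemma id : HasSecondDeriv (fun s : ℝ => s) 1 0 :=
  ⟨fun _ => 1, .of_forall hasDerivAt_id', rfl, hasDerivAt_const 0 1⟩

lemma add (hf : HasSecondDeriv f a b) (hg : HasSecondDeriv g a' b') :
    HasSecondDeriv (fun s => f s + g s) (a + a') (b + b') := by
  obtain ⟨d, h1, h2, h3⟩ := hf
  obtain ⟨e, k1, k2, k3⟩ := hg
  exact ⟨fun s => d s + e s, by filter_upwards [h1, k1] with s hs ks using hs.add ks,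
    by simp [h2, k2], h3.add k3⟩

lemma clm_comp {G : Type*} [NormedAddCommGroup G] [NormedSpace ℝ G] (L : F →L[ℝ] G)
    (hf : HasSecondDeriv f a b) : HasSecondDeriv (fun s => L (f s)) (L a) (L b) := by
  obtain ⟨d, h1, h2, h3⟩ := hf
  exact ⟨fun s => L (d s),
    by filter_upwards [h1] with s hs using L.hasFDerivAt.comp_hasDerivAt s hs,
    by simp [h2], L.hasFDerivAt.comp_hasDerivAt 0 h3⟩

lemma const_mul {f : ℝ → ℝ} {a b : ℝ} (c : ℝ) (hf : HasSecondDeriv f a b) :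
    HasSecondDeriv (fun s => c * f s) (c * a) (c * b) := by
  simpa using hf.clm_comp (c • ContinuousLinearMap.id ℝ ℝ)

lemma congr (hf : HasSecondDeriv f a b) (h : f =ᶠ[𝓝 0] g) : HasSecondDeriv g a b := by
  obtain ⟨d, h1, h2, h3⟩ := hf
  refine ⟨d, ?_, h2, h3⟩
  filter_upwards [h1, h.eventuallyEq_nhds] with s hs ks using hs.congr_of_eventuallyEq ks.symm

lemma congr_val (hf : HasSecondDeriv f a b) (ha : a = a') (hb : b = b') :
    HasSecondDeriv f a' b' := ha ▸ hb ▸ hf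

lemma mul {A : Type*} [NormedRing A] [NormedAlgebra ℝ A] {f g : ℝ → A} {a b a' b' : A}
    (hf : HasSecondDeriv f a b) (hg : HasSecondDeriv g a' b') :
    HasSecondDeriv (fun s => f s * g s) (a * g 0 + f 0 * a')
      ((b * g 0 + a * a') + (a * a' + f 0 * b')) := by
  obtain ⟨d, h1, rfl, h3⟩ := hf
  obtain ⟨e, k1, rfl, k3⟩ := hg
  exact ⟨fun s => d s * g s + f s * e s,
    by filter_upwards [h1, k1] with s hs ks using hs.mul ks, rfl,
    (h3.mul k1.self_of_nhds).add (h1.self_of_nhds.mul k3)⟩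

lemma scomp {𝕜 : Type*} [RCLike 𝕜] {f : ℝ → 𝕜} {a b : 𝕜} (hf : HasSecondDeriv f a b)
    {φ φ' : 𝕜 → 𝕜} {c : 𝕜} (h1 : ∀ᶠ y in 𝓝 (f 0), HasDerivAt φ (φ' y) y)
    (h2 : HasDerivAt φ' c (f 0)) :
    HasSecondDeriv (fun s => φ (f s)) (φ' (f 0) * a) (c * a ^ 2 + φ' (f 0) * b) := by
  obtain ⟨d, k1, rfl, k3⟩ := hf
  have hc : Tendsto f (𝓝 0) (𝓝 (f 0)) := k1.self_of_nhds.continuousAt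
  refine ⟨fun s => φ' (f s) * d s, ?_, rfl, ?_⟩
  · filter_upwards [k1, hc.eventually h1] with s hs ks
    simpa [Function.comp_def, mul_comm] using HasDerivAt.scomp s ks hs
  · have h3 := (HasDerivAt.scomp (0 : ℝ) h2 k1.self_of_nhds).mul k3
    rw [show c * d 0 ^ 2 + φ' (f 0) * b = d 0 • c * d 0 + φ' (f 0) * b by
      rw [smul_eq_mul]; ring]
    exact h3

lemma unique (hf : HasSecondDeriv f a b) (hf' : HasSecondDeriv f a' b') : b = b' := by
  obtain ⟨d, h1, -, h3⟩ := hf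
  obtain ⟨e, k1, -, k3⟩ := hf'
  have : d =ᶠ[𝓝 0] e := by filter_upwards [h1, k1] with s hs ks using hs.unique ks
  exact h3.unique (k3.congr_of_eventuallyEq this)

lemma nonneg_of_isLocalMin {f : ℝ → ℝ} {a b : ℝ} (hf : HasSecondDeriv f a b)
    (hmin : IsLocalMin f 0) : 0 ≤ b := by
  by_contra! hb
  obtain ⟨d, h1, h2, h3⟩ := hf
  have e1 : deriv f =ᶠ[𝓝 0] d := by filter_upwards [h1] with s hs using hs.deriv
  have hd0 : deriv f 0 = 0 := hmin.deriv_eq_zero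
  have e2 : deriv (deriv f) 0 = b := by rw [e1.deriv_eq, h3.deriv]
  have hmax := isLocalMax_of_deriv_deriv_neg (f := f) (x₀ := 0) (by rw [e2]; exact hb) hd0
    h1.self_of_nhds.continuousAt
  have e3 : f =ᶠ[𝓝 0] fun _ => f 0 := by
    filter_upwards [hmin, hmax] with s hs ks using le_antisymm ks hs
  have : deriv (deriv f) 0 = 0 := by
    rw [(e3.deriv).deriv_eq]; simp
  linarith

end HasSecondDeriv

/-- The sum of the pure second derivatives of `u` at `x` along the coordinate axes is `L`. -/
def HasLaplacianAt {m : ℕ} {F : Type*} [NormedAddCommGroup F] [NormedSpace ℝ F]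
    (u : EuclideanSpace ℝ (Fin m) → F) (L : F) (x : EuclideanSpace ℝ (Fin m)) : Prop :=
  ∃ a b : Fin m → F,
    (∀ i, HasSecondDeriv (fun s => u (x + s • EuclideanSpace.single i (1 : ℝ))) (a i) (b i)) ∧
      ∑ i, b i = L

namespace HasLaplacianAt

variable {m : ℕ} {u v : EuclideanSpace ℝ (Fin m) → ℝ} {L M : ℝ} {x : EuclideanSpace ℝ (Fin m)}

lemma const (c : ℝ) : HasLaplacianAt (fun _ => c) 0 x :=
  ⟨0, 0, fun _ => .const c, by simp⟩

lemma add (hu : HasLaplacianAt u L x) (hv : HasLaplacianAt v M x) :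
    HasLaplacianAt (fun y => u y + v y) (L + M) x := by
  obtain ⟨a, b, h, rfl⟩ := hu
  obtain ⟨a', b', h', rfl⟩ := hv
  exact ⟨a + a', b + b', fun i => (h i).add (h' i), by simp [Finset.sum_add_distrib]⟩

lemma const_mul (c : ℝ) (hu : HasLaplacianAt u L x) :
    HasLaplacianAt (fun y => c * u y) (c * L) x := by
  obtain ⟨a, b, h, rfl⟩ := hu
  exact ⟨fun i => c * a i, fun i => c * b i, fun i => (h i).const_mul c, by
    simp [Finset.mul_sum]⟩

lemma tendsto_line (x e : EuclideanSpace ℝ (Fin m)) :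
    Tendsto (fun s : ℝ => x + s • e) (𝓝 0) (𝓝 x) := by
  have : Continuous fun s : ℝ => x + s • e := by fun_prop
  simpa using this.tendsto 0

lemma congr (hu : HasLaplacianAt u L x) (h : u =ᶠ[𝓝 x] v) : HasLaplacianAt v L x := by
  obtain ⟨a, b, k, rfl⟩ := hu
  exact ⟨a, b, fun i => (k i).congr ((tendsto_line x _).eventually h), rfl⟩

lemma unique (hu : HasLaplacianAt u L x) (hv : HasLaplacianAt u M x) : L = M := by
  obtain ⟨a, b, k, rfl⟩ := hu
  obtain ⟨a', b', k', rfl⟩ := hv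
  exact Finset.sum_congr rfl fun i _ => (k i).unique (k' i)

lemma nonneg_of_isLocalMin (hu : HasLaplacianAt u L x) (hmin : IsLocalMin u x) : 0 ≤ L := by
  obtain ⟨a, b, k, rfl⟩ := hu
  refine Finset.sum_nonneg fun i _ => (k i).nonneg_of_isLocalMin ?_
  have := (tendsto_line x (EuclideanSpace.single i (1 : ℝ))).eventually hmin
  simpa [IsLocalMin, IsMinFilter] using this

end HasLaplacianAt

lemma ContDiffAt.hasLaplacianAt {m : ℕ} {u : EuclideanSpace ℝ (Fin m) → ℝ}
    {x : EuclideanSpace ℝ (Fin m)} (hu : ContDiffAt ℝ 2 u x) :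
    HasLaplacianAt u (∑ i : Fin m, fderiv ℝ (fun y => fderiv ℝ u y (EuclideanSpace.single i 1)) x
        (EuclideanSpace.single i 1)) x := by
  refine ⟨fun i => fderiv ℝ u x (EuclideanSpace.single i 1), _, fun i => ?_, rfl⟩
  set e : EuclideanSpace ℝ (Fin m) := EuclideanSpace.single i 1
  have hl : ∀ s : ℝ, HasDerivAt (fun s : ℝ => x + s • e) e s := fun s => by
    simpa using ((hasDerivAt_id s).smul_const e).const_add x
  have h1 : ∀ᶠ y in 𝓝 x, DifferentiableAt ℝ u y := by
    filter_upwards [hu.eventually (by simp)] with y hy using hy.differentiableAt (by simp)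
  have h2 : DifferentiableAt ℝ (fun y => fderiv ℝ u y e) x :=
    ((hu.fderiv_right (m := 1) (by norm_num)).differentiableAt (by simp)).clm_apply
      (differentiableAt_const e)
  refine ⟨fun s => fderiv ℝ u (x + s • e) e, ?_, by simp [e], ?_⟩
  · filter_upwards [(HasLaplacianAt.tendsto_line x e).eventually h1] with s hs
    exact hs.hasFDerivAt.comp_hasDerivAt s (hl s)
  · have h3 : HasFDerivAt (fun y => fderiv ℝ u y e) (fderiv ℝ (fun y => fderiv ℝ u y e) x)
        (x + (0 : ℝ) • e) := by simpa using h2.hasFDerivAt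
    exact h3.comp_hasDerivAt 0 (hl 0)

end SecondDerivatives

section MinimumPrinciple

lemma nonneg_of_forall_not_isLocalMin {X : Type*} [MetricSpace X] [ProperSpace X] {V : Set X}
    (hVb : Bornology.IsBounded V) (hV : IsOpen V) {u : X → ℝ} (hc : ∀ x ∈ V, ContinuousAt u x)
    (hb : ∀ x ∉ V, ∀ ε > 0, ∀ᶠ y in 𝓝 x, y ∈ V → -ε < u y)
    (hmin : ∀ x ∈ V, u x < 0 → ¬ IsLocalMin u x) : ∀ x ∈ V, 0 ≤ u x := by
  classical
  intro x hx
  by_contra! hlt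
  set w : X → ℝ := fun y => if y ∈ V then u y else 0 with hw
  have hlsc : LowerSemicontinuousOn w (closure V) := by
    intro z _ c hc'
    refine eventually_nhdsWithin_of_eventually_nhds ?_
    by_cases hz : z ∈ V
    · have : c < u z := by simpa [hw, hz] using hc'
      filter_upwards [hV.mem_nhds hz, (hc z hz).eventually (lt_mem_nhds this)] with y hy hy'
      simpa [hw, hy] using hy'
    · have hc0 : c < 0 := by simpa [hw, hz] using hc'
      filter_upwards [hb z hz (-c) (by linarith)] with y hy
      by_cases hyV : y ∈ V
      · simpa [hw, hyV] using hy hyV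
      · simpa [hw, hyV] using hc0
  obtain ⟨q, hq, hqmin⟩ := hlsc.exists_isMinOn ⟨x, subset_closure hx⟩
    (isCompact_of_isClosed_isBounded isClosed_closure hVb.closure)
  have hqx : w q ≤ w x := hqmin (subset_closure hx)
  have hwx : w x = u x := by simp [hw, hx]
  have hqV : q ∈ V := by
    by_contra hqV
    have : w q = 0 := by simp [hw, hqV]
    linarith
  have hwq : w q = u q := by simp [hw, hqV]
  refine hmin q hqV (by linarith) ?_
  filter_upwards [hV.mem_nhds hqV] with y hy
  have h1 : w q ≤ w y := hqmin (subset_closure hy)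
  have h2 : w y = u y := by simp [hw, hy]
  linarith

/-- A superharmonic version of the minimum principle on bounded open sets. -/
lemma nonneg_of_hasLaplacianAt {m : ℕ} {V : Set (EuclideanSpace ℝ (Fin m))}
    (hVb : Bornology.IsBounded V) (hV : IsOpen V) {u : EuclideanSpace ℝ (Fin m) → ℝ}
    (hc : ∀ x ∈ V, ContinuousAt u x)
    (hb : ∀ x ∉ V, ∀ ε > 0, ∀ᶠ y in 𝓝 x, y ∈ V → -ε < u y)
    (hL : ∀ x ∈ V, ∃ L < 0, HasLaplacianAt u L x) : ∀ x ∈ V, 0 ≤ u x :=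
  nonneg_of_forall_not_isLocalMin hVb hV hc hb fun x hx _ hmin => by
    obtain ⟨L, hL0, hL⟩ := hL x hx
    exact absurd (hL.nonneg_of_isLocalMin hmin) (not_le.mpr hL0)

lemma hasSecondDeriv_normSq {m : ℕ} (x : EuclideanSpace ℝ (Fin m)) (i : Fin m) :
    HasSecondDeriv (fun s : ℝ => ‖x + s • EuclideanSpace.single i (1 : ℝ)‖ ^ 2) (2 * x i) 2 := by
  have h : (fun s : ℝ => ‖x‖ ^ 2 + ((2 * x i) * s + s * s)) =
      fun s : ℝ => ‖x + s • EuclideanSpace.single i (1 : ℝ)‖ ^ 2 := by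
    funext s
    rw [norm_add_sq_real, inner_smul_right, norm_smul]
    simp [EuclideanSpace.inner_single_right]
    ring
  rw [← h]
  have := (HasSecondDeriv.const (‖x‖ ^ 2)).add
    ((HasSecondDeriv.id.const_mul (2 * x i)).add (HasSecondDeriv.id.mul HasSecondDeriv.id))
  convert this using 1 <;> norm_num

lemma hasLaplacianAt_normSq {m : ℕ} (x : EuclideanSpace ℝ (Fin m)) :
    HasLaplacianAt (fun y => ‖y‖ ^ 2) (2 * m) x :=
  ⟨_, _, fun i => hasSecondDeriv_normSq x i, by simp [mul_comm]⟩

lemma sum_two_mul_sq {m : ℕ} (x : EuclideanSpace ℝ (Fin m)) :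
    ∑ i, (2 * x i) ^ 2 = 4 * ‖x‖ ^ 2 := by
  rw [EuclideanSpace.real_norm_sq_eq, Finset.mul_sum]
  exact Finset.sum_congr rfl fun i _ => by ring

/-- The fundamental solution `‖x‖ ^ (-p)` (up to a constant) in `ℝ^(p+2)`. -/
def newton (p : ℕ) (x : EuclideanSpace ℝ (Fin (p + 1 + 1))) : ℝ := (‖x‖ ^ p)⁻¹

lemma newton_nonneg {p : ℕ} (x : EuclideanSpace ℝ (Fin (p + 1 + 1))) : 0 ≤ newton p x := by
  unfold newton; positivity

lemma newton_contDiffAt {p : ℕ} {x : EuclideanSpace ℝ (Fin (p + 1 + 1))} (hx : x ≠ 0) :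
    ContDiffAt ℝ 2 (newton p) x :=
  ((contDiffAt_norm ℝ hx).pow p).inv (by simpa using fun h => absurd h hx)

lemma newton_hasLaplacianAt {p : ℕ} {x : EuclideanSpace ℝ (Fin (p + 1 + 1))} (hx : x ≠ 0) :
    HasLaplacianAt (newton p) 0 x := by
  have hN : 0 < ‖x‖ ^ 2 := by positivity
  set q : ℝ := -(p : ℝ) / 2 with hq
  have hk : (fun y => (‖y‖ ^ 2) ^ q) = newton p := by
    funext y
    rw [newton, ← Real.rpow_natCast, ← Real.rpow_mul (norm_nonneg _), ← Real.rpow_natCast,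
      ← Real.rpow_neg (norm_nonneg _)]
    congr 1
    rw [hq]; push_cast; ring
  rw [← hk]
  have hφ : ∀ᶠ y : ℝ in 𝓝 (‖x‖ ^ 2), HasDerivAt (fun y => y ^ q) (q * y ^ (q - 1)) y := by
    filter_upwards [lt_mem_nhds hN] with y hy
    exact Real.hasDerivAt_rpow_const (Or.inl hy.ne')
  have hφ' : HasDerivAt (fun y : ℝ => q * y ^ (q - 1)) (q * ((q - 1) * (‖x‖ ^ 2) ^ (q - 1 - 1)))
      (‖x‖ ^ 2) := (Real.hasDerivAt_rpow_const (Or.inl hN.ne')).const_mul q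
  refine ⟨_, _, fun i => (hasSecondDeriv_normSq x i).scomp (by simpa using hφ)
    (by simpa using hφ'), ?_⟩
  simp only [zero_smul, add_zero]
  rw [Finset.sum_add_distrib, ← Finset.mul_sum, sum_two_mul_sq]
  rw [Real.rpow_sub_one hN.ne' (q - 1)]
  simp only [Finset.sum_const, Finset.card_univ, Fintype.card_fin, nsmul_eq_mul]
  field_simp
  rw [hq]; push_cast; ring

end MinimumPrinciple

section Translates

variable {X : Type*} [NormedAddCommGroup X] [InnerProductSpace ℝ X] [FiniteDimensional ℝ X]
  [MeasurableSpace X] [BorelSpace X]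
  {G : Type*} [NormedAddCommGroup G]

lemma integrable_translate (ν : Measure X) [IsFiniteMeasure ν] {f : X → G} (hf : Continuous f)
    (hs : HasCompactSupport f) (x : X) : Integrable (fun w => f (x - w)) ν := by
  obtain ⟨C, hC⟩ := hs.exists_bound_of_continuous hf
  exact Integrable.of_bound (hf.comp (by fun_prop : Continuous fun w => x - w)).aestronglyMeasurable
    C (.of_forall fun w => hC _)

variable [NormedSpace ℝ G]

lemma continuous_integral_translate (ν : Measure X) [IsFiniteMeasure ν] {f : X → G}
    (hf : Continuous f) (hs : HasCompactSupport f) : Continuous fun x => ∫ w, f (x - w) ∂ν := by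
  obtain ⟨C, hC⟩ := hs.exists_bound_of_continuous hf
  refine continuous_of_dominated (bound := fun _ => C) (fun x => ?_)
    (fun x => .of_forall fun w => hC _)
    (integrable_const C) (.of_forall fun w => by fun_prop)
  exact (integrable_translate ν hf hs x).aestronglyMeasurable

lemma hasFDerivAt_integral_translate (ν : Measure X) [IsFiniteMeasure ν] {f : X → G}
    (hf : ContDiff ℝ 1 f) (hs : HasCompactSupport f) (x : X) :
    HasFDerivAt (fun x => ∫ w, f (x - w) ∂ν) (∫ w, fderiv ℝ f (x - w) ∂ν) x := by
  have hf' : Continuous (fderiv ℝ f) := hf.continuous_fderiv one_ne_zero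
  obtain ⟨C, hC⟩ := (hs.fderiv ℝ).exists_bound_of_continuous hf'
  refine hasFDerivAt_integral_of_dominated_of_fderiv_le (bound := fun _ => C)
    (F := fun x w => f (x - w)) (F' := fun x w => fderiv ℝ f (x - w)) (s := univ) univ_mem ?_
    (integrable_translate ν hf.continuous hs x) ?_ ?_ (integrable_const C) ?_
  · exact .of_forall fun y => (integrable_translate ν hf.continuous hs y).aestronglyMeasurable
  · exact (integrable_translate ν hf' (hs.fderiv ℝ) x).aestronglyMeasurable
  · exact .of_forall fun w y _ => hC _
  · refine .of_forall fun w y _ => ?_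
    have := (hf.differentiable one_ne_zero (y - w)).hasFDerivAt.comp y
      ((hasFDerivAt_id y).sub_const w)
    simpa [Function.comp_def] using this

lemma fderiv_integral_translate (ν : Measure X) [IsFiniteMeasure ν] {f : X → G}
    (hf : ContDiff ℝ 1 f) (hs : HasCompactSupport f) :
    fderiv ℝ (fun x => ∫ w, f (x - w) ∂ν) = fun x => ∫ w, fderiv ℝ f (x - w) ∂ν :=
  funext fun x => (hasFDerivAt_integral_translate ν hf hs x).fderiv

lemma contDiff_one_integral_translate (ν : Measure X) [IsFiniteMeasure ν] {f : X → G}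
    (hf : ContDiff ℝ 1 f) (hs : HasCompactSupport f) :
    ContDiff ℝ 1 (fun x => ∫ w, f (x - w) ∂ν) := by
  rw [contDiff_one_iff_fderiv, fderiv_integral_translate ν hf hs]
  exact ⟨fun x => (hasFDerivAt_integral_translate ν hf hs x).differentiableAt,
    continuous_integral_translate ν (hf.continuous_fderiv one_ne_zero) (hs.fderiv ℝ)⟩

lemma contDiff_two_integral_translate (ν : Measure X) [IsFiniteMeasure ν] {f : X → G}
    (hf : ContDiff ℝ 2 f) (hs : HasCompactSupport f) :
    ContDiff ℝ 2 (fun x => ∫ w, f (x - w) ∂ν) := by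
  have hf1 : ContDiff ℝ 1 f := hf.of_le (by norm_num)
  rw [show (2 : WithTop ℕ∞) = 1 + 1 by norm_num, contDiff_succ_iff_fderiv,
    fderiv_integral_translate ν hf1 hs]
  exact ⟨fun x => (hasFDerivAt_integral_translate ν hf1 hs x).differentiableAt, by simp,
    contDiff_one_integral_translate ν (hf.fderiv_right (by norm_num)) (hs.fderiv ℝ)⟩

lemma fderiv_apply_integral_translate (ν : Measure X) [IsFiniteMeasure ν] {f : X → G}
    [CompleteSpace G] (hf : ContDiff ℝ 1 f) (hs : HasCompactSupport f) (x e : X) :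
    fderiv ℝ (fun x => ∫ w, f (x - w) ∂ν) x e = ∫ w, fderiv ℝ f (x - w) e ∂ν := by
  rw [fderiv_integral_translate ν hf hs]
  exact ContinuousLinearMap.integral_apply (integrable_translate ν
    (hf.continuous_fderiv one_ne_zero) (hs.fderiv ℝ) x) e

end Translates

lemma exists_newton_cutoff (p : ℕ) {δ R : ℝ} (hδ : 0 < δ) :
    ∃ κ : EuclideanSpace ℝ (Fin (p + 1 + 1)) → ℝ, ContDiff ℝ 2 κ ∧ HasCompactSupport κ ∧
      ∀ x, δ < ‖x‖ → ‖x‖ < R → κ =ᶠ[𝓝 x] newton p := by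
  let χ₁ : ContDiffBump (0 : EuclideanSpace ℝ (Fin (p + 1 + 1))) :=
    ⟨δ / 2, δ, by positivity, by linarith⟩
  let χ₂ : ContDiffBump (0 : EuclideanSpace ℝ (Fin (p + 1 + 1))) :=
    ⟨|R| + 1, |R| + 2, by positivity, by linarith⟩
  refine ⟨fun x => χ₂ x * ((1 - χ₁ x) * newton p x), ?_, ?_, ?_⟩
  · refine χ₂.contDiff.mul (contDiff_iff_contDiffAt.2 fun x => ?_)
    by_cases hx : x = 0
    · subst hx
      have : (fun x => (1 - χ₁ x) * newton p x) =ᶠ[𝓝 0] fun _ => 0 := by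
        filter_upwards [χ₁.eventuallyEq_one] with y hy
        simp [hy]
      exact contDiffAt_const.congr_of_eventuallyEq this
    · exact (contDiffAt_const.sub χ₁.contDiffAt).mul (newton_contDiffAt hx)
  · exact χ₂.hasCompactSupport.mul_right
  · intro x h1 h2
    have o1 : ∀ᶠ y in 𝓝 x, δ < ‖y‖ := continuous_norm.continuousAt.eventually (lt_mem_nhds h1)
    have o2 : ∀ᶠ y in 𝓝 x, ‖y‖ < R := continuous_norm.continuousAt.eventually (gt_mem_nhds h2)
    filter_upwards [o1, o2] with y hy1 hy2
    have e1 : χ₁ y = 0 := χ₁.zero_of_le_dist (by simpa using hy1.le)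
    have e2 : χ₂ y = 1 := χ₂.one_of_mem_closedBall (by
      simp [χ₂]; linarith [le_abs_self R])
    simp [e1, e2]

/-- The Newtonian potential of a finite measure carried by a compact set is harmonic off it. -/
theorem isHarmonicOn_potential {p : ℕ} (ν : Measure (EuclideanSpace ℝ (Fin (p + 1 + 1))))
    [IsFiniteMeasure ν] {S : Set (EuclideanSpace ℝ (Fin (p + 1 + 1)))} (hS : IsCompact S)
    (hν : ν Sᶜ = 0) : IsHarmonicOn (fun x => ∫ w, newton p (x - w) ∂ν) Sᶜ := by
  have hloc : ∀ x ∈ Sᶜ, ∃ κ : EuclideanSpace ℝ (Fin (p + 1 + 1)) → ℝ, ContDiff ℝ 2 κ ∧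
      HasCompactSupport κ ∧
      (∀ᶠ y in 𝓝 x, ∀ w ∈ S, κ =ᶠ[𝓝 (y - w)] newton p) := by
    intro x hx
    obtain ⟨δ, hδ, hb⟩ := Metric.isOpen_iff.1 hS.isClosed.isOpen_compl x hx
    obtain ⟨R, hR⟩ := hS.isBounded.subset_closedBall x
    obtain ⟨κ, h1, h2, h3⟩ := exists_newton_cutoff p (δ := δ / 4) (R := R + δ) (by positivity)
    refine ⟨κ, h1, h2, ?_⟩
    filter_upwards [ball_mem_nhds x (by positivity : 0 < δ / 2)] with y hy w hw
    have hwx : δ ≤ dist w x := by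
      by_contra! hlt
      exact hb (mem_ball.2 hlt) hw
    have hwR : dist w x ≤ R := hR hw
    rw [mem_ball] at hy
    refine h3 _ ?_ ?_
    · rw [← dist_eq_norm]
      have := dist_triangle w y x
      rw [dist_comm w y] at this
      linarith
    · rw [← dist_eq_norm]
      have := dist_triangle_right y w x
      linarith
  have hae : ∀ᵐ w ∂ν, w ∈ S := hν
  have hEq : ∀ x ∈ Sᶜ, ∃ κ : EuclideanSpace ℝ (Fin (p + 1 + 1)) → ℝ, ContDiff ℝ 2 κ ∧
      HasCompactSupport κ ∧ (∀ w ∈ S, κ =ᶠ[𝓝 (x - w)] newton p) ∧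
      (fun x => ∫ w, newton p (x - w) ∂ν) =ᶠ[𝓝 x] fun x => ∫ w, κ (x - w) ∂ν := by
    intro x hx
    obtain ⟨κ, h1, h2, h3⟩ := hloc x hx
    refine ⟨κ, h1, h2, h3.self_of_nhds, ?_⟩
    filter_upwards [h3] with y hy
    refine integral_congr_ae ?_
    filter_upwards [hae] with w hw using (hy w hw).self_of_nhds.symm
  refine ⟨fun x hx => ?_, fun x hx => ?_⟩
  · obtain ⟨κ, h1, h2, -, h4⟩ := hEq x hx
    exact ((contDiff_two_integral_translate ν h1 h2).contDiffAt.congr_of_eventuallyEq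
      h4).contDiffWithinAt
  · obtain ⟨κ, h1, h2, h3, h4⟩ := hEq x hx
    have h1' : ContDiff ℝ 1 κ := h1.of_le (by norm_num)
    have key : ∀ i : Fin (p + 1 + 1), fderiv ℝ (fun y => fderiv ℝ
        (fun x => ∫ w, newton p (x - w) ∂ν) y (EuclideanSpace.single i 1)) x
        (EuclideanSpace.single i 1) = ∫ w, fderiv ℝ (fun y => fderiv ℝ κ y
          (EuclideanSpace.single i 1)) (x - w) (EuclideanSpace.single i 1) ∂ν := by
      intro i
      set e : EuclideanSpace ℝ (Fin (p + 1 + 1)) := EuclideanSpace.single i 1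
      have hk1 : ContDiff ℝ 1 (fun y => fderiv ℝ κ y e) :=
        (h1.fderiv_right (m := 1) (by norm_num)).clm_apply contDiff_const
      have hk2 : HasCompactSupport (fun y => fderiv ℝ κ y e) := h2.fderiv_apply ℝ e
      rw [← fderiv_apply_integral_translate ν hk1 hk2 x e]
      have : (fun y => fderiv ℝ (fun x => ∫ w, newton p (x - w) ∂ν) y e) =ᶠ[𝓝 x]
          fun y => ∫ w, fderiv ℝ κ (y - w) e ∂ν := by
        filter_upwards [h4.eventuallyEq_nhds] with y hy
        rw [hy.fderiv_eq, fderiv_apply_integral_translate ν h1' h2]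
      rw [this.fderiv_eq]
    simp only [key]
    rw [← integral_finsetSum]
    · rw [integral_congr_ae (g := fun _ => (0 : ℝ)), integral_zero]
      filter_upwards [hae] with w hw
      have hne : x - w ≠ 0 := sub_ne_zero.2 fun h => hx (h ▸ hw)
      exact h1.contDiffAt.hasLaplacianAt.unique
        ((newton_hasLaplacianAt hne).congr (h3 w hw).symm)
    · intro i _
      set e : EuclideanSpace ℝ (Fin (p + 1 + 1)) := EuclideanSpace.single i 1
      have hk1 : ContDiff ℝ 1 (fun y => fderiv ℝ κ y e) :=
        (h1.fderiv_right (m := 1) (by norm_num)).clm_apply contDiff_const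
      have hk2 : HasCompactSupport (fun y => fderiv ℝ κ y e) := h2.fderiv_apply ℝ e
      exact integrable_translate ν ((hk1.continuous_fderiv one_ne_zero).clm_apply continuous_const)
        (hk2.fderiv_apply ℝ e) x

section NewtonPotentials

lemma nonneg_of_tendsto_zero {m : ℕ} (hm : 0 < m) {u : EuclideanSpace ℝ (Fin m) → ℝ} {a : ℝ}
    (hc : ∀ x, a ≤ ‖x‖ → ContinuousAt u x) (hL : ∀ x, a < ‖x‖ → HasLaplacianAt u 0 x)
    (ha : ∀ x, ‖x‖ = a → 0 ≤ u x)
    (h0 : Tendsto u (Bornology.cobounded (EuclideanSpace ℝ (Fin m))) (𝓝 0)) :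
    ∀ x, a ≤ ‖x‖ → 0 ≤ u x := by
  intro x hx
  rcases hx.eq_or_lt with h | hx
  · exact ha x h.symm
  refine le_of_forall_pos_le_add fun δ hδ => ?_
  have hδ' : ∀ᶠ y in Bornology.cobounded (EuclideanSpace ℝ (Fin m)), -δ < u y :=
    h0.eventually (lt_mem_nhds (by linarith))
  rw [← comap_norm_atTop, eventually_comap] at hδ'
  obtain ⟨R, hRx, hR⟩ := (((eventually_gt_atTop ‖x‖)).and hδ').exists
  have main : ∀ ε > 0, 0 ≤ u x + δ + ε * (R ^ 2 - ‖x‖ ^ 2) := by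
    intro ε hε
    set V : Set (EuclideanSpace ℝ (Fin m)) := {y | a < ‖y‖} ∩ ball 0 R
    have hVo : IsOpen V := (isOpen_lt continuous_const continuous_norm).inter isOpen_ball
    have hcont : ∀ y, a ≤ ‖y‖ → ContinuousAt (fun y => u y + δ + ε * (R ^ 2 - ‖y‖ ^ 2)) y :=
      fun y hy => ((hc y hy).add continuousAt_const).add (by fun_prop)
    refine nonneg_of_hasLaplacianAt (V := V) (u := fun y => u y + δ + ε * (R ^ 2 - ‖y‖ ^ 2))
      (isBounded_ball.subset inter_subset_right) hVo (fun y hy => hcont y (le_of_lt hy.1)) ?_ ?_ x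
      ⟨hx, by simpa using hRx⟩
    · intro y hy ε' hε'
      by_cases h1 : ‖y‖ < a
      · filter_upwards [continuous_norm.continuousAt.eventually (gt_mem_nhds h1)] with z hz hzV
        exact absurd hzV.1 (not_lt.2 hz.le)
      by_cases h2 : R < ‖y‖
      · filter_upwards [continuous_norm.continuousAt.eventually (lt_mem_nhds h2)] with z hz hzV
        exact absurd (by simpa using hzV.2) (not_lt.2 hz.le)
      push Not at h1 h2
      have hpos : 0 ≤ u y + δ + ε * (R ^ 2 - ‖y‖ ^ 2) := by
        have hsq : 0 ≤ ε * (R ^ 2 - ‖y‖ ^ 2) := by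
          have := norm_nonneg y
          have : ‖y‖ ^ 2 ≤ R ^ 2 := by gcongr
          exact mul_nonneg hε.le (by linarith)
        rcases h1.eq_or_lt with h | h
        · have := ha y h.symm; linarith
        · have hyR : ‖y‖ = R := by
            by_contra hne
            exact hy ⟨h, by simpa using lt_of_le_of_ne h2 hne⟩
          have := hR y hyR; linarith
      filter_upwards [(hcont y h1).eventually (lt_mem_nhds (show -ε' < _ by linarith))] with z hz _
        using hz
    · intro y hy
      refine ⟨_, ?_, (((hL y hy.1).add (.const δ)).add
        (((HasLaplacianAt.const (R ^ 2)).add ((hasLaplacianAt_normSq y).const_mul (-1))).const_mul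
          ε)).congr (.of_forall fun z => by simp [sub_eq_add_neg])⟩
      have : (0 : ℝ) < m := by exact_mod_cast hm
      nlinarith
  have ht : Tendsto (fun ε : ℝ => u x + δ + ε * (R ^ 2 - ‖x‖ ^ 2)) (𝓝[>] 0) (𝓝 (u x + δ)) := by
    have : Continuous fun ε : ℝ => u x + δ + ε * (R ^ 2 - ‖x‖ ^ 2) := by fun_prop
    simpa using (this.tendsto 0).mono_left nhdsWithin_le_nhds
  refine ge_of_tendsto ht ?_
  filter_upwards [self_mem_nhdsWithin] with ε hε using main ε hε

variable {p : ℕ}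

lemma newton_smul {a : ℝ} (ha : 0 < a) (x : EuclideanSpace ℝ (Fin (p + 1 + 1))) :
    newton p (a • x) = (a ^ p)⁻¹ * newton p x := by
  simp only [newton, norm_smul, Real.norm_of_nonneg ha.le, mul_pow, mul_inv]

lemma newton_le_of_le_norm {d : ℝ} (hd : 0 < d) {x : EuclideanSpace ℝ (Fin (p + 1 + 1))}
    (hx : d ≤ ‖x‖) : newton p x ≤ (d ^ p)⁻¹ := by
  unfold newton; gcongr

lemma newton_tendsto (hp : p ≠ 0) : Tendsto (newton p)
    (Bornology.cobounded (EuclideanSpace ℝ (Fin (p + 1 + 1)))) (𝓝 0) :=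
  ((tendsto_pow_atTop hp).comp tendsto_norm_cobounded_atTop).inv_tendsto_atTop

/-- A potential of a finite measure on a bounded set vanishes at infinity. -/
lemma tendsto_potential (hp : p ≠ 0) (ν : Measure (EuclideanSpace ℝ (Fin (p + 1 + 1))))
    [IsFiniteMeasure ν] {R : ℝ} (hν : ∀ᵐ w ∂ν, ‖w‖ ≤ R) :
    Tendsto (fun x => ∫ w, newton p (x - w) ∂ν)
      (Bornology.cobounded (EuclideanSpace ℝ (Fin (p + 1 + 1)))) (𝓝 0) := by
  have hlim : Tendsto (fun x : EuclideanSpace ℝ (Fin (p + 1 + 1)) =>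
      ((‖x‖ - R) ^ p)⁻¹ * ν.real univ) (Bornology.cobounded _) (𝓝 0) := by
    have h1 : Tendsto (fun x : EuclideanSpace ℝ (Fin (p + 1 + 1)) => ‖x‖ - R)
      (Bornology.cobounded _) atTop :=
        tendsto_atTop_add_const_right _ _ tendsto_norm_cobounded_atTop
    simpa using (((tendsto_pow_atTop hp).comp h1).inv_tendsto_atTop).mul_const (ν.real univ)
  refine squeeze_zero' (.of_forall fun x => integral_nonneg fun w => newton_nonneg _) ?_ hlim
  filter_upwards [tendsto_norm_cobounded_atTop.eventually (eventually_gt_atTop R)] with x hx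
  have hb : ∀ᵐ w ∂ν, ‖newton p (x - w)‖ ≤ ((‖x‖ - R) ^ p)⁻¹ := by
    filter_upwards [hν] with w hw
    rw [Real.norm_of_nonneg (newton_nonneg _)]
    refine newton_le_of_le_norm (by linarith) ?_
    have := norm_sub_norm_le x w
    linarith
  have := norm_integral_le_of_norm_le_const hb
  exact (le_abs_self _).trans this

/-- The potential of a ball, outside the concentric ball of twice the radius, is a multiple of
the fundamental solution. -/
lemma exists_integral_newton_ball (hp : p ≠ 0) : ∃ A : ℝ, 0 < A ∧ ∀ a : ℝ, 0 < a →
    ∀ x : EuclideanSpace ℝ (Fin (p + 1 + 1)), 2 * a ≤ ‖x‖ →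
      ∫ v in closedBall 0 1, newton p (x - a • v) = A * newton p x := by
  set X := EuclideanSpace ℝ (Fin (p + 1 + 1))
  set ν : Measure X := volume.restrict (closedBall 0 1) with hνdef
  have : IsFiniteMeasure ν := ⟨by
    rw [Measure.restrict_apply_univ]; exact measure_closedBall_lt_top⟩
  have hνc : ν (closedBall 0 1)ᶜ = 0 := by
    rw [Measure.restrict_apply measurableSet_closedBall.compl]; simp
  have hνn : ∀ᵐ w ∂ν, ‖w‖ ≤ 1 := by
    filter_upwards [show ∀ᵐ w ∂ν, w ∈ closedBall (0 : X) 1 from hνc] with w hw using by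
      simpa using hw
  set J : X → ℝ := fun x => ∫ v, newton p (x - v) ∂ν with hJ
  have hharm : IsHarmonicOn J (closedBall 0 1)ᶜ :=
    isHarmonicOn_potential ν (isCompact_closedBall 0 1) hνc
  have hCD : ∀ x : X, 1 < ‖x‖ → ContDiffAt ℝ 2 J x := fun x hx =>
    hharm.1.contDiffAt (isClosed_closedBall.isOpen_compl.mem_nhds (by simpa using hx))
  have hLap : ∀ x : X, 1 < ‖x‖ → HasLaplacianAt J 0 x := fun x hx => by
    simpa only [hharm.2 x (by simpa using hx)] using (hCD x hx).hasLaplacianAt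
  have hrot : ∀ x y : X, ‖x‖ = ‖y‖ → J x = J y := by
    intro x y hxy
    obtain ⟨T, hT⟩ : ∃ T : X ≃ₗᵢ[ℝ] X, T x = y := ⟨_, Submodule.reflection_sub hxy⟩
    have hpre : T ⁻¹' closedBall (0 : X) 1 = closedBall 0 1 := by ext; simp
    have := T.measurePreserving.setIntegral_preimage_emb
      T.toHomeomorph.measurableEmbedding (fun v => newton p (y - v)) (closedBall 0 1)
    rw [hpre] at this
    rw [hJ]
    simp only [hνdef]
    rw [← this]
    refine integral_congr_ae (.of_forall fun v => ?_)
    simp only [newton]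
    rw [← hT, ← map_sub, T.norm_map]
  have hlim : Tendsto J (Bornology.cobounded X) (𝓝 0) := tendsto_potential hp ν hνn
  obtain ⟨x₀, hx₀⟩ : ∃ x₀ : X, ‖x₀‖ = 2 := ⟨EuclideanSpace.single 0 2, by
    rw [PiLp.norm_single]; simp⟩
  have hJpos : 0 < J x₀ := by
    have hle : ∫ _, ((3 : ℝ) ^ p)⁻¹ ∂ν ≤ J x₀ := by
      refine integral_mono_ae (integrable_const _) ?_ ?_
      · refine Integrable.of_bound (C := ((1 : ℝ) ^ p)⁻¹) ?_ ?_
        · refine Measurable.aestronglyMeasurable ?_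
          unfold newton; fun_prop
        · filter_upwards [hνn] with w hw
          rw [Real.norm_of_nonneg (newton_nonneg _)]
          refine newton_le_of_le_norm one_pos ?_
          have := norm_sub_norm_le x₀ w
          linarith
      · filter_upwards [hνn] with w hw
        have h1 := norm_sub_norm_le x₀ w
        have h2 := norm_sub_le x₀ w
        have : 0 < ‖x₀ - w‖ := by linarith
        unfold newton
        gcongr
        linarith
    refine lt_of_lt_of_le ?_ hle
    rw [integral_const, smul_eq_mul]
    refine mul_pos ?_ (by positivity)
    rw [measureReal_def, hνdef, Measure.restrict_apply_univ]
    exact ENNReal.toReal_pos (measure_closedBall_pos _ _ one_pos).ne' measure_closedBall_lt_top.ne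
  set A : ℝ := J x₀ * 2 ^ p with hA
  have hkey : ∀ x : X, 2 ≤ ‖x‖ → J x = A * newton p x := by
    have hk0 : ∀ x : X, 2 ≤ ‖x‖ → x ≠ 0 := fun x hx h => by simp [h] at hx; linarith
    have hsph : ∀ x : X, ‖x‖ = 2 → J x = A * newton p x := fun x hx => by
      rw [hrot x x₀ (hx.trans hx₀.symm), newton, hx, hA]; field_simp
    have aux : ∀ s : ℝ, ∀ x : X, 2 ≤ ‖x‖ → 0 ≤ s * (J x + -A * newton p x) := by
      intro s
      refine nonneg_of_tendsto_zero (by omega) (fun x hx => ?_) (fun x hx => ?_) (fun x hx => ?_) ?_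
      · exact continuousAt_const.mul ((hCD x (by linarith)).continuousAt.add
          (continuousAt_const.mul (newton_contDiffAt (hk0 x hx)).continuousAt))
      · simpa using ((hLap x (by linarith)).add
          ((newton_hasLaplacianAt (hk0 x hx.le)).const_mul (-A))).const_mul s
      · rw [hsph x hx]; simp
      · simpa using (hlim.add ((newton_tendsto hp).const_mul (-A))).const_mul s
    intro x hx
    have h1 := aux 1 x hx
    have h2 := aux (-1) x hx
    linarith
  refine ⟨A, by positivity, fun a ha x hx => ?_⟩
  have hx2 : 2 ≤ ‖a⁻¹ • x‖ := by
    rw [norm_smul, Real.norm_of_nonneg (by positivity), ← div_eq_inv_mul, le_div_iff₀ ha]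
    exact hx
  have h1 : ∀ v : X, newton p (x - a • v) = (a ^ p)⁻¹ * newton p (a⁻¹ • x - v) := fun v => by
    rw [← newton_smul ha, smul_sub, smul_inv_smul₀ ha.ne']
  simp_rw [h1]
  rw [integral_const_mul]
  change _ * J (a⁻¹ • x) = _
  rw [hkey _ hx2, newton_smul (by positivity : 0 < a⁻¹), inv_pow]
  have : a ^ p ≠ 0 := by positivity
  field_simp

end NewtonPotentials

section DiscMeasure

/-- The inclusion of `ℝ^d` into `ℝ^(d+1)` as the hyperplane where the last coordinate vanishes. -/
def hyperplaneIncl (d : ℕ) : EuclideanSpace ℝ (Fin d) →ₗᵢ[ℝ] EuclideanSpace ℝ (Fin (d + 1)) where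
  toFun w := WithLp.toLp 2 (Fin.snoc (α := fun _ => ℝ) w 0)
  map_add' v w := by
    ext j
    refine Fin.lastCases ?_ (fun i => ?_) j <;> simp
  map_smul' c w := by
    ext j
    refine Fin.lastCases ?_ (fun i => ?_) j <;> simp
  norm_map' w := by
    simp [EuclideanSpace.norm_eq, Fin.sum_univ_castSucc]

lemma hyperplaneIncl_last {d : ℕ} (w : EuclideanSpace ℝ (Fin d)) :
    hyperplaneIncl d w (Fin.last d) = 0 := by
  simp [hyperplaneIncl]

/-- The orthogonal projection of `ℝ^(d+1)` onto the first `d` coordinates. -/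
def hyperplaneProj (d : ℕ) (x : EuclideanSpace ℝ (Fin (d + 1))) : EuclideanSpace ℝ (Fin d) :=
  WithLp.toLp 2 fun i => x i.castSucc

lemma continuous_hyperplaneProj (d : ℕ) : Continuous (hyperplaneProj d) := by
  unfold hyperplaneProj; fun_prop

lemma norm_hyperplaneProj_le {d : ℕ} (x : EuclideanSpace ℝ (Fin (d + 1))) :
    ‖hyperplaneProj d x‖ ≤ ‖x‖ := by
  rw [EuclideanSpace.norm_eq, EuclideanSpace.norm_eq, Fin.sum_univ_castSucc (n := d)]
  refine Real.sqrt_le_sqrt ?_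
  simp only [hyperplaneProj]
  have := sq_nonneg ‖x (Fin.last d)‖
  linarith

lemma norm_le_norm_sub_hyperplaneIncl {d : ℕ} (x : EuclideanSpace ℝ (Fin (d + 1)))
    (v : EuclideanSpace ℝ (Fin d)) :
    ‖v‖ ≤ ‖x - hyperplaneIncl d (hyperplaneProj d x - v)‖ := by
  have : hyperplaneProj d (x - hyperplaneIncl d (hyperplaneProj d x - v)) = v := by
    ext i
    simp [hyperplaneProj, hyperplaneIncl]
  conv_lhs => rw [← this]
  exact norm_hyperplaneProj_le _

/-- There is a nontrivial measure on the unit disc of a hyperplane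
whose Newtonian potential is bounded and continuous. -/
lemma exists_disc_measure {p : ℕ} (hp : p ≠ 0) :
    ∃ μ : Measure (EuclideanSpace ℝ (Fin (p + 1 + 1))), IsFiniteMeasure μ ∧ μ univ ≠ 0 ∧
      (∀ᵐ w ∂μ, ‖w‖ ≤ 1 ∧ w (Fin.last (p + 1)) = 0) ∧ (∀ x, μ {x} = 0) ∧
      (∀ x, Integrable (fun w => newton p (x - w)) μ) ∧
      (Continuous fun x => ∫ w, newton p (x - w) ∂μ) ∧
      ∃ C, ∀ x, ∫ w, newton p (x - w) ∂μ ≤ C := by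
  set X := EuclideanSpace ℝ (Fin (p + 1 + 1))
  set Y := EuclideanSpace ℝ (Fin (p + 1))
  set ι := hyperplaneIncl (p + 1)
  set P := hyperplaneProj (p + 1)
  have hP : Continuous P := continuous_hyperplaneProj _
  have hι : Continuous ι := ι.continuous
  have hme : MeasurableEmbedding ι := ι.isometry.isClosedEmbedding.measurableEmbedding
  set φ : Y → ℝ := fun w => max 0 (1 - ‖w‖) with hφ
  have hφc : Continuous φ := by fun_prop
  have hφ0 : ∀ w, 0 ≤ φ w := fun w => le_max_left _ _
  have hφ1 : ∀ w, φ w ≤ 1 := fun w => max_le zero_le_one (by linarith [norm_nonneg w])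
  have hφs : ∀ w, 1 ≤ ‖w‖ → φ w = 0 := fun w hw => max_eq_left (by linarith)
  have hdm : Measurable fun w => ENNReal.ofReal (φ w) := hφc.measurable.ennreal_ofReal
  set m : Measure Y := volume.withDensity fun w => ENNReal.ofReal (φ w) with hm
  have hφint : Integrable φ := hφc.integrable_of_hasCompactSupport (by
    refine HasCompactSupport.intro (isCompact_closedBall 0 1) fun w hw => hφs w ?_
    simp only [mem_closedBall, dist_zero_right, not_le] at hw
    exact hw.le)
  have hmfin : IsFiniteMeasure m := isFiniteMeasure_withDensity_ofReal hφint.2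
  have hmpos : m univ ≠ 0 := by
    rw [hm, withDensity_apply _ MeasurableSet.univ, Measure.restrict_univ, ne_eq,
      lintegral_eq_zero_iff hdm]
    intro h
    have h2 : ∀ᵐ w : Y, ¬ w ∈ ball (0 : Y) 1 := by
      filter_upwards [h] with w hw hb
      simp only [Pi.zero_apply, ENNReal.ofReal_eq_zero] at hw
      have : 0 < 1 - ‖w‖ := by simpa using hb
      exact absurd hw (not_le.2 (lt_max_of_lt_right this))
    have h3 : volume (ball (0 : Y) 1) = 0 := by
      rw [ae_iff] at h2
      simp only [not_not] at h2
      exact h2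
    exact (measure_ball_pos volume (0 : Y) one_pos).ne' h3
  have hm1 : ∀ᵐ w ∂m, ‖w‖ ≤ 1 := by
    rw [hm, ae_withDensity_iff hdm]
    refine .of_forall fun w hw => ?_
    by_contra! h
    exact hw (by rw [hφs w h.le, ENNReal.ofReal_zero])
  set G : X → Y → ℝ := fun x v => φ (P x - v) * newton p (x - ι (P x - v)) with hG
  have hmeasN : Measurable (newton p) := by unfold newton; fun_prop
  have hGm : ∀ x, AEStronglyMeasurable (G x) volume := fun x => by
    refine Measurable.aestronglyMeasurable ?_
    exact (hφc.measurable.comp (by fun_prop)).mul (hmeasN.comp (by fun_prop))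
  have hne : ∀ᵐ v : Y, v ≠ 0 := by simp [ae_iff]
  set bd : ℝ → Y → ℝ := fun R => (ball (0 : Y) (R + 1)).indicator fun v => (‖v‖ ^ p)⁻¹ with hbd
  have hbdi : ∀ R, Integrable (bd R) := fun R => by
    rw [hbd, integrable_indicator_iff measurableSet_ball, integrableOn_fun_norm_addHaar volume
      (f := fun y : ℝ => (y ^ p)⁻¹)]
    refine (integrableOn_const (C := (1 : ℝ)) (by simp) (by simp)).congr_fun ?_ measurableSet_Ioo
    intro y hy
    have : y ^ p ≠ 0 := pow_ne_zero _ hy.1.ne'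
    simp [Y, this]
  have hGb : ∀ R, ∀ x : X, ‖x‖ < R → ∀ v ≠ 0, ‖G x v‖ ≤ bd R v := by
    intro R x hx v hv
    have h0 : 0 ≤ G x v := mul_nonneg (hφ0 _) (newton_nonneg _)
    rw [Real.norm_of_nonneg h0]
    by_cases hvR : v ∈ ball (0 : Y) (R + 1)
    · simp only [hbd, indicator_of_mem hvR]
      calc G x v ≤ 1 * newton p (x - ι (P x - v)) :=
            mul_le_mul_of_nonneg_right (hφ1 _) (newton_nonneg _)
        _ ≤ _ := by
            rw [one_mul]
            exact newton_le_of_le_norm (norm_pos_iff.2 hv) (norm_le_norm_sub_hyperplaneIncl x v)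
    · simp only [hbd, indicator_of_notMem hvR]
      have h1 : R + 1 ≤ ‖v‖ := by simpa using hvR
      have h2 : ‖P x‖ ≤ ‖x‖ := norm_hyperplaneProj_le x
      have h3 := norm_sub_norm_le v (P x)
      rw [norm_sub_rev] at h3
      simp only [hG]
      rw [hφs _ (by linarith), zero_mul]
  have hGi : ∀ x, Integrable (G x) := fun x =>
    (hbdi (‖x‖ + 1)).mono' (hGm x) (by
      filter_upwards [hne] with v hv using hGb _ x (by linarith) v hv)
  have hF : ∀ x, (fun w => G x (P x - w)) = fun w => φ w * newton p (x - ι w) := fun x => by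
    funext w; simp [hG]
  have h_int : ∀ x, Integrable (fun w => newton p (x - ι w)) m := fun x => by
    rw [hm, integrable_withDensity_iff_integrable_smul' hdm (by simp)]
    have := (hGi x).comp_sub_left (P x)
    rw [hF] at this
    refine this.congr (.of_forall fun w => ?_)
    simp [ENNReal.toReal_ofReal (hφ0 w)]
  have hval : ∀ x, ∫ w, newton p (x - w) ∂(m.map ι) = ∫ v, G x v := fun x => by
    rw [hme.integral_map, hm, integral_withDensity_eq_integral_toReal_smul hdm (by simp),
      ← integral_sub_left_eq_self (G x) volume (P x), hF]
    refine integral_congr_ae (.of_forall fun w => ?_)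
    simp [ENNReal.toReal_ofReal (hφ0 w)]
  have hcont : Continuous fun x => ∫ w, newton p (x - w) ∂(m.map ι) := by
    simp_rw [hval]
    refine continuous_iff_continuousAt.2 fun x => ?_
    have hlt : ∀ᶠ y : X in 𝓝 x, ‖y‖ < ‖x‖ + 1 :=
      continuous_norm.continuousAt.eventually (gt_mem_nhds (by linarith))
    refine continuousAt_of_dominated (bound := bd (‖x‖ + 1)) (.of_forall fun y => hGm y) ?_
      (hbdi _) ?_
    · filter_upwards [hlt] with y hy
      filter_upwards [hne] with v hv using hGb _ y hy v hv
    · filter_upwards [hne] with v hv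
      refine (hφc.continuousAt.comp (by fun_prop)).mul ?_
      have hz : x - ι (P x - v) ≠ 0 := by
        rw [← norm_pos_iff]
        exact (norm_pos_iff.2 hv).trans_le (norm_le_norm_sub_hyperplaneIncl x v)
      exact ContinuousAt.comp (f := fun y => y - ι (P y - v)) (g := newton p)
        (newton_contDiffAt hz).continuousAt (by fun_prop)
  have hae : ∀ᵐ w ∂(m.map ι), ‖w‖ ≤ 1 ∧ w (Fin.last (p + 1)) = 0 := by
    rw [hme.ae_map_iff]
    filter_upwards [hm1] with w hw
    exact ⟨by rw [ι.norm_map]; exact hw, hyperplaneIncl_last w⟩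
  have hfin : IsFiniteMeasure (m.map ι) := Measure.isFiniteMeasure_map m ι
  refine ⟨m.map ι, hfin, ?_, hae, fun x => ?_, fun x => ?_, hcont, ?_⟩
  · rwa [hme.map_apply, preimage_univ]
  · rw [hme.map_apply]
    have : (ι ⁻¹' {x}).Subsingleton := subsingleton_singleton.preimage ι.injective
    have h0 : volume (ι ⁻¹' {x}) = 0 := this.measure_zero volume
    exact withDensity_absolutelyContinuous _ _ h0
  · rw [hme.integrable_map_iff]
    exact h_int x
  · have hlim := tendsto_potential hp (m.map ι) (hae.mono fun w hw => hw.1)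
    have h1 := hlim.eventually (gt_mem_nhds one_pos)
    rw [← comap_norm_atTop, eventually_comap] at h1
    obtain ⟨R, hR⟩ := eventually_atTop.1 h1
    obtain ⟨C, hC⟩ := ((isCompact_closedBall (0 : X) R).image hcont).bddAbove
    refine ⟨max C 1, fun x => ?_⟩
    rcases le_total ‖x‖ R with h | h
    · exact (hC ⟨x, by simpa using h, rfl⟩).trans (le_max_left _ _)
    · exact (hR _ h x rfl).le.trans (le_max_right _ _)

end DiscMeasure

section EdgeBarriers

section Barriers

variable {n : ℕ}

lemma hasSecondDeriv_last (x : EuclideanSpace ℝ (Fin (n + 1))) (i : Fin (n + 1)) :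
    HasSecondDeriv (fun s : ℝ => (x + s • EuclideanSpace.single i (1 : ℝ)) (Fin.last n))
      (if i = Fin.last n then 1 else 0) 0 := by
  have h := (HasSecondDeriv.const (x (Fin.last n))).add
    (HasSecondDeriv.id.const_mul (if i = Fin.last n then (1 : ℝ) else 0))
  refine (by simpa using h : HasSecondDeriv _ _ _).congr (.of_forall fun s => ?_)
  by_cases hi : i = Fin.last n
  · subst hi; simp
  · simp [hi, Ne.symm hi]

/-- `(‖x‖² - 1)² + 4 t²`, which vanishes exactly on the unit sphere of the hyperplane `t = 0`. -/
def edgeQuad (x : EuclideanSpace ℝ (Fin (n + 1))) : ℝ :=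
  (‖x‖ ^ 2 - 1) ^ 2 + 4 * x (Fin.last n) ^ 2

/-- A strictly superharmonic function with a logarithmic pole along the unit sphere of `t = 0`. -/
def edgePole (x : EuclideanSpace ℝ (Fin (n + 1))) : ℝ :=
  -Real.log (edgeQuad x) - n * √(edgeQuad x) - (n + 1) * ‖x‖ ^ 2

/-- The square root `√(1 - ‖x‖² - 2 i t)`. -/
def slitRoot (x : EuclideanSpace ℝ (Fin (n + 1))) : ℂ :=
  (1 - (‖x‖ ^ 2 : ℝ) - 2 * Complex.I * (x (Fin.last n) : ℝ)) ^ (2⁻¹ : ℂ)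

/-- A subharmonic function vanishing on the hyperplane `t = 0` outside the unit ball. -/
def slitBarrier (x : EuclideanSpace ℝ (Fin (n + 1))) : ℝ :=
  (slitRoot x).re * ((‖x‖ ^ 2) ^ n)⁻¹

lemma edgePole_hasLaplacianAt (hn : 0 < n) {x : EuclideanSpace ℝ (Fin (n + 1))}
    (hx : 0 < edgeQuad x) : ∃ L < 0, HasLaplacianAt edgePole L x := by
  set N : ℝ := ‖x‖ ^ 2 with hN
  set t : ℝ := x (Fin.last n) with ht
  set q : ℝ := edgeQuad x with hq
  have hqe : q = (N - 1) ^ 2 + 4 * t ^ 2 := rfl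
  have hQ : ∀ i, HasSecondDeriv
      (fun s : ℝ => edgeQuad (x + s • EuclideanSpace.single i (1 : ℝ)))
      (4 * (N - 1) * x i + 8 * t * (if i = Fin.last n then 1 else 0))
      (8 * (x i) ^ 2 + 4 * (N - 1) + 8 * (if i = Fin.last n then 1 else 0)) := by
    intro i
    have h1 := (hasSecondDeriv_normSq x i).add (.const (-1))
    have h2 := hasSecondDeriv_last x i
    have h3 := (h1.mul h1).add ((h2.mul h2).const_mul 4)
    simp only [zero_smul, add_zero, ← hN, ← ht] at h3
    refine (h3.congr_val ?_ ?_).congr (.of_forall fun s => ?_)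
    · ring
    · split_ifs <;> ring
    · simp only [edgeQuad]; ring
  set φ' : ℝ → ℝ := fun y => -y⁻¹ - n * (2 * √y)⁻¹ with hφ'
  have hd1 : ∀ᶠ y in 𝓝 q, HasDerivAt (fun y : ℝ => -Real.log y - n * √y) (φ' y) y := by
    filter_upwards [lt_mem_nhds hx] with y hy
    exact ((Real.hasDerivAt_log hy.ne').neg.sub
      ((Real.hasDerivAt_sqrt hy.ne').const_mul _)).congr_deriv (by simp only [hφ', one_div])
  have hs : 0 < √q := Real.sqrt_pos.2 hx
  have hsq : √q ^ 2 = q := Real.sq_sqrt hx.le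
  have hd2 : HasDerivAt φ' ((q ^ 2)⁻¹ + n / (4 * q * √q)) q := by
    have h1 := (hasDerivAt_inv hx.ne').neg.sub
      ((((Real.hasDerivAt_sqrt hx.ne').const_mul 2).inv (by positivity)).const_mul (n : ℝ))
    refine HasDerivAt.congr_deriv h1 ?_
    rw [mul_pow, hsq]
    field_simp
    ring
  have hmain : HasLaplacianAt (fun y => (-Real.log (edgeQuad y) - n * √(edgeQuad y)) +
      (-((n : ℝ) + 1)) * ‖y‖ ^ 2)
      ((((q ^ 2)⁻¹ + n / (4 * q * √q)) * (16 * N * q) + φ' q *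
          (8 * N + 4 * (n + 1) * (N - 1) + 8)) +
        (-((n : ℝ) + 1)) * (2 * (n + 1 : ℕ))) x := by
    refine HasLaplacianAt.add ⟨_, _, fun i => (hQ i).scomp (φ := fun y => -Real.log y - n * √y)
      (by simpa using hd1) (by simpa using hd2), ?_⟩ ((hasLaplacianAt_normSq x).const_mul _)
    simp only [zero_smul, add_zero, ← hq]
    rw [Finset.sum_add_distrib, ← Finset.mul_sum, ← Finset.mul_sum]
    have e1 : ∑ i, (x i) ^ 2 = N := (EuclideanSpace.real_norm_sq_eq x).symm
    congr 2
    · have : ∀ i, (4 * (N - 1) * x i + 8 * t * (if i = Fin.last n then (1 : ℝ) else 0)) ^ 2 =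
          16 * (N - 1) ^ 2 * (x i) ^ 2 + (if i = Fin.last n then
            64 * (N - 1) * t * x i + 64 * t ^ 2 else 0) := fun i => by split_ifs <;> ring
      simp_rw [this, Finset.sum_add_distrib, ← Finset.mul_sum, e1, Finset.sum_ite_eq',
        Finset.mem_univ, if_true, ← ht, hqe]
      ring
    · simp_rw [Finset.sum_add_distrib, ← Finset.mul_sum, e1]
      simp
      ring
  refine ⟨_, ?_, hmain.congr (.of_forall fun y => by simp only [edgePole]; ring)⟩
  have hNs : |N - 1| ≤ √q := by
    rw [← Real.sqrt_sq_eq_abs]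
    exact Real.sqrt_le_sqrt (by rw [hqe]; nlinarith)
  have hn1 : (1 : ℝ) ≤ n := by exact_mod_cast hn
  set σ := √q
  have e : (((q ^ 2)⁻¹ + n / (4 * q * σ)) * (16 * N * q) + φ' q *
          (8 * N + 4 * (n + 1) * (N - 1) + 8)) +
        (-((n : ℝ) + 1)) * (2 * (n + 1 : ℕ)) =
      (4 * (n - 1) * ((1 - N) - σ) + 2 * n * (n + 1) * ((1 - N) - σ) * σ - 4 * σ
          - 2 * (n + 1) * σ ^ 2)
        / σ ^ 2 := by
    simp only [hφ']
    change _ + (-q⁻¹ - n * (2 * σ)⁻¹) * _ + _ = _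
    rw [← hsq]
    push_cast
    field_simp
    ring
  rw [e]
  refine div_neg_of_neg_of_pos ?_ (by positivity)
  have h1 : (1 - N) - σ ≤ 0 := by linarith [neg_abs_le (N - 1)]
  have h2 : 4 * ((n : ℝ) - 1) * ((1 - N) - σ) ≤ 0 :=
    mul_nonpos_of_nonneg_of_nonpos (by linarith) h1
  have h3 : 2 * (n : ℝ) * (n + 1) * ((1 - N) - σ) * σ ≤ 0 :=
    mul_nonpos_of_nonpos_of_nonneg (mul_nonpos_of_nonneg_of_nonpos (by positivity) h1) hs.le
  nlinarith [sq_nonneg σ]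

lemma slitBarrier_hasLaplacianAt {x : EuclideanSpace ℝ (Fin (n + 1))} (hx0 : x ≠ 0)
    (hx : ‖x‖ < 1 ∨ x (Fin.last n) ≠ 0) : ∃ L, 0 ≤ L ∧ HasLaplacianAt slitBarrier L x := by
  set N : ℝ := ‖x‖ ^ 2 with hN
  have hN0 : 0 < N := by positivity
  set t : ℝ := x (Fin.last n) with ht
  set c : ℂ := 1 - (N : ℝ) - 2 * Complex.I * (t : ℝ) with hc
  have hcs : c ∈ Complex.slitPlane := by
    rw [Complex.mem_slitPlane_iff]
    rcases hx with h | h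
    · left
      have : N < 1 := by rw [hN]; nlinarith [norm_nonneg x]
      simp [hc]; exact_mod_cast this
    · right
      simp [hc, h]
  have hc0 : c ≠ 0 := Complex.slitPlane_ne_zero hcs
  set S : ℂ := c ^ (2⁻¹ : ℂ) with hS
  have hS2 : S ^ 2 = c := by simp [hS]
  have hS0 : S ≠ 0 := fun h => hc0 (by rw [← hS2, h]; simp)
  have hSre : 0 ≤ S.re := by rw [hS, Complex.cpow_inv_two_re]; positivity
  set δ : Fin (n + 1) → ℂ := fun i => if i = Fin.last n then 1 else 0 with hδ
  have hC : ∀ i, HasSecondDeriv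
      (fun s : ℝ => (1 - (‖x + s • EuclideanSpace.single i (1 : ℝ)‖ ^ 2 : ℝ) -
        2 * Complex.I * ((x + s • EuclideanSpace.single i (1 : ℝ)) (Fin.last n) : ℝ) : ℂ))
      (-2 * x i - 2 * Complex.I * δ i) (-2) := by
    intro i
    have h1 := (hasSecondDeriv_normSq x i).clm_comp Complex.ofRealCLM
    have h2 := (hasSecondDeriv_last x i).clm_comp Complex.ofRealCLM
    have h3 := ((HasSecondDeriv.const (1 : ℂ)).add
      ((HasSecondDeriv.const (-1 : ℂ)).mul h1)).add
      ((HasSecondDeriv.const (-2 * Complex.I : ℂ)).mul h2)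
    refine (h3.congr_val ?_ ?_).congr (.of_forall fun s => ?_)
    · simp only [hδ]; split_ifs <;> (simp; try ring)
    · simp
    · simp; ring
  have hSd : ∀ i, HasSecondDeriv
      (fun s : ℝ => slitRoot (x + s • EuclideanSpace.single i (1 : ℝ)))
      ((2 * S)⁻¹ * (-2 * x i - 2 * Complex.I * δ i))
      (-(4 * S ^ 3)⁻¹ * (-2 * x i - 2 * Complex.I * δ i) ^ 2 + (2 * S)⁻¹ * (-2)) := by
    intro i
    have hd1 : ∀ᶠ y in 𝓝 c, HasDerivAt (fun y : ℂ => y ^ (2⁻¹ : ℂ))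
        ((2⁻¹ : ℂ) * y ^ ((2⁻¹ : ℂ) - 1) * 1) y := by
      filter_upwards [Complex.isOpen_slitPlane.mem_nhds hcs] with y hy
      exact (hasDerivAt_id y).cpow_const hy
    have hd2 : HasDerivAt (fun y : ℂ => (2⁻¹ : ℂ) * y ^ ((2⁻¹ : ℂ) - 1) * 1)
        (2⁻¹ * (((2⁻¹ : ℂ) - 1) * c ^ ((2⁻¹ : ℂ) - 1 - 1) * 1) * 1) c :=
      (((hasDerivAt_id c).cpow_const hcs).const_mul _).mul_const _
    have e1 : (2⁻¹ : ℂ) * c ^ ((2⁻¹ : ℂ) - 1) * 1 = (2 * S)⁻¹ := by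
      rw [Complex.cpow_sub _ _ hc0, Complex.cpow_one, ← hS]
      nth_rewrite 1 [← hS2]
      field_simp
    have e2 : 2⁻¹ * (((2⁻¹ : ℂ) - 1) * c ^ ((2⁻¹ : ℂ) - 1 - 1) * 1) * 1 = -(4 * S ^ 3)⁻¹ := by
      rw [Complex.cpow_sub _ _ hc0, Complex.cpow_sub _ _ hc0, Complex.cpow_one, ← hS]
      nth_rewrite 1 2 [← hS2]
      field_simp
      norm_num
    have h := (hC i).scomp (φ := fun y : ℂ => y ^ (2⁻¹ : ℂ))
      (φ' := fun y : ℂ => (2⁻¹ : ℂ) * y ^ ((2⁻¹ : ℂ) - 1) * 1)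
      (c := 2⁻¹ * (((2⁻¹ : ℂ) - 1) * c ^ ((2⁻¹ : ℂ) - 1 - 1) * 1) * 1)
      (by simpa only [zero_smul, add_zero] using hd1)
      (by simpa only [zero_smul, add_zero] using hd2)
    simp only [zero_smul, add_zero] at h
    change HasSecondDeriv _ ((2⁻¹ : ℂ) * c ^ ((2⁻¹ : ℂ) - 1) * 1 * _)
      (_ * _ + ((2⁻¹ : ℂ) * c ^ ((2⁻¹ : ℂ) - 1) * 1) * _) at h
    rw [e1, e2] at h
    exact h
  have hM : ∀ i, HasSecondDeriv (fun s : ℝ =>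
      (((‖x + s • EuclideanSpace.single i (1 : ℝ)‖ ^ 2) ^ n)⁻¹ : ℝ))
      (-(n : ℝ) * (N ^ (n + 1))⁻¹ * (2 * x i))
      (n * (n + 1) * (N ^ (n + 2))⁻¹ * (2 * x i) ^ 2 + -(n : ℝ) * (N ^ (n + 1))⁻¹ * 2) := by
    intro i
    have hz : ∀ (k : ℕ) (y : ℝ), 0 < y →
        HasDerivAt (fun y : ℝ => (y ^ k)⁻¹) (-(k : ℝ) * (y ^ (k + 1))⁻¹) y := fun k y hy => by
      have := (hasDerivAt_pow k y).inv (pow_ne_zero k hy.ne')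
      refine this.congr_deriv ?_
      rcases k with _ | k
      · simp
      · have := hy.ne'
        simp
        field_simp
        ring
    have hd2 : HasDerivAt (fun y : ℝ => -(n : ℝ) * (y ^ (n + 1))⁻¹)
        (n * (n + 1) * (N ^ (n + 2))⁻¹) N :=
      ((hz (n + 1) N hN0).const_mul (-(n : ℝ))).congr_deriv (by push_cast; ring)
    have h := (hasSecondDeriv_normSq x i).scomp (φ := fun y : ℝ => (y ^ n)⁻¹)
      (φ' := fun y : ℝ => -(n : ℝ) * (y ^ (n + 1))⁻¹)
      (by
        filter_upwards [lt_mem_nhds (by simpa using hN0)] with y hy using hz n y hy)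
      (by simpa only [zero_smul, add_zero] using hd2)
    simpa only [zero_smul, add_zero] using h
  have hprod := fun i => (((hSd i).mul ((hM i).clm_comp Complex.ofRealCLM)).clm_comp
    Complex.reCLM)
  simp only [zero_smul, add_zero] at hprod
  have hsum : ∑ i, ((-(4 * S ^ 3)⁻¹ * (-2 * x i - 2 * Complex.I * δ i) ^ 2 + (2 * S)⁻¹ * (-2)) *
      (((N ^ n)⁻¹ : ℝ) : ℂ) + (2 * S)⁻¹ * (-2 * x i - 2 * Complex.I * δ i) *
        ((-(n : ℝ) * (N ^ (n + 1))⁻¹ * (2 * x i) : ℝ) : ℂ) +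
      ((2 * S)⁻¹ * (-2 * x i - 2 * Complex.I * δ i) *
        ((-(n : ℝ) * (N ^ (n + 1))⁻¹ * (2 * x i) : ℝ) : ℂ) +
      S * ((n * (n + 1) * (N ^ (n + 2))⁻¹ * (2 * x i) ^ 2 +
        -(n : ℝ) * (N ^ (n + 1))⁻¹ * 2 : ℝ) : ℂ))) =
      ((n * (N ^ (n + 1))⁻¹ : ℝ) : ℂ) * (((2 + N : ℝ) : ℂ) * S⁻¹ + ((2 * n : ℝ) : ℂ) * S) := by
    have e1 : ∑ i, ((x i : ℝ) : ℂ) ^ 2 = N := by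
      rw [hN, EuclideanSpace.real_norm_sq_eq]; push_cast; rfl
    have e2 : ∑ i, δ i = 1 := by simp [hδ]
    have e3 : ∑ i, ((x i : ℝ) : ℂ) * δ i = t := by simp [hδ, ht]
    have e4 : ∀ i, δ i ^ 2 = δ i := fun i => by simp only [hδ]; split_ifs <;> simp
    have hNc : (N : ℂ) ≠ 0 := by exact_mod_cast hN0.ne'
    have hI : Complex.I ^ 2 = -1 := Complex.I_sq
    have hterm : ∀ i, ((-(4 * S ^ 3)⁻¹ * (-2 * x i - 2 * Complex.I * δ i) ^ 2 + (2 * S)⁻¹ * (-2)) *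
      (((N ^ n)⁻¹ : ℝ) : ℂ) + (2 * S)⁻¹ * (-2 * x i - 2 * Complex.I * δ i) *
        ((-(n : ℝ) * (N ^ (n + 1))⁻¹ * (2 * x i) : ℝ) : ℂ) +
      ((2 * S)⁻¹ * (-2 * x i - 2 * Complex.I * δ i) *
        ((-(n : ℝ) * (N ^ (n + 1))⁻¹ * (2 * x i) : ℝ) : ℂ) +
      S * ((n * (n + 1) * (N ^ (n + 2))⁻¹ * (2 * x i) ^ 2 +
        -(n : ℝ) * (N ^ (n + 1))⁻¹ * 2 : ℝ) : ℂ))) =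
      (-(S ^ 3)⁻¹ * (N ^ n : ℂ)⁻¹ + 4 * n * S⁻¹ * (N ^ (n + 1) : ℂ)⁻¹ +
          4 * S * n * (n + 1) * (N ^ (n + 2) : ℂ)⁻¹) * (x i : ℂ) ^ 2 +
        (-(S ^ 3)⁻¹ * 2 * Complex.I * (N ^ n : ℂ)⁻¹ +
          4 * n * Complex.I * S⁻¹ * (N ^ (n + 1) : ℂ)⁻¹) * ((x i : ℂ) * δ i) +
        ((S ^ 3)⁻¹ * (N ^ n : ℂ)⁻¹) * δ i +
        (-S⁻¹ * (N ^ n : ℂ)⁻¹ - 2 * S * n * (N ^ (n + 1) : ℂ)⁻¹) := fun i => by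
      push_cast
      linear_combination (exp := 1) (-(S ^ 3)⁻¹ * (N ^ n : ℂ)⁻¹ * δ i ^ 2) * hI +
        ((S ^ 3)⁻¹ * (N ^ n : ℂ)⁻¹) * e4 i
    simp_rw [hterm, Finset.sum_add_distrib, ← Finset.mul_sum, e1, e2, e3]
    have ht' : 2 * Complex.I * (t : ℂ) = 1 - N - S ^ 2 := by rw [hS2, hc]; ring
    simp only [Finset.sum_const, Finset.card_univ, Fintype.card_fin, nsmul_eq_mul]
    push_cast
    have hP : (N : ℂ) ^ (n + 1) = N ^ n * N := pow_succ _ _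
    have hP2 : (N : ℂ) ^ (n + 2) = N ^ n * N * N := by ring
    rw [hP, hP2]
    have hPn : (N : ℂ) ^ n ≠ 0 := pow_ne_zero _ hNc
    set K : ℂ := (N : ℂ) ^ n
    have : (-(S ^ 3)⁻¹ * 2 * Complex.I * K⁻¹ + 4 * n * Complex.I * S⁻¹ * (K * N)⁻¹) * (t : ℂ) =
        (-(S ^ 3)⁻¹ * K⁻¹ + 2 * n * S⁻¹ * (K * N)⁻¹) * (1 - N - S ^ 2) := by
      rw [← ht']; ring
    rw [this]
    field_simp
    ring
  refine ⟨(n * (N ^ (n + 1))⁻¹) * ((2 + N) * (S⁻¹).re + 2 * n * S.re), ?_, ?_⟩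
  · have : 0 ≤ (S⁻¹).re := by
      rw [Complex.inv_re]
      exact div_nonneg hSre (Complex.normSq_nonneg _)
    positivity
  · refine ⟨_, _, fun i => (hprod i).congr (.of_forall fun s => ?_), ?_⟩
    · simp only [slitBarrier, Complex.ofRealCLM_apply, Complex.reCLM_apply, Complex.re_mul_ofReal]
    · rw [← map_sum]
      refine (congrArg Complex.reCLM hsum).trans ?_
      simp only [Complex.reCLM_apply, Complex.re_ofReal_mul, Complex.add_re]

end Barriers

end EdgeBarriers

/-- The Newtonian potential of a measure. -/
def potential (p : ℕ) (ν : Measure (EuclideanSpace ℝ (Fin (p + 1 + 1))))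
    (x : EuclideanSpace ℝ (Fin (p + 1 + 1))) : ℝ := ∫ w, newton p (x - w) ∂ν

/-- The fundamental solution `‖x‖ ^ (-p)` as an extended real, infinite at the origin. -/
def enewton (p : ℕ) (x : EuclideanSpace ℝ (Fin (p + 1 + 1))) : ℝ≥0∞ := (‖x‖ₑ ^ p)⁻¹

/-- The Newtonian potential of a measure, with values in the extended reals. -/
def epotential (p : ℕ) (ν : Measure (EuclideanSpace ℝ (Fin (p + 1 + 1))))
    (x : EuclideanSpace ℝ (Fin (p + 1 + 1))) : ℝ≥0∞ := ∫⁻ w, enewton p (x - w) ∂ν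

/-- The flat annulus with radii `r` and `2 * r`. -/
def flatAnnulus (n : ℕ) (r : ℝ) : Set (EuclideanSpace ℝ (Fin (n + 1))) :=
  (closedBall 0 (2 * r) \ ball 0 r) ∩ {x | x (Fin.last n) = 0}

/-- `ω` is a subprobability measure on `E` which reproduces at the origin all continuous bounded
potentials of measures on `E`. -/
def IsSwept (p : ℕ) (E : Set (EuclideanSpace ℝ (Fin (p + 1 + 1))))
    (ω : Measure (EuclideanSpace ℝ (Fin (p + 1 + 1)))) : Prop :=
  ω Eᶜ = 0 ∧ ω univ ≤ 1 ∧ ∀ ν : Measure (EuclideanSpace ℝ (Fin (p + 1 + 1))),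
    IsFiniteMeasure ν → ν Eᶜ = 0 → Continuous (potential p ν) → (∃ C, ∀ x, potential p ν x ≤ C) →
      potential p ν 0 = ∫ x, potential p ν x ∂ω

section FlatAnnulus

variable {n : ℕ} {r : ℝ}

lemma mem_flatAnnulus {x : EuclideanSpace ℝ (Fin (n + 1))} :
    x ∈ flatAnnulus n r ↔ r ≤ ‖x‖ ∧ ‖x‖ ≤ 2 * r ∧ x (Fin.last n) = 0 := by
  simp only [flatAnnulus, mem_inter_iff, Set.mem_sdiff, mem_closedBall, dist_zero_right, mem_ball,
    not_lt, mem_ofPred_eq]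
  tauto

lemma isCompact_flatAnnulus : IsCompact (flatAnnulus n r) := by
  have h : IsClosed {x : EuclideanSpace ℝ (Fin (n + 1)) | x (Fin.last n) = 0} :=
    isClosed_eq (by fun_prop) continuous_const
  exact ((isCompact_closedBall _ _).diff isOpen_ball).inter_right h

end FlatAnnulus

section Potentials

variable {p : ℕ}

lemma potential_nonneg (ν : Measure (EuclideanSpace ℝ (Fin (p + 1 + 1))))
    (x : EuclideanSpace ℝ (Fin (p + 1 + 1))) : 0 ≤ potential p ν x :=
  integral_nonneg fun _ => newton_nonneg _

lemma measurable_newton : Measurable (newton p) := by unfold newton; fun_prop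

lemma continuous_enewton : Continuous (enewton p) := by unfold enewton; fun_prop

lemma measurable_enewton : Measurable (enewton p) := continuous_enewton.measurable

lemma enewton_sub_comm (x y : EuclideanSpace ℝ (Fin (p + 1 + 1))) :
    enewton p (x - y) = enewton p (y - x) := by
  simp only [enewton, ← ofReal_norm, norm_sub_rev]

lemma enewton_eq_ofReal {x : EuclideanSpace ℝ (Fin (p + 1 + 1))} (hx : x ≠ 0) :
    enewton p x = ENNReal.ofReal (newton p x) := by
  have : 0 < ‖x‖ := norm_pos_iff.2 hx
  rw [enewton, newton, ENNReal.ofReal_inv_of_pos (by positivity),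
    ENNReal.ofReal_pow (norm_nonneg x), ofReal_norm]

lemma enewton_le_of_norm_le {x y : EuclideanSpace ℝ (Fin (p + 1 + 1))} (h : ‖x‖ ≤ ‖y‖) :
    enewton p y ≤ enewton p x := by
  simp only [enewton, ← ofReal_norm]
  gcongr

lemma enewton_le_ofReal {d : ℝ} (hd : 0 < d) {x : EuclideanSpace ℝ (Fin (p + 1 + 1))}
    (hx : d ≤ ‖x‖) : enewton p x ≤ ENNReal.ofReal (d ^ p)⁻¹ := by
  rw [enewton_eq_ofReal (norm_pos_iff.1 (hd.trans_le hx))]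
  exact ENNReal.ofReal_le_ofReal (newton_le_of_le_norm hd hx)

/-- The two notions of potential agree for a measure without mass at `x`. -/
lemma epotential_eq_ofReal {ν : Measure (EuclideanSpace ℝ (Fin (p + 1 + 1)))}
    {x : EuclideanSpace ℝ (Fin (p + 1 + 1))} (hx : ν {x} = 0)
    (hi : Integrable (fun w => newton p (x - w)) ν) :
    epotential p ν x = ENNReal.ofReal (potential p ν x) := by
  rw [potential, ofReal_integral_eq_lintegral_ofReal hi (.of_forall fun _ => newton_nonneg _),
    epotential]
  refine lintegral_congr_ae ?_
  filter_upwards [show ∀ᵐ w ∂ν, w ≠ x by simpa [ae_iff] using hx] with w hw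
  exact enewton_eq_ofReal (sub_ne_zero.2 hw.symm)

lemma potential_map_smul_add (μ : Measure (EuclideanSpace ℝ (Fin (p + 1 + 1)))) {s : ℝ}
    (hs : 0 < s) (z x : EuclideanSpace ℝ (Fin (p + 1 + 1))) :
    potential p (μ.map fun w => z + s • w) x = (s ^ p)⁻¹ * potential p μ (s⁻¹ • (x - z)) := by
  have hm : Measurable fun w => newton p (x - w) := measurable_newton.comp (by fun_prop)
  rw [potential, integral_map (by fun_prop) hm.aestronglyMeasurable, potential,
    ← integral_const_mul]
  refine integral_congr_ae (.of_forall fun w => ?_)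
  simp only
  rw [← newton_smul hs, smul_sub, smul_inv_smul₀ hs.ne', sub_sub]

variable {ω : Measure (EuclideanSpace ℝ (Fin (p + 1 + 1)))}

lemma measurable_epotential [SFinite ω] : Measurable (epotential p ω) :=
  (measurable_enewton.comp (by fun_prop : Measurable fun q :
    EuclideanSpace ℝ (Fin (p + 1 + 1)) × EuclideanSpace ℝ (Fin (p + 1 + 1)) =>
      q.1 - q.2)).lintegral_prod_right'

lemma IsSwept.lintegral_epotential {E : Set (EuclideanSpace ℝ (Fin (p + 1 + 1)))}
    (hω : IsSwept p E ω)
    (hE : MeasurableSet E)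
    {μ : Measure (EuclideanSpace ℝ (Fin (p + 1 + 1)))} [IsFiniteMeasure μ]
    (hμ1 : ∀ x, μ {x} = 0) (hμ2 : ∀ x, Integrable (fun w => newton p (x - w)) μ)
    (hμ3 : Continuous (potential p μ)) (hμ4 : ∃ C, ∀ x, potential p μ x ≤ C)
    {z : EuclideanSpace ℝ (Fin (p + 1 + 1))} {s : ℝ} (hs : 0 < s)
    (hzs : ∀ᵐ w ∂μ, z + s • w ∈ E) :
    ∫⁻ w, epotential p ω (z + s • w) ∂μ = ∫⁻ w, enewton p (z + s • w) ∂μ := by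
  have hωf : IsFiniteMeasure ω := ⟨hω.2.1.trans_lt one_lt_top⟩
  set T : EuclideanSpace ℝ (Fin (p + 1 + 1)) → EuclideanSpace ℝ (Fin (p + 1 + 1)) :=
    fun w => z + s • w with hT
  have hTm : Measurable T := by fun_prop
  set ν := μ.map T with hν
  have hνE : ν Eᶜ = 0 := by
    have : ∀ᵐ w ∂ν, w ∈ E := (ae_map_iff hTm.aemeasurable hE).2 hzs
    exact this
  have hcont : Continuous (potential p ν) := by
    have : potential p ν = fun x => (s ^ p)⁻¹ * potential p μ (s⁻¹ • (x - z)) :=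
      funext fun x => potential_map_smul_add μ hs z x
    rw [this]
    fun_prop
  obtain ⟨C, hC⟩ := hμ4
  have hbd : ∀ x, potential p ν x ≤ (s ^ p)⁻¹ * C := fun x => by
    rw [potential_map_smul_add μ hs z x]
    exact mul_le_mul_of_nonneg_left (hC _) (by positivity)
  have hrep := hω.2.2 ν (Measure.isFiniteMeasure_map μ T) hνE hcont ⟨_, hbd⟩
  have hν1 : ∀ x, ν {x} = 0 := fun x => by
    rw [hν, Measure.map_apply hTm (measurableSet_singleton x)]
    refine measure_mono_null (t := {s⁻¹ • (x - z)}) (fun w hw => ?_) (hμ1 _)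
    have : z + s • w = x := hw
    rw [mem_singleton_iff, ← this, add_sub_cancel_left, inv_smul_smul₀ hs.ne']
  have hν2 : ∀ x, Integrable (fun w => newton p (x - w)) ν := fun x => by
    have hm : Measurable fun w => newton p (x - w) := measurable_newton.comp (by fun_prop)
    rw [hν, integrable_map_measure hm.aestronglyMeasurable hTm.aemeasurable]
    refine ((hμ2 (s⁻¹ • (x - z))).const_mul (s ^ p)⁻¹).congr (.of_forall fun w => ?_)
    simp only [Function.comp, hT]
    rw [← newton_smul hs, smul_sub, smul_inv_smul₀ hs.ne', sub_sub]
  have h_int : Integrable (potential p ν) ω := by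
    refine Integrable.of_bound hcont.aestronglyMeasurable ((s ^ p)⁻¹ * C) (.of_forall fun x => ?_)
    rw [Real.norm_of_nonneg (potential_nonneg _ _)]
    exact hbd x
  have e1 : ∫⁻ x, epotential p ν x ∂ω = epotential p ν 0 := by
    rw [epotential_eq_ofReal (hν1 0) (hν2 0), hrep,
      ofReal_integral_eq_lintegral_ofReal h_int (.of_forall fun _ => potential_nonneg _ _)]
    exact lintegral_congr fun x => epotential_eq_ofReal (hν1 x) (hν2 x)
  have e2 : ∫⁻ x, epotential p ν x ∂ω = ∫⁻ w, epotential p ω w ∂ν := by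
    simp only [epotential]
    have hm : Measurable (Function.uncurry fun x w : EuclideanSpace ℝ (Fin (p + 1 + 1)) =>
        enewton p (x - w)) :=
      measurable_enewton.comp (by fun_prop : Measurable fun q :
        EuclideanSpace ℝ (Fin (p + 1 + 1)) × EuclideanSpace ℝ (Fin (p + 1 + 1)) => q.1 - q.2)
    rw [lintegral_lintegral_swap hm.aemeasurable]
    exact lintegral_congr fun x => lintegral_congr fun y => enewton_sub_comm _ _
  rw [← lintegral_map measurable_epotential hTm, ← lintegral_map measurable_enewton hTm,
    ← hν, ← e2, e1, epotential]
  exact lintegral_congr fun w => by rw [enewton_sub_comm, sub_zero]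

/-- The radial perturbation moving a point of `[1, 2]` at distance at least `s` of the endpoints. -/
lemma add_smul_mem_flatAnnulus {z w : EuclideanSpace ℝ (Fin (p + 1 + 1))} {s : ℝ} (hs : 0 ≤ s)
    (hz1 : 1 + s ≤ ‖z‖) (hz2 : ‖z‖ ≤ 2 - s) (hz : z (Fin.last (p + 1)) = 0)
    (hw : ‖w‖ ≤ 1 ∧ w (Fin.last (p + 1)) = 0) : z + s • w ∈ flatAnnulus (p + 1) 1 := by
  have hsw : ‖s • w‖ ≤ s := by
    rw [norm_smul, Real.norm_of_nonneg hs]; nlinarith [hw.1]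
  have h1 := norm_add_le z (s • w)
  have h2 := norm_sub_le_norm_add z (s • w)
  rw [mem_flatAnnulus]
  refine ⟨by linarith, by linarith, ?_⟩
  simp [hz, hw.2]

lemma IsSwept.epotential_le (hp : p ≠ 0) (hω : IsSwept p (flatAnnulus (p + 1) 1) ω)
    {z : EuclideanSpace ℝ (Fin (p + 1 + 1))} (hz : z ∈ flatAnnulus (p + 1) 1) :
    epotential p ω z ≤ enewton p z := by
  have hωf : IsFiniteMeasure ω := ⟨hω.2.1.trans_lt one_lt_top⟩
  obtain ⟨μ, hμf, hμ0, hμ, hμ1, hμ2, hμ3, hμ4⟩ := exists_disc_measure hp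
  obtain ⟨ha1, ha2, hzl⟩ := mem_flatAnnulus.1 hz
  rw [mul_one] at ha2
  set a := ‖z‖
  set b : ℝ → ℝ := fun s => max (1 + s) (min a (2 - s))
  set ζ : ℝ → EuclideanSpace ℝ (Fin (p + 1 + 1)) := fun s => (b s / a) • z
  have hb0 : b 0 = a := by simp [b, ha1, ha2]
  have hbc : Continuous b := by fun_prop
  have ha0 : a ≠ 0 := by linarith
  have hζ0 : ζ 0 = z := by simp [ζ, hb0, ha0]
  have hζc : Continuous ζ := by fun_prop
  set σ : ℕ → ℝ := fun k => 1 / ((k : ℝ) + 2)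
  have hσ : Tendsto σ atTop (𝓝 0) := by
    have := (tendsto_one_div_add_atTop_nhds_zero_nat (𝕜 := ℝ)).comp (tendsto_add_atTop_nat 1)
    refine this.congr fun k => ?_
    simp only [Function.comp, σ]
    push_cast
    ring_nf
  have hσ0 : ∀ k, 0 < σ k := fun k => by positivity
  have hσ1 : ∀ k, σ k ≤ 1 / 2 := fun k => by
    simp only [σ]
    exact one_div_le_one_div_of_le (by norm_num) (by linarith [Nat.cast_nonneg (α := ℝ) k])
  have hζn : ∀ k, ‖ζ (σ k)‖ = b (σ k) := fun k => by
    have hb : 0 ≤ b (σ k) := le_max_of_le_left (by linarith [hσ0 k])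
    simp only [ζ]
    rw [norm_smul, Real.norm_of_nonneg (by positivity)]
    exact div_mul_cancel₀ _ ha0
  have hb1 : ∀ k, 1 + σ k ≤ b (σ k) := fun k => le_max_left _ _
  have hb2 : ∀ k, b (σ k) ≤ 2 - σ k := fun k =>
    max_le (by linarith [hσ1 k]) (min_le_right _ _)
  have hdisc : ∀ k, ∀ᵐ w ∂μ, ζ (σ k) + σ k • w ∈ flatAnnulus (p + 1) 1 := fun k => by
    filter_upwards [hμ] with w hw
    exact add_smul_mem_flatAnnulus (hσ0 k).le (by rw [hζn]; exact hb1 k) (by rw [hζn]; exact hb2 k)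
      (by simp [ζ, hzl]) hw
  have hEq := fun k => hω.lintegral_epotential isCompact_flatAnnulus.measurableSet hμ1 hμ2 hμ3
    hμ4 (hσ0 k) (hdisc k)
  have hlim : ∀ w, Tendsto (fun k => ζ (σ k) + σ k • w) atTop (𝓝 z) := fun w => by
    have : Continuous fun s : ℝ => ζ s + s • w := by fun_prop
    have := (this.tendsto 0).comp hσ
    simpa [hζ0, Function.comp_def] using this
  have hfatou1 : ∀ w, epotential p ω z ≤
      liminf (fun k => epotential p ω (ζ (σ k) + σ k • w)) atTop := fun w => by
    refine le_trans (le_of_eq ?_) (lintegral_liminf_le fun k =>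
      measurable_enewton.comp (by fun_prop))
    refine lintegral_congr fun x => ((Tendsto.liminf_eq ?_)).symm
    exact (continuous_enewton.tendsto _).comp ((hlim w).sub_const x)
  have hfatou2 : epotential p ω z * μ univ ≤
      liminf (fun k => ∫⁻ w, epotential p ω (ζ (σ k) + σ k • w) ∂μ) atTop := by
    calc epotential p ω z * μ univ = ∫⁻ _, epotential p ω z ∂μ := by rw [lintegral_const]
      _ ≤ ∫⁻ w, liminf (fun k => epotential p ω (ζ (σ k) + σ k • w)) atTop ∂μ :=
        lintegral_mono hfatou1
      _ ≤ _ := lintegral_liminf_le fun k => measurable_epotential.comp (by fun_prop)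
  have hup : ∀ k, ∫⁻ w, epotential p ω (ζ (σ k) + σ k • w) ∂μ ≤
      ENNReal.ofReal ((b (σ k) - σ k) ^ p)⁻¹ * μ univ := fun k => by
    rw [hEq, ← lintegral_const]
    refine lintegral_mono_ae ?_
    filter_upwards [hμ] with w hw
    refine enewton_le_ofReal (by linarith [hb1 k]) ?_
    have h2 := norm_sub_le_norm_add (ζ (σ k)) (σ k • w)
    have hsw : ‖σ k • w‖ ≤ σ k := by
      rw [norm_smul, Real.norm_of_nonneg (hσ0 k).le]; nlinarith [hw.1, hσ0 k]
    rw [hζn] at h2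
    linarith
  have hfin : Tendsto (fun k => ENNReal.ofReal ((b (σ k) - σ k) ^ p)⁻¹ * μ univ) atTop
      (𝓝 (ENNReal.ofReal (a ^ p)⁻¹ * μ univ)) := by
    refine ENNReal.Tendsto.mul_const ?_ (Or.inr (measure_ne_top μ _))
    refine (ENNReal.continuous_ofReal.tendsto _).comp (Tendsto.inv₀ ?_ (pow_ne_zero _ ha0))
    have : Continuous fun s => (b s - s) ^ p := by fun_prop
    simpa [hb0, Function.comp_def] using (this.tendsto 0).comp hσ
  have hz0 : z ≠ 0 := norm_ne_zero_iff.1 ha0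
  rw [enewton_eq_ofReal hz0]
  have := hfatou2.trans ((liminf_le_liminf (.of_forall hup)).trans_eq hfin.liminf_eq)
  exact (ENNReal.mul_le_mul_iff_left hμ0 (measure_ne_top μ _)).1 this

end Potentials

section Barriers

variable {n : ℕ}

lemma slitRoot_re_eq (x : EuclideanSpace ℝ (Fin (n + 1))) :
    (slitRoot x).re =
      √((√((1 - ‖x‖ ^ 2) ^ 2 + 4 * x (Fin.last n) ^ 2) + (1 - ‖x‖ ^ 2)) / 2) := by
  rw [slitRoot, Complex.cpow_inv_two_re, Complex.norm_eq_sqrt_sq_add_sq]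
  simp only [Complex.sub_re, Complex.one_re, Complex.ofReal_re, Complex.mul_re, Complex.re_ofNat,
    Complex.I_re, Complex.im_ofNat, Complex.I_im, Complex.mul_im, Complex.sub_im, Complex.one_im,
    Complex.ofReal_im]
  ring_nf

lemma sq_last_le (x : EuclideanSpace ℝ (Fin (n + 1))) : x (Fin.last n) ^ 2 ≤ ‖x‖ ^ 2 := by
  rw [EuclideanSpace.norm_sq_eq]
  rw [← sq_abs, ← Real.norm_eq_abs]
  exact Finset.single_le_sum (f := fun i => ‖x i‖ ^ 2) (fun i _ => by positivity)
    (Finset.mem_univ (Fin.last n))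

lemma slitRoot_re_le_one (x : EuclideanSpace ℝ (Fin (n + 1))) : (slitRoot x).re ≤ 1 := by
  rw [slitRoot_re_eq, Real.sqrt_le_left zero_le_one]
  have : √((1 - ‖x‖ ^ 2) ^ 2 + 4 * x (Fin.last n) ^ 2) ≤ 1 + ‖x‖ ^ 2 := by
    rw [Real.sqrt_le_left (by positivity)]
    nlinarith [sq_last_le x]
  linarith

lemma slitBarrier_nonneg (x : EuclideanSpace ℝ (Fin (n + 1))) : 0 ≤ slitBarrier x := by
  rw [slitBarrier, slitRoot_re_eq]; positivity

lemma slitBarrier_le (x : EuclideanSpace ℝ (Fin (n + 1))) : slitBarrier x ≤ ((‖x‖ ^ 2) ^ n)⁻¹ :=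
  mul_le_of_le_one_left (by positivity) (slitRoot_re_le_one x)

lemma continuous_slitRoot_re :
    Continuous fun x : EuclideanSpace ℝ (Fin (n + 1)) => (slitRoot x).re := by
  simp only [slitRoot_re_eq]
  fun_prop

lemma continuousAt_slitBarrier {x : EuclideanSpace ℝ (Fin (n + 1))} (hx : x ≠ 0) :
    ContinuousAt slitBarrier x := by
  have : (‖x‖ ^ 2) ^ n ≠ 0 := by have := norm_pos_iff.2 hx; positivity
  unfold slitBarrier
  exact continuous_slitRoot_re.continuousAt.mul (ContinuousAt.inv₀ (by fun_prop) this)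

lemma slitBarrier_eq_zero {x : EuclideanSpace ℝ (Fin (n + 1))} (hx : 1 ≤ ‖x‖)
    (ht : x (Fin.last n) = 0) : slitBarrier x = 0 := by
  have : √((1 - ‖x‖ ^ 2) ^ 2 + 4 * 0 ^ 2) = ‖x‖ ^ 2 - 1 := by
    rw [show (1 - ‖x‖ ^ 2) ^ 2 + 4 * 0 ^ 2 = (‖x‖ ^ 2 - 1) ^ 2 by ring]
    exact Real.sqrt_sq (by nlinarith)
  rw [slitBarrier, slitRoot_re_eq, ht, this]
  simp

lemma edgeQuad_nonneg (x : EuclideanSpace ℝ (Fin (n + 1))) : 0 ≤ edgeQuad x := by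
  unfold edgeQuad; positivity

lemma continuous_edgeQuad : Continuous (edgeQuad : EuclideanSpace ℝ (Fin (n + 1)) → ℝ) := by
  unfold edgeQuad; fun_prop

lemma edgeQuad_eq_zero_iff {x : EuclideanSpace ℝ (Fin (n + 1))} :
    edgeQuad x = 0 ↔ ‖x‖ = 1 ∧ x (Fin.last n) = 0 := by
  constructor
  · intro h
    unfold edgeQuad at h
    have h1 : ‖x‖ ^ 2 - 1 = 0 := by
      rw [← sq_eq_zero_iff]; nlinarith [sq_nonneg (‖x‖ ^ 2 - 1), sq_nonneg (x (Fin.last n))]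
    have h2 : x (Fin.last n) = 0 := by
      rw [← sq_eq_zero_iff]; nlinarith [sq_nonneg (‖x‖ ^ 2 - 1), sq_nonneg (x (Fin.last n))]
    exact ⟨(pow_eq_one_iff_of_nonneg (norm_nonneg x) two_ne_zero).1 (by linarith), h2⟩
  · rintro ⟨h1, h2⟩
    simp [edgeQuad, h1, h2]

lemma continuousAt_edgePole {x : EuclideanSpace ℝ (Fin (n + 1))} (hx : edgeQuad x ≠ 0) :
    ContinuousAt edgePole x := by
  have := continuous_edgeQuad (n := n)
  have h : ContinuousAt (fun y : EuclideanSpace ℝ (Fin (n + 1)) => Real.log (edgeQuad y)) x :=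
    ContinuousAt.log (by fun_prop) hx
  unfold edgePole
  fun_prop

lemma exists_le_edgePole (R : ℝ) :
    ∃ C : ℝ, 0 ≤ C ∧ ∀ x : EuclideanSpace ℝ (Fin (n + 1)), ‖x‖ ≤ R → -C ≤ edgePole x := by
  have := continuous_edgeQuad (n := n)
  have hg : Continuous fun x : EuclideanSpace ℝ (Fin (n + 1)) =>
    edgeQuad x + n * √(edgeQuad x) + (n + 1) * ‖x‖ ^ 2 := by fun_prop
  obtain ⟨C, hC⟩ := (isCompact_closedBall (0 : EuclideanSpace ℝ (Fin (n + 1))) R).bddAbove_image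
    hg.continuousOn
  refine ⟨max C 0, le_max_right _ _, fun x hx => ?_⟩
  have h1 := hC (mem_image_of_mem _ (mem_closedBall_zero_iff.2 hx))
  have h2 := Real.log_le_self (edgeQuad_nonneg x)
  have h3 := le_max_left C 0
  unfold edgePole
  linarith

lemma eventually_lt_edgePole {e : EuclideanSpace ℝ (Fin (n + 1))} (he : edgeQuad e = 0) (M : ℝ) :
    ∀ᶠ x in 𝓝 e, edgeQuad x ≠ 0 → M < edgePole x := by
  have hq := continuous_edgeQuad (n := n)
  have hg : Continuous fun x : EuclideanSpace ℝ (Fin (n + 1)) =>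
    n * √(edgeQuad x) + (n + 1) * ‖x‖ ^ 2 := by fun_prop
  have h1 := (hg.tendsto e).eventually_lt_const (lt_add_one _)
  have h2 := Real.tendsto_log_nhdsNE_zero.eventually_lt_atBot
    (-(M + (n * √(edgeQuad e) + (n + 1) * ‖e‖ ^ 2 + 1)))
  rw [eventually_nhdsWithin_iff] at h2
  have h3 := (by simpa [he] using hq.tendsto e : Tendsto edgeQuad (𝓝 e) (𝓝 0)).eventually h2
  filter_upwards [h1, h3] with x hx1 hx3 hx
  have := hx3 hx
  unfold edgePole
  linarith

end Barriers

section SweptBounds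

variable {p : ℕ} {ω : Measure (EuclideanSpace ℝ (Fin (p + 1 + 1)))}

lemma epotential_mono {E : Set (EuclideanSpace ℝ (Fin (p + 1 + 1)))} (hω : ω Eᶜ = 0)
    {x z : EuclideanSpace ℝ (Fin (p + 1 + 1))} (h : ∀ w ∈ E, ‖z - w‖ ≤ ‖x - w‖) :
    epotential p ω x ≤ epotential p ω z := by
  refine lintegral_mono_ae ?_
  filter_upwards [show ∀ᵐ w ∂ω, w ∈ E from hω] with w hw
  exact enewton_le_of_norm_le (h w hw)

lemma epotential_le_ofReal {E : Set (EuclideanSpace ℝ (Fin (p + 1 + 1)))} (hω : IsSwept p E ω)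
    {x : EuclideanSpace ℝ (Fin (p + 1 + 1))} {d : ℝ} (hd : 0 < d) (h : ∀ w ∈ E, d ≤ ‖x - w‖) :
    epotential p ω x ≤ ENNReal.ofReal (d ^ p)⁻¹ := by
  calc epotential p ω x ≤ ∫⁻ _, ENNReal.ofReal (d ^ p)⁻¹ ∂ω := by
        refine lintegral_mono_ae ?_
        filter_upwards [show ∀ᵐ w ∂ω, w ∈ E from hω.1] with w hw
        exact enewton_le_ofReal hd (h w hw)
    _ = ENNReal.ofReal (d ^ p)⁻¹ * ω univ := by rw [lintegral_const]
    _ ≤ _ := mul_le_of_le_one_right' hω.2.1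

lemma nonempty_flatAnnulus : (flatAnnulus (p + 1) 1).Nonempty := by
  refine ⟨EuclideanSpace.single 0 1, mem_flatAnnulus.2 ⟨by simp, by simp, ?_⟩⟩
  simp [Fin.ext_iff]

lemma IsSwept.epotential_le_two_pow (hp : p ≠ 0) (hω : IsSwept p (flatAnnulus (p + 1) 1) ω)
    (x : EuclideanSpace ℝ (Fin (p + 1 + 1))) : epotential p ω x ≤ ENNReal.ofReal (2 ^ p) := by
  obtain ⟨z, hz, hxz⟩ := isCompact_flatAnnulus.exists_infDist_eq_dist
    (nonempty_flatAnnulus (p := p)) x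
  have hzx : ∀ w ∈ flatAnnulus (p + 1) 1, ‖(2 : ℝ)⁻¹ • (z - w)‖ ≤ ‖x - w‖ := fun w hw => by
    have h1 : ‖x - z‖ ≤ ‖x - w‖ := by
      rw [← dist_eq_norm, ← dist_eq_norm, ← hxz]; exact infDist_le_dist_of_mem hw
    have h2 : ‖z - w‖ ≤ ‖x - z‖ + ‖x - w‖ := by
      rw [norm_sub_rev x z]; simpa using norm_add_le (z - x) (x - w)
    rw [norm_smul]
    norm_num
    linarith
  have hhalf : ∀ w, enewton p ((2 : ℝ)⁻¹ • w) = ENNReal.ofReal (2 ^ p) * enewton p w := fun w => by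
    have h2 : ‖(2 : ℝ)⁻¹‖ₑ = 2⁻¹ := by
      rw [← ofReal_norm, norm_inv, ENNReal.ofReal_inv_of_pos (by norm_num)]; norm_num
    rw [enewton, enewton, enorm_smul, h2, mul_pow, ENNReal.mul_inv (by simp) (by simp),
      ENNReal.ofReal_pow (by norm_num), ← ENNReal.inv_pow, inv_inv]
    simp
  calc epotential p ω x ≤ ∫⁻ w, ENNReal.ofReal (2 ^ p) * enewton p (z - w) ∂ω := by
        refine lintegral_mono_ae ?_
        filter_upwards [show ∀ᵐ w ∂ω, w ∈ flatAnnulus (p + 1) 1 from hω.1] with w hw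
        rw [← hhalf]
        exact enewton_le_of_norm_le (hzx w hw)
    _ = ENNReal.ofReal (2 ^ p) * epotential p ω z := by
        rw [lintegral_const_mul' _ _ ENNReal.ofReal_ne_top]; rfl
    _ ≤ ENNReal.ofReal (2 ^ p) * 1 := by
        gcongr
        refine (hω.epotential_le hp hz).trans ((enewton_le_ofReal one_pos
          (mem_flatAnnulus.1 hz).1).trans ?_)
        simp
    _ = _ := mul_one _

/-- Every point of the relative interior of the flat annulus is a regular boundary point. -/
lemma IsSwept.epotential_le_near (hp : p ≠ 0) (hω : IsSwept p (flatAnnulus (p + 1) 1) ω)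
    {e x : EuclideanSpace ℝ (Fin (p + 1 + 1))} (he : e ∈ flatAnnulus (p + 1) 1)
    (hx : ‖x - e‖ ≤ ‖e‖ - 1) :
    epotential p ω x ≤ ENNReal.ofReal ((‖e‖ - ‖x - e‖) ^ p)⁻¹ := by
  set K : Set (EuclideanSpace ℝ (Fin (p + 1 + 1))) :=
    closedBall 0 2 ∩ {x | x (Fin.last (p + 1)) = 0} with hK
  have hKc : IsClosed K := isClosed_closedBall.inter (isClosed_eq (by fun_prop) continuous_const)
  have hKv : Convex ℝ K := (convex_closedBall _ _).inter fun x hx y hy a b _ _ _ => by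
    have hx : x (Fin.last (p + 1)) = 0 := hx
    have hy : y (Fin.last (p + 1)) = 0 := hy
    simp [hx, hy]
  have hEK : flatAnnulus (p + 1) 1 ⊆ K := fun w hw => by
    have := mem_flatAnnulus.1 hw
    exact ⟨by simpa using this.2.1, this.2.2⟩
  obtain ⟨z, hz, hxz⟩ := exists_norm_eq_iInf_of_complete_convex ⟨e, hEK he⟩ hKc.isComplete hKv x
  rw [norm_eq_iInf_iff_real_inner_le_zero hKv hz] at hxz
  have hle : ∀ w ∈ K, ‖z - w‖ ≤ ‖x - w‖ := fun w hw => by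
    have h1 := hxz w hw
    have h2 : ‖x - w‖ ^ 2 = ‖x - z‖ ^ 2 - 2 * inner ℝ (x - z) (w - z) + ‖z - w‖ ^ 2 := by
      rw [show x - w = (x - z) - (w - z) by abel, norm_sub_sq_real, norm_sub_rev w z]
    exact le_of_sq_le_sq (by nlinarith [sq_nonneg ‖x - z‖]) (norm_nonneg _)
  have h1 : ‖e‖ - ‖x - e‖ ≤ ‖z‖ := by
    have := hle e (hEK he)
    have h3 := norm_sub_norm_le e z
    rw [norm_sub_rev] at h3
    linarith
  have hzE : z ∈ flatAnnulus (p + 1) 1 :=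
    mem_flatAnnulus.2 ⟨by linarith, by simpa using hz.1, hz.2⟩
  exact (epotential_mono hω.1 fun w hw => hle w (hEK hw)).trans
    ((hω.epotential_le hp hzE).trans (enewton_le_ofReal (by linarith) h1))

lemma IsSwept.epotential_eq_potential (hp : p ≠ 0) (hω : IsSwept p (flatAnnulus (p + 1) 1) ω)
    {x : EuclideanSpace ℝ (Fin (p + 1 + 1))} (hx : x ∉ flatAnnulus (p + 1) 1) :
    epotential p ω x = ENNReal.ofReal (potential p ω x) := by
  have hx0 : ω {x} = 0 := measure_mono_null (singleton_subset_iff.2 hx) hω.1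
  have hm : Measurable fun w => newton p (x - w) := measurable_newton.comp (by fun_prop)
  refine epotential_eq_ofReal hx0 ⟨hm.aestronglyMeasurable, ?_⟩
  refine lt_of_le_of_lt (lintegral_mono_ae ?_)
    ((hω.epotential_le_two_pow hp x).trans_lt ENNReal.ofReal_lt_top)
  filter_upwards [show ∀ᵐ w ∂ω, w ≠ x by simpa [ae_iff] using hx0] with w hw
  rw [enewton_eq_ofReal (sub_ne_zero.2 hw.symm), ← ofReal_norm,
    Real.norm_of_nonneg (newton_nonneg _)]

lemma IsSwept.potential_le (hp : p ≠ 0) (hω : IsSwept p (flatAnnulus (p + 1) 1) ω)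
    {x : EuclideanSpace ℝ (Fin (p + 1 + 1))} (hx : x ∉ flatAnnulus (p + 1) 1) {c : ℝ} (hc : 0 ≤ c)
    (h : epotential p ω x ≤ ENNReal.ofReal c) : potential p ω x ≤ c := by
  rwa [hω.epotential_eq_potential hp hx, ENNReal.ofReal_le_ofReal_iff hc] at h

lemma IsSwept.contDiffAt_potential (hω : IsSwept p (flatAnnulus (p + 1) 1) ω)
    {x : EuclideanSpace ℝ (Fin (p + 1 + 1))} (hx : x ∉ flatAnnulus (p + 1) 1) :
    ContDiffAt ℝ 2 (potential p ω) x := by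
  have hωf : IsFiniteMeasure ω := ⟨hω.2.1.trans_lt one_lt_top⟩
  exact (isHarmonicOn_potential ω isCompact_flatAnnulus hω.1).1.contDiffAt
    (isCompact_flatAnnulus.isClosed.isOpen_compl.mem_nhds hx)

lemma IsSwept.hasLaplacianAt_potential (hω : IsSwept p (flatAnnulus (p + 1) 1) ω)
    {x : EuclideanSpace ℝ (Fin (p + 1 + 1))} (hx : x ∉ flatAnnulus (p + 1) 1) :
    HasLaplacianAt (potential p ω) 0 x := by
  have hωf : IsFiniteMeasure ω := ⟨hω.2.1.trans_lt one_lt_top⟩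
  have h := (isHarmonicOn_potential ω isCompact_flatAnnulus hω.1).2 x hx
  have h2 := (hω.contDiffAt_potential hx).hasLaplacianAt
  rw [← h]
  exact h2

end SweptBounds

section Comparison

variable {p : ℕ} {ω : Measure (EuclideanSpace ℝ (Fin (p + 1 + 1)))}

lemma barrier_le_one {x : EuclideanSpace ℝ (Fin (p + 1 + 1))} (hx : 1 / 4 < ‖x‖) :
    (16 ^ (p + 1) : ℝ)⁻¹ * slitBarrier x ≤ 1 := by
  have h1 := slitBarrier_le x
  have h2 : ((‖x‖ ^ 2) ^ (p + 1))⁻¹ ≤ 16 ^ (p + 1) := by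
    rw [inv_le_comm₀ (by positivity) (by positivity), ← inv_pow]
    gcongr
    nlinarith
  rw [inv_mul_le_iff₀ (by positivity)]
  linarith

lemma tendsto_slitBarrier : Tendsto (slitBarrier : EuclideanSpace ℝ (Fin (p + 1 + 1)) → ℝ)
    (Bornology.cobounded _) (𝓝 0) := by
  have h1 : Tendsto (fun x : EuclideanSpace ℝ (Fin (p + 1 + 1)) => ((‖x‖ ^ 2) ^ (p + 1))⁻¹)
      (Bornology.cobounded _) (𝓝 0) :=
    (((tendsto_pow_atTop (by simp)).comp (tendsto_pow_atTop two_ne_zero)).comp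
      tendsto_norm_cobounded_atTop).inv_tendsto_atTop
  exact squeeze_zero slitBarrier_nonneg slitBarrier_le h1

/-- The subharmonic barrier lies below the difference between the fundamental solution and its
balayage on the flat annulus. -/
lemma IsSwept.potential_add_slitBarrier_le (hp : p ≠ 0)
    (hω : IsSwept p (flatAnnulus (p + 1) 1) ω) {x₀ : EuclideanSpace ℝ (Fin (p + 1 + 1))}
    (hx₀ : 1 / 4 < ‖x₀‖) (hx₀E : x₀ ∉ flatAnnulus (p + 1) 1) :
    potential p ω x₀ + (16 ^ (p + 1) : ℝ)⁻¹ * slitBarrier x₀ ≤ newton p x₀ := by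
  have hωf : IsFiniteMeasure ω := ⟨hω.2.1.trans_lt one_lt_top⟩
  set E : Set (EuclideanSpace ℝ (Fin (p + 1 + 1))) := flatAnnulus (p + 1) 1 with hE
  have hEc : IsClosed E := isCompact_flatAnnulus.isClosed
  set γ : ℝ := (16 ^ (p + 1) : ℝ)⁻¹ with hγ
  have hγ0 : 0 < γ := by positivity
  set g : EuclideanSpace ℝ (Fin (p + 1 + 1)) → ℝ := fun x =>
    newton p x + ((-1) * potential p ω x + (-γ) * slitBarrier x) with hg
  suffices H : ∀ δ > 0, 0 ≤ g x₀ + 2 * δ by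
    have : 0 ≤ g x₀ := le_of_forall_pos_le_add fun ε hε => by
      have := H (ε / 2) (by positivity)
      linarith
    simp only [hg] at this
    linarith
  intro δ hδ
  have hfar : ∀ᶠ x in Bornology.cobounded (EuclideanSpace ℝ (Fin (p + 1 + 1))), -δ < g x := by
    have hpot : Tendsto (potential p ω) (Bornology.cobounded _) (𝓝 0) := by
      refine tendsto_potential hp ω (R := 2) ?_
      filter_upwards [show ∀ᵐ w ∂ω, w ∈ E from hω.1] with w hw
      simpa using (mem_flatAnnulus.1 hw).2.1
    have : Tendsto g (Bornology.cobounded _) (𝓝 (0 + ((-1) * 0 + (-γ) * 0))) :=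
      (newton_tendsto hp).add ((hpot.const_mul _).add (tendsto_slitBarrier.const_mul _))
    exact this.eventually_const_lt (by simpa using hδ)
  obtain ⟨R₀, hR₀⟩ : ∃ R₀, ∀ x : EuclideanSpace ℝ (Fin (p + 1 + 1)), R₀ < ‖x‖ → -δ < g x := by
    rw [← comap_norm_atTop, eventually_comap] at hfar
    obtain ⟨R₀, hR₀⟩ := eventually_atTop.1 hfar
    exact ⟨R₀, fun x hx => hR₀ _ hx.le x rfl⟩
  set R : ℝ := max R₀ ‖x₀‖ + 1 with hR
  obtain ⟨C, hC0, hC⟩ := exists_le_edgePole (n := p + 1) R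
  set V : Set (EuclideanSpace ℝ (Fin (p + 1 + 1))) := ball 0 R ∩ ((closedBall 0 (1 / 4))ᶜ ∩ Eᶜ)
    with hV
  have hVo : IsOpen V := isOpen_ball.inter (isClosed_closedBall.isOpen_compl.inter hEc.isOpen_compl)
  have hVb : Bornology.IsBounded V := isBounded_ball.subset inter_subset_left
  have hmemV : ∀ x, x ∈ V ↔ ‖x‖ < R ∧ 1 / 4 < ‖x‖ ∧ x ∉ E := fun x => by simp [hV]
  have hx₀V : x₀ ∈ V := (hmemV _).2 ⟨by linarith [le_max_right R₀ ‖x₀‖], hx₀, hx₀E⟩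
  have hne : ∀ x ∈ V, x ≠ 0 := fun x hx h => by
    have := ((hmemV x).1 hx).2.1
    rw [h, norm_zero] at this
    norm_num at this
  have hQ : ∀ x ∈ V, edgeQuad x ≠ 0 := fun x hx h => by
    obtain ⟨h1, h2⟩ := edgeQuad_eq_zero_iff.1 h
    exact ((hmemV x).1 hx).2.2 (mem_flatAnnulus.2 ⟨h1.ge, by linarith, h2⟩)
  have hgc : ∀ x ∈ V, ContinuousAt g x := fun x hx => by
    have h1 := (newton_contDiffAt (hne x hx)).continuousAt
    have h2 := (hω.contDiffAt_potential ((hmemV x).1 hx).2.2).continuousAt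
    have h3 := continuousAt_slitBarrier (hne x hx)
    fun_prop
  have hbar : ∀ x ∈ V, γ * slitBarrier x ≤ 1 := fun x hx =>
    barrier_le_one ((hmemV x).1 hx).2.1
  have hglow : ∀ x ∈ V, -(2 ^ p + 1) ≤ g x := fun x hx => by
    have h1 := newton_nonneg x
    have h2 := hω.potential_le hp ((hmemV x).1 hx).2.2 (by positivity)
      (hω.epotential_le_two_pow hp x)
    have h3 := hbar x hx
    simp only [hg]
    linarith
  have key : ∀ ε, 0 < ε → ε * C ≤ δ → 0 ≤ (g x₀ + 2 * δ) + ε * edgePole x₀ := by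
    intro ε hε hεC
    set φ : EuclideanSpace ℝ (Fin (p + 1 + 1)) → ℝ := fun x =>
      g x + (ε * edgePole x + 2 * δ) with hφ
    have hPV : ∀ x ∈ V, -δ ≤ ε * edgePole x := fun x hx => by
      have := mul_le_mul_of_nonneg_left (hC x ((hmemV x).1 hx).1.le) hε.le
      linarith
    have hφc : ∀ x ∈ V, ContinuousAt φ x := fun x hx =>
      (hgc x hx).add (((continuousAt_edgePole (hQ x hx)).const_mul ε).add continuousAt_const)
    have hbd : ∀ x ∉ V, ∀ η > 0, ∀ᶠ y in 𝓝 x, y ∈ V → -η < φ y := by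
      intro x hx η hη
      have hred : (∀ᶠ y in 𝓝 x, y ∈ V → -δ < g y) → ∀ᶠ y in 𝓝 x, y ∈ V → -η < φ y := by
        intro h
        filter_upwards [h] with y hy hyV
        have h1 := hy hyV
        have h2 := hPV y hyV
        simp only [hφ]
        linarith
      by_cases h1 : R ≤ ‖x‖
      · refine hred ?_
        have : R₀ < ‖x‖ := by linarith [le_max_left R₀ ‖x₀‖]
        filter_upwards [continuous_norm.continuousAt.eventually_const_lt this] with y hy _
        exact hR₀ y hy
      by_cases h2 : ‖x‖ ≤ 1 / 4
      · refine hred ?_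
        have : ‖x‖ < 1 / 3 := by linarith
        filter_upwards [continuous_norm.continuousAt.eventually_lt_const this] with y hy hyV
        have hy0 : 0 < ‖y‖ := norm_pos_iff.2 (hne y hyV)
        have hk : (3 : ℝ) ^ p ≤ newton p y := by
          rw [newton, ← inv_pow]
          gcongr
          rw [le_inv_comm₀ (by norm_num) hy0]
          linarith
        have hU : potential p ω y ≤ (3 / 2) ^ p := by
          refine hω.potential_le hp ((hmemV y).1 hyV).2.2 (by positivity) ?_
          have := epotential_le_ofReal hω (x := y) (d := 2 / 3) (by norm_num) fun w hw => by
            have h3 := (mem_flatAnnulus.1 hw).1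
            have h4 := norm_sub_norm_le w y
            rw [norm_sub_rev] at h4
            linarith
          rwa [← inv_pow, inv_div] at this
        have h3 := hbar y hyV
        have h4 : (2 : ℝ) ≤ 2 ^ p := by
          calc (2 : ℝ) = 2 ^ 1 := by norm_num
            _ ≤ 2 ^ p := pow_le_pow_right₀ (by norm_num) (Nat.one_le_iff_ne_zero.2 hp)
        have h5 : (1 : ℝ) ≤ (3 / 2) ^ p := one_le_pow₀ (by norm_num)
        have h6 : (3 : ℝ) ^ p = 2 ^ p * (3 / 2) ^ p := by rw [← mul_pow]; norm_num
        simp only [hg]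
        nlinarith
      have hxE : x ∈ E := by
        by_contra h
        exact hx ((hmemV x).2 ⟨not_le.1 h1, not_le.1 h2, h⟩)
      obtain ⟨hx1, hx2, hx3⟩ := mem_flatAnnulus.1 hxE
      have hx0 : x ≠ 0 := fun h => by rw [h, norm_zero] at hx1; norm_num at hx1
      rcases hx1.eq_or_lt with hx1 | hx1
      · have hedge := eventually_lt_edgePole (edgeQuad_eq_zero_iff.2 ⟨hx1.symm, hx3⟩)
          ((2 ^ p + 1) / ε)
        filter_upwards [hedge] with y hy hyV
        have h3 := hy (hQ y hyV)
        rw [div_lt_iff₀' hε] at h3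
        have h4 := hglow y hyV
        simp only [hφ]
        linarith
      · refine hred ?_
        have hlim : Tendsto (fun y => newton p y - (((‖x‖ - ‖y - x‖) ^ p)⁻¹ +
            γ * slitBarrier y)) (𝓝 x) (𝓝 0) := by
          have h3 := (newton_contDiffAt (p := p) hx0).continuousAt
          have h4 := continuousAt_slitBarrier hx0
          have h5 : ContinuousAt (fun y => ((‖x‖ - ‖y - x‖) ^ p)⁻¹) x := by
            refine ContinuousAt.inv₀ (by fun_prop) ?_
            simp only [sub_self, norm_zero, sub_zero]
            positivity
          have h6 : ContinuousAt (fun y => newton p y - (((‖x‖ - ‖y - x‖) ^ p)⁻¹ +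
            γ * slitBarrier y)) x := by fun_prop
          have h7 := h6.tendsto
          simpa [slitBarrier_eq_zero hx1.le hx3, newton] using h7
        have hnear : ∀ᶠ y in 𝓝 x, ‖y - x‖ < ‖x‖ - 1 := by
          have h3 : Continuous fun y : EuclideanSpace ℝ (Fin (p + 1 + 1)) => ‖y - x‖ := by fun_prop
          exact h3.continuousAt.eventually_lt_const (by simpa using hx1)
        filter_upwards [hlim.eventually_const_lt (neg_lt_zero.2 hδ), hnear] with y hy hyn hyV
        have h3 := hω.potential_le hp ((hmemV y).1 hyV).2.2
          (inv_nonneg.2 (pow_nonneg (by linarith) p)) (hω.epotential_le_near hp hxE hyn.le)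
        simp only [hg]
        linarith
    have hmin : ∀ x ∈ V, φ x < 0 → ¬ IsLocalMin φ x := by
      intro x hx _ hloc
      obtain ⟨-, -, hxE⟩ := (hmemV x).1 hx
      have hQ' : 0 < edgeQuad x := (edgeQuad_nonneg x).lt_of_ne' (hQ x hx)
      obtain ⟨L, hL, hPL⟩ := edgePole_hasLaplacianAt (n := p + 1) (by omega) hQ'
      have hk := newton_hasLaplacianAt (p := p) (hne x hx)
      have hU := hω.hasLaplacianAt_potential hxE
      by_cases hF : ‖x‖ < 1 ∨ x (Fin.last (p + 1)) ≠ 0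
      · obtain ⟨M, hM, hhM⟩ := slitBarrier_hasLaplacianAt (hne x hx) hF
        have := ((hk.add ((hU.const_mul (-1)).add (hhM.const_mul (-γ)))).add
          ((hPL.const_mul ε).add (.const (2 * δ)))).nonneg_of_isLocalMin hloc
        nlinarith
      · push Not at hF
        have h0 := slitBarrier_eq_zero hF.1 hF.2
        have hloc' : IsLocalMin (fun y => (newton p y + (-1) * potential p ω y) +
            (ε * edgePole y + 2 * δ)) x := by
          filter_upwards [hloc] with y hy
          have h1 := mul_nonneg hγ0.le (slitBarrier_nonneg y)
          simp only [hφ, hg, h0] at hy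
          linarith
        have := ((hk.add (hU.const_mul (-1))).add
          ((hPL.const_mul ε).add (.const (2 * δ)))).nonneg_of_isLocalMin hloc'
        nlinarith
    have := nonneg_of_forall_not_isLocalMin hVb hVo hφc hbd hmin x₀ hx₀V
    simp only [hφ] at this
    linarith
  have hlim : Tendsto (fun ε : ℝ => (g x₀ + 2 * δ) + ε * edgePole x₀) (𝓝[>] 0)
      (𝓝 (g x₀ + 2 * δ)) := by
    have : Continuous fun ε : ℝ => (g x₀ + 2 * δ) + ε * edgePole x₀ := by fun_prop
    simpa using (this.tendsto 0).mono_left nhdsWithin_le_nhds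
  refine ge_of_tendsto hlim ?_
  filter_upwards [Ioo_mem_nhdsGT (show (0 : ℝ) < δ / (C + 1) by positivity)] with ε hε
  refine key ε hε.1 ?_
  have := (le_div_iff₀ (by positivity)).1 hε.2.le
  nlinarith [hε.1]

end Comparison

section LocalBound

variable {p : ℕ} {ω : Measure (EuclideanSpace ℝ (Fin (p + 1 + 1)))}

lemma enewton_smul {a : ℝ} (ha : 0 < a) (x : EuclideanSpace ℝ (Fin (p + 1 + 1))) :
    enewton p (a • x) = ENNReal.ofReal (a ^ p)⁻¹ * enewton p x := by
  have h2 : ‖a‖ₑ ≠ 0 := by simpa using ha.ne'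
  rw [enewton, enewton, enorm_smul, mul_pow, ENNReal.mul_inv (by simp [h2]) (by simp),
    ENNReal.ofReal_inv_of_pos (by positivity), ENNReal.ofReal_pow ha.le, Real.enorm_of_nonneg ha.le]

lemma exists_lintegral_enewton_ball (hp : p ≠ 0) : ∃ A : ℝ, 0 < A ∧ ∀ a : ℝ, 0 < a →
    ∀ x : EuclideanSpace ℝ (Fin (p + 1 + 1)), 2 * a ≤ ‖x‖ →
      ∫⁻ v in closedBall 0 1, enewton p (x - a • v) = ENNReal.ofReal A * enewton p x := by
  obtain ⟨A, hA, h⟩ := exists_integral_newton_ball hp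
  refine ⟨A, hA, fun a ha x hx => ?_⟩
  have hx0 : x ≠ 0 := fun h => by rw [h, norm_zero] at hx; linarith
  have hne : ∀ v ∈ closedBall (0 : EuclideanSpace ℝ (Fin (p + 1 + 1))) 1, x - a • v ≠ 0 := by
    intro v hv h0
    have h1 : ‖x‖ = a * ‖v‖ := by
      rw [sub_eq_zero.1 h0, norm_smul, Real.norm_of_nonneg ha.le]
    have h2 : ‖v‖ ≤ 1 := by simpa using hv
    nlinarith
  have hi : IntegrableOn (fun v => newton p (x - a • v)) (closedBall 0 1) := by
    refine ContinuousOn.integrableOn_compact (isCompact_closedBall _ _) fun v hv => ?_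
    refine ContinuousAt.continuousWithinAt ?_
    exact ContinuousAt.comp (f := fun v => x - a • v)
      (newton_contDiffAt (hne v hv)).continuousAt (by fun_prop)
  rw [enewton_eq_ofReal hx0, ← ENNReal.ofReal_mul hA.le, ← h a ha x hx,
    ofReal_integral_eq_lintegral_ofReal hi (.of_forall fun _ => newton_nonneg _)]
  exact setLIntegral_congr_fun measurableSet_closedBall fun v hv => enewton_eq_ofReal (hne v hv)

lemma IsSwept.epotential_add_slitBarrier_le (hp : p ≠ 0)
    (hω : IsSwept p (flatAnnulus (p + 1) 1) ω) {x : EuclideanSpace ℝ (Fin (p + 1 + 1))}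
    (hx : 1 / 4 < ‖x‖) :
    epotential p ω x + ENNReal.ofReal ((16 ^ (p + 1) : ℝ)⁻¹ * slitBarrier x) ≤ enewton p x := by
  by_cases hxE : x ∈ flatAnnulus (p + 1) 1
  · obtain ⟨h1, -, h2⟩ := mem_flatAnnulus.1 hxE
    rw [slitBarrier_eq_zero h1 h2, mul_zero, ENNReal.ofReal_zero, add_zero]
    exact hω.epotential_le hp hxE
  · have hx0 : x ≠ 0 := fun h => by rw [h, norm_zero] at hx; norm_num at hx
    rw [hω.epotential_eq_potential hp hxE, enewton_eq_ofReal hx0,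
      ← ENNReal.ofReal_add (potential_nonneg _ _)
        (mul_nonneg (by positivity) (slitBarrier_nonneg x))]
    exact ENNReal.ofReal_le_ofReal (hω.potential_add_slitBarrier_le hp hx hxE)

/-- Near the slit the barrier is bounded below by the square root of the distance to the edge. -/
lemma le_slitBarrier {n : ℕ} {x : EuclideanSpace ℝ (Fin (n + 1))} {A s : ℝ} (hA : 0 ≤ A)
    (hs : 0 < s) (h1 : 1 ≤ ‖x‖) (h3 : ‖x‖ ≤ 3) (hD : ‖x‖ - 1 ≤ 2 * (1 + A) * s)
    (ht : s / 16 ≤ |x (Fin.last n)|) :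
    √(s / (4096 * (1 + A))) * (9 ^ n)⁻¹ ≤ slitBarrier x := by
  set κ : ℝ := 1 / (4096 * (1 + A)) with hκ
  have hκ0 : 0 < κ := by positivity
  have hκA : κ * (1 + A) = 1 / 4096 := by rw [hκ]; field_simp
  have hκ1 : κ ≤ 1 / 4096 := by nlinarith
  set D : ℝ := ‖x‖ ^ 2 - 1 with hDd
  have hD0 : 0 ≤ D := by nlinarith
  have hD8 : D ≤ 8 * (1 + A) * s := by nlinarith
  have ht2 : (s / 16) ^ 2 ≤ x (Fin.last n) ^ 2 := by
    rw [← sq_abs (x (Fin.last n))]; gcongr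
  have hkD : κ * D ≤ 8 * s / 4096 := by
    calc κ * D ≤ κ * (8 * (1 + A) * s) := by gcongr
      _ = 8 * (κ * (1 + A)) * s := by ring
      _ = _ := by rw [hκA]; ring
  have hroot : D + 2 * κ * s ≤ √((1 - ‖x‖ ^ 2) ^ 2 + 4 * x (Fin.last n) ^ 2) := by
    refine Real.le_sqrt_of_sq_le ?_
    have e1 : (1 - ‖x‖ ^ 2) ^ 2 = D ^ 2 := by rw [hDd]; ring
    have e2 : κ * D * s ≤ 8 * s / 4096 * s := by gcongr
    have e3 : κ ^ 2 * s ^ 2 ≤ (1 / 4096) ^ 2 * s ^ 2 := by gcongr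
    rw [e1]
    nlinarith [sq_nonneg s]
  have e0 : s / (4096 * (1 + A)) = κ * s := by rw [hκ]; ring
  rw [slitBarrier, slitRoot_re_eq, e0]
  gcongr
  · linarith
  · nlinarith

/-- Averaging a potential over a ball whose double misses the support of the measure. -/
lemma setLIntegral_epotential_ball [SFinite ω] {M a : ℝ} {x : EuclideanSpace ℝ (Fin (p + 1 + 1))}
    (hM : ∀ y : EuclideanSpace ℝ (Fin (p + 1 + 1)), 2 * a ≤ ‖y‖ →
      ∫⁻ v in closedBall 0 1, enewton p (y - a • v) = ENNReal.ofReal M * enewton p y)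
    (hω : ∀ᵐ w ∂ω, 2 * a ≤ ‖x - w‖) :
    ∫⁻ v in closedBall 0 1, epotential p ω (x - a • v) = ENNReal.ofReal M * epotential p ω x := by
  have hm : Measurable (Function.uncurry fun v w : EuclideanSpace ℝ (Fin (p + 1 + 1)) =>
      enewton p (x - a • v - w)) :=
    measurable_enewton.comp (by fun_prop : Measurable fun q :
      EuclideanSpace ℝ (Fin (p + 1 + 1)) × EuclideanSpace ℝ (Fin (p + 1 + 1)) =>
        x - a • q.1 - q.2)
  simp only [epotential]
  rw [lintegral_lintegral_swap hm.aemeasurable, ← lintegral_const_mul' _ _ ENNReal.ofReal_ne_top]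
  refine lintegral_congr_ae ?_
  filter_upwards [hω] with w hw
  rw [← hM _ hw]
  simp only [sub_right_comm]

lemma lintegral_epotential_le_mul [SFinite ω] {μ : Measure (EuclideanSpace ℝ (Fin (p + 1 + 1)))}
    [SFinite μ] {C : ℝ≥0∞} (hC : ∀ x, epotential p μ x ≤ C) {s : ℝ} (hs : 0 < s)
    (y : EuclideanSpace ℝ (Fin (p + 1 + 1))) :
    ∫⁻ v, epotential p ω (y + s • v) ∂μ ≤ ENNReal.ofReal (s ^ p)⁻¹ * C * ω univ := by
  have hm : Measurable (Function.uncurry fun v x : EuclideanSpace ℝ (Fin (p + 1 + 1)) =>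
      enewton p (y + s • v - x)) :=
    measurable_enewton.comp (by fun_prop : Measurable fun q :
      EuclideanSpace ℝ (Fin (p + 1 + 1)) × EuclideanSpace ℝ (Fin (p + 1 + 1)) =>
        y + s • q.1 - q.2)
  simp only [epotential]
  rw [lintegral_lintegral_swap hm.aemeasurable, ← lintegral_const]
  refine lintegral_mono fun x => ?_
  have hscale : ∀ v, enewton p (y + s • v - x) =
      ENNReal.ofReal (s ^ p)⁻¹ * enewton p (s⁻¹ • (x - y) - v) := fun v => by
    rw [← enewton_smul hs, smul_sub, smul_inv_smul₀ hs.ne', enewton_sub_comm, sub_sub]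
  simp only [hscale]
  rw [lintegral_const_mul' _ _ ENNReal.ofReal_ne_top]
  gcongr
  exact hC _

set_option maxHeartbeats 400000 in
lemma IsSwept.exists_le_measure_ball (hp : p ≠ 0) {A : ℝ} (hA : 0 ≤ A) :
    ∃ c : ℝ, 0 < c ∧ ∀ ω : Measure (EuclideanSpace ℝ (Fin (p + 1 + 1))),
      IsSwept p (flatAnnulus (p + 1) 1) ω → ∀ y ∈ flatAnnulus (p + 1) 1, ∀ ρ : ℝ, 0 < ρ →
        ρ ≤ 1 / 2 → ρ ≤ ‖y‖ - 1 → ‖y‖ - 1 ≤ (1 + A) * ρ →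
          c * (ρ ^ p * √ρ) ≤ (ω (ball y ρ)).toReal := by
  obtain ⟨μ, hμf, hμ0, hμ, hμ1, hμ2, hμ3, hμ4⟩ := exists_disc_measure hp
  obtain ⟨M, hM, hMean⟩ := exists_lintegral_enewton_ball hp
  obtain ⟨C, hC⟩ := id hμ4
  set S₁ : Set (EuclideanSpace ℝ (Fin (p + 1 + 1))) :=
    closedBall (EuclideanSpace.single (Fin.last (p + 1)) (1 / 2 : ℝ)) (1 / 4) with hS₁
  have hS₁sub : S₁ ⊆ closedBall 0 1 := by
    refine closedBall_subset_closedBall' ?_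
    rw [dist_zero_right, PiLp.norm_single]
    norm_num
  have hS₁last : ∀ v ∈ S₁, 1 / 4 ≤ |v (Fin.last (p + 1))| := fun v hv => by
    have h1 : ‖v - EuclideanSpace.single (Fin.last (p + 1)) (1 / 2 : ℝ)‖ ≤ 1 / 4 := by
      simpa [hS₁, dist_eq_norm] using hv
    have h2 := (PiLp.norm_apply_le _ (Fin.last (p + 1))).trans h1
    simp only [PiLp.sub_apply, PiLp.single_apply, if_true, Real.norm_eq_abs] at h2
    rw [abs_le] at h2
    rw [le_abs]
    left; linarith
  set K : ℝ := (volume S₁).toReal with hK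
  have hKfin : volume S₁ ≠ ⊤ := measure_closedBall_lt_top.ne
  have hK0 : 0 < K := ENNReal.toReal_pos (measure_closedBall_pos _ _ (by norm_num)).ne' hKfin
  set m : ℝ := (μ univ).toReal with hm
  have hm0 : 0 < m := ENNReal.toReal_pos hμ0 (measure_ne_top _ _)
  set γ : ℝ := (16 ^ (p + 1) : ℝ)⁻¹ with hγ
  have hγ0 : 0 < γ := by positivity
  set C' : ℝ := max C 1 with hC'
  have hC'0 : 0 < C' := lt_max_of_lt_right one_pos
  refine ⟨K * (γ * (√(1 / (8192 * (1 + A))) * (9 ^ (p + 1))⁻¹)) * m / (M * 4 ^ p * C'),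
    by positivity, ?_⟩
  intro ω hω y hy ρ hρ hρ2 hy1 hyA
  have hωf : IsFiniteMeasure ω := ⟨hω.2.1.trans_lt one_lt_top⟩
  obtain ⟨-, hy2, hyl⟩ := mem_flatAnnulus.1 hy
  have hy0 : ‖y‖ ≠ 0 := by linarith
  set s : ℝ := ρ / 2 with hs
  set s' : ℝ := s / 2 with hs'
  set a : ℝ := s / 4 with ha
  have hs0 : 0 < s := by positivity
  have hs'0 : 0 < s' := by positivity
  have ha0 : 0 < a := by positivity
  set y' : EuclideanSpace ℝ (Fin (p + 1 + 1)) := ((‖y‖ - s) / ‖y‖) • y with hy'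
  have hy'n : ‖y'‖ = ‖y‖ - s := by
    rw [hy', norm_smul, Real.norm_of_nonneg (div_nonneg (by linarith) (norm_nonneg y))]
    exact div_mul_cancel₀ _ hy0
  have hy'd : dist y' y = s := by
    have : y' - y = (-(s / ‖y‖)) • y := by
      rw [hy', sub_div, div_self hy0, sub_smul, one_smul, neg_smul]
      abel
    rw [dist_eq_norm, this, norm_smul, norm_neg,
      Real.norm_of_nonneg (div_nonneg hs0.le (norm_nonneg y))]
    exact div_mul_cancel₀ _ hy0
  have hy'l : y' (Fin.last (p + 1)) = 0 := by simp [hy', hyl]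
  set S : Set (EuclideanSpace ℝ (Fin (p + 1 + 1))) := ball y' s with hS
  have hSm : MeasurableSet S := measurableSet_ball
  have hSsub : S ⊆ ball y ρ := ball_subset_ball' (by rw [hy'd]; linarith)
  set W : EuclideanSpace ℝ (Fin (p + 1 + 1)) → EuclideanSpace ℝ (Fin (p + 1 + 1)) :=
    fun v => y' + s' • v with hW
  have hWn : ∀ v : EuclideanSpace ℝ (Fin (p + 1 + 1)), ‖v‖ ≤ 1 → ‖s' • v‖ ≤ s' := fun v hv => by
    rw [norm_smul, Real.norm_of_nonneg hs'0.le]; nlinarith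
  have hWE : ∀ᵐ v ∂μ, W v ∈ flatAnnulus (p + 1) 1 := by
    filter_upwards [hμ] with v hv
    exact add_smul_mem_flatAnnulus hs'0.le (by linarith) (by linarith) hy'l hv
  have hrep := hω.lintegral_epotential isCompact_flatAnnulus.measurableSet hμ1 hμ2 hμ3 hμ4 hs'0 hWE
  set F := epotential p (ω.restrict S) with hF
  set G := epotential p (ω.restrict Sᶜ) with hG
  have hFG : ∀ x, epotential p ω x = F x + G x := fun x =>
    (lintegral_add_compl _ hSm).symm
  have hFm : Measurable F := measurable_epotential
  have hyA' : ‖y‖ - 1 ≤ 2 * (1 + A) * s := hyA.trans_eq (by rw [hs]; ring)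
  set b : ℝ := K * (γ * (√(s / (4096 * (1 + A))) * (9 ^ (p + 1))⁻¹)) with hb
  have hpt : ∀ᵐ v ∂μ, ENNReal.ofReal M * G (W v) + ENNReal.ofReal b ≤
      ENNReal.ofReal M * enewton p (W v) := by
    filter_upwards [hμ, hWE] with v hv hvE
    obtain ⟨hv1, hv2⟩ := hv
    obtain ⟨hw1, hw2, hw3⟩ := mem_flatAnnulus.1 hvE
    have hwup : ‖W v‖ ≤ ‖y‖ - s + s' := by
      have := norm_add_le y' (s' • v)
      linarith [hWn v hv1]
    have hwlow : ‖y‖ - s - s' ≤ ‖W v‖ := by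
      have := norm_sub_le_norm_add y' (s' • v)
      linarith [hWn v hv1]
    rw [← hMean a ha0 _ (by linarith : 2 * a ≤ ‖W v‖)]
    have hav : ∀ u ∈ closedBall (0 : EuclideanSpace ℝ (Fin (p + 1 + 1))) 1, ‖a • u‖ ≤ a := by
      intro u hu
      have : ‖u‖ ≤ 1 := by simpa using hu
      rw [norm_smul, Real.norm_of_nonneg ha0.le]; nlinarith
    have hzn : ∀ u ∈ closedBall (0 : EuclideanSpace ℝ (Fin (p + 1 + 1))) 1,
        1 ≤ ‖W v - a • u‖ ∧ ‖W v - a • u‖ ≤ ‖y‖ := by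
      intro u hu
      have h1 := norm_sub_norm_le (W v) (a • u)
      have h2 := norm_sub_le (W v) (a • u)
      have h3 := hav u hu
      exact ⟨by linarith, by linarith⟩
    have hmeas : Measurable fun u => epotential p ω (W v - a • u) :=
      measurable_epotential.comp (by fun_prop)
    have hlow1 : ENNReal.ofReal M * G (W v) ≤
        ∫⁻ u in closedBall 0 1, epotential p ω (W v - a • u) := by
      have hS' : ∀ᵐ x ∂ω.restrict Sᶜ, 2 * a ≤ ‖W v - x‖ := by
        filter_upwards [ae_restrict_mem hSm.compl] with x hx
        have h1 : s ≤ ‖x - y'‖ := by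
          rw [← dist_eq_norm]; exact not_lt.1 hx
        have h3 : ‖x - y'‖ ≤ ‖s' • v‖ + ‖W v - x‖ := by
          have : x - y' = s' • v - (W v - x) := by simp only [hW]; abel
          rw [this]; exact norm_sub_le _ _
        linarith [hWn v hv1]
      rw [hG, ← setLIntegral_epotential_ball (hMean a ha0) hS']
      exact lintegral_mono fun u => setLIntegral_le_lintegral _ _
    have hlow2 : ENNReal.ofReal b ≤
        ∫⁻ u in closedBall 0 1, ENNReal.ofReal (γ * slitBarrier (W v - a • u)) := by
      calc ENNReal.ofReal b
          = ∫⁻ _ in S₁, ENNReal.ofReal (γ * (√(s / (4096 * (1 + A))) * (9 ^ (p + 1))⁻¹)) := by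
            rw [setLIntegral_const, hb, mul_comm K, ENNReal.ofReal_mul (by positivity), hK,
              ENNReal.ofReal_toReal hKfin]
        _ ≤ ∫⁻ u in S₁, ENNReal.ofReal (γ * slitBarrier (W v - a • u)) := by
            refine setLIntegral_mono' measurableSet_closedBall fun u hu => ?_
            obtain ⟨h1, h2⟩ := hzn u (hS₁sub hu)
            refine ENNReal.ofReal_le_ofReal (mul_le_mul_of_nonneg_left ?_ hγ0.le)
            refine le_slitBarrier hA hs0 h1 (by linarith) (by linarith) ?_
            have h3 := hS₁last u hu
            have h4 : (W v - a • u) (Fin.last (p + 1)) = -(a * u (Fin.last (p + 1))) := by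
              simp [hw3]
            rw [h4, abs_neg, abs_mul, abs_of_pos ha0]
            nlinarith
        _ ≤ _ := lintegral_mono_set hS₁sub
    calc _ ≤ (∫⁻ u in closedBall 0 1, epotential p ω (W v - a • u)) +
          ∫⁻ u in closedBall 0 1, ENNReal.ofReal (γ * slitBarrier (W v - a • u)) :=
          add_le_add hlow1 hlow2
      _ = ∫⁻ u in closedBall 0 1, (epotential p ω (W v - a • u) +
          ENNReal.ofReal (γ * slitBarrier (W v - a • u))) := (lintegral_add_left hmeas _).symm
      _ ≤ _ := setLIntegral_mono' measurableSet_closedBall fun u hu =>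
          hω.epotential_add_slitBarrier_le hp (by linarith [(hzn u hu).1])
  have h_int := lintegral_mono_ae hpt
  rw [lintegral_add_right _ measurable_const, lintegral_const, lintegral_const_mul' _ _
    ENNReal.ofReal_ne_top, lintegral_const_mul' _ _ ENNReal.ofReal_ne_top, ← hrep] at h_int
  have hsplit : ∫⁻ v, epotential p ω (y' + s' • v) ∂μ =
      ∫⁻ v, F (W v) ∂μ + ∫⁻ v, G (W v) ∂μ := by
    have hFW : Measurable fun v => F (W v) := hFm.comp (by fun_prop)
    rw [← lintegral_add_left hFW]
    exact lintegral_congr fun v => hFG _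
  have hGfin : ∫⁻ v, G (W v) ∂μ ≠ ⊤ := by
    refine ((lintegral_mono fun v => ?_).trans_lt (?_ :
      ∫⁻ _, ENNReal.ofReal (2 ^ p) ∂μ < ⊤)).ne
    · refine le_trans ?_ (hω.epotential_le_two_pow hp (W v))
      rw [hFG]; exact le_add_self
    · rw [lintegral_const]
      exact ENNReal.mul_lt_top ENNReal.ofReal_lt_top (measure_lt_top _ _)
  rw [hsplit, mul_add, add_comm] at h_int
  have hcancel := (ENNReal.add_le_add_iff_right
    (ENNReal.mul_ne_top ENNReal.ofReal_ne_top hGfin)).1 h_int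
  have hFup : ∫⁻ v, F (W v) ∂μ ≤ ENNReal.ofReal ((s' ^ p)⁻¹ * C') * ω S := by
    have hCμ : ∀ x, epotential p μ x ≤ ENNReal.ofReal C' := fun x =>
      (epotential_eq_ofReal (hμ1 x) (hμ2 x)).le.trans
        (ENNReal.ofReal_le_ofReal ((hC x).trans (le_max_left _ _)))
    rw [ENNReal.ofReal_mul (by positivity), ← Measure.restrict_apply_univ S]
    exact lintegral_epotential_le_mul hCμ hs'0 y'
  have hfinal : ENNReal.ofReal b * μ univ ≤
      ENNReal.ofReal M * (ENNReal.ofReal ((s' ^ p)⁻¹ * C') * ω S) :=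
    hcancel.trans (by gcongr)
  have hreal := ENNReal.toReal_mono (ENNReal.mul_ne_top ENNReal.ofReal_ne_top
    (ENNReal.mul_ne_top ENNReal.ofReal_ne_top (measure_ne_top _ _))) hfinal
  simp only [ENNReal.toReal_mul] at hreal
  rw [ENNReal.toReal_ofReal (by positivity), ENNReal.toReal_ofReal hM.le,
    ENNReal.toReal_ofReal (by positivity)] at hreal
  have hmono : (ω S).toReal ≤ (ω (ball y ρ)).toReal :=
    ENNReal.toReal_mono (measure_ne_top _ _) (measure_mono hSsub)
  refine le_trans ?_ hmono
  have hsq : √(s / (4096 * (1 + A))) = √(1 / (8192 * (1 + A))) * √ρ := by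
    rw [← Real.sqrt_mul (by positivity), hs]
    congr 1
    field_simp
    norm_num
  have hsp : s' ^ p = ρ ^ p / 4 ^ p := by rw [hs', hs, div_div, div_pow]; norm_num
  rw [hsp] at hreal
  rw [div_mul_eq_mul_div, div_le_iff₀ (by positivity)]
  have hb' : b = K * (γ * (√(1 / (8192 * (1 + A))) * (9 ^ (p + 1))⁻¹)) * √ρ := by
    rw [hb, hsq]; ring
  rw [hb'] at hreal
  have := mul_le_mul_of_nonneg_left hreal (by positivity : 0 ≤ ρ ^ p)
  have hρp : ρ ^ p ≠ 0 := by positivity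
  calc _ = ρ ^ p * (K * (γ * (√(1 / (8192 * (1 + A))) * (9 ^ (p + 1))⁻¹)) * √ρ * m) := by ring
    _ ≤ _ := this
    _ = _ := by field_simp

end LocalBound

section Scaling

variable {p : ℕ} {ω : Measure (EuclideanSpace ℝ (Fin (p + 1 + 1)))} {r : ℝ}

lemma smul_mem_flatAnnulus_iff {n : ℕ} {a : ℝ} (ha : 0 < a) {x : EuclideanSpace ℝ (Fin (n + 1))} :
    a • x ∈ flatAnnulus n (a * r) ↔ x ∈ flatAnnulus n r := by
  rw [mem_flatAnnulus, mem_flatAnnulus, norm_smul, Real.norm_of_nonneg ha.le, mul_left_comm,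
    mul_le_mul_iff_right₀ ha, mul_le_mul_iff_right₀ ha]
  simp [ha.ne']

/-- After rescaling, harmonic measure of the complement of a flat annulus reproduces
potentials. -/
lemma IsHarmonicMeasure.isSwept (hp : p ≠ 0) (hr : 0 < r)
    (hω : IsHarmonicMeasure (flatAnnulus (p + 1) r)ᶜ 0 ω) :
    IsSwept p (flatAnnulus (p + 1) 1) (ω.map fun x => r⁻¹ • x) := by
  obtain ⟨h1, h2, h3⟩ := hω
  have hωf : IsFiniteMeasure ω := ⟨h2.trans_lt one_lt_top⟩
  have hm : Measurable fun x : EuclideanSpace ℝ (Fin (p + 1 + 1)) => r⁻¹ • x := by fun_prop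
  have hiff : ∀ x : EuclideanSpace ℝ (Fin (p + 1 + 1)),
      r • x ∈ flatAnnulus (p + 1) r ↔ x ∈ flatAnnulus (p + 1) 1 := fun x => by
    simpa using smul_mem_flatAnnulus_iff (r := 1) hr (x := x)
  refine ⟨?_, ?_, fun ν hν hνE hc hb => ?_⟩
  · rw [Measure.map_apply hm isCompact_flatAnnulus.measurableSet.compl]
    refine measure_mono_null ?_ h1
    intro x hx hxf
    refine hx ?_
    rw [frontier_compl] at hxf
    have := isCompact_flatAnnulus.isClosed.frontier_subset hxf
    rw [← hiff]
    simpa [smul_inv_smul₀ hr.ne'] using this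
  · rw [Measure.map_apply hm MeasurableSet.univ]
    exact h2
  · have hT : Measurable fun w : EuclideanSpace ℝ (Fin (p + 1 + 1)) => 0 + r • w := by fun_prop
    set ν' := ν.map fun w => 0 + r • w with hν'
    have hν'f : IsFiniteMeasure ν' := Measure.isFiniteMeasure_map _ _
    have hpot : ∀ x, potential p ν' x = (r ^ p)⁻¹ * potential p ν (r⁻¹ • x) := fun x => by
      rw [hν', potential_map_smul_add ν hr, sub_zero]
    have hν'E : ν' (flatAnnulus (p + 1) r)ᶜ = 0 := by
      rw [hν', Measure.map_apply hT isCompact_flatAnnulus.measurableSet.compl]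
      refine measure_mono_null ?_ hνE
      intro x hx hxE
      refine hx ?_
      simpa using (hiff x).2 hxE
    have hcont : Continuous (potential p ν') := by
      rw [funext hpot]; fun_prop
    obtain ⟨C, hC⟩ := hb
    have hbd : Bornology.IsBounded (range (potential p ν')) := by
      refine (isBounded_Icc 0 ((r ^ p)⁻¹ * C)).subset ?_
      rintro _ ⟨x, rfl⟩
      refine ⟨potential_nonneg _ _, ?_⟩
      rw [hpot]
      exact mul_le_mul_of_nonneg_left (hC _) (by positivity)
    have hlim : Tendsto (potential p ν') (Bornology.cobounded _) (𝓝 0) := by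
      refine tendsto_potential hp ν' (R := 2 * r) ?_
      filter_upwards [show ∀ᵐ w ∂ν', w ∈ flatAnnulus (p + 1) r from hν'E] with w hw
      exact (mem_flatAnnulus.1 hw).2.1
    have h := h3 _ hcont hbd (isHarmonicOn_potential ν' isCompact_flatAnnulus hν'E) fun _ => hlim
    simp only [hpot, smul_zero] at h
    rw [integral_const_mul] at h
    rw [integral_map hm.aemeasurable hc.aestronglyMeasurable]
    exact mul_left_cancel₀ (by positivity) h

lemma infDist_sphere_of_le_norm {X : Type*} [NormedAddCommGroup X] [NormedSpace ℝ X] (hr : 0 < r)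
    {y : X} (hy : r ≤ ‖y‖) : infDist y (sphere 0 r) = ‖y‖ - r := by
  have hy0 : 0 < ‖y‖ := hr.trans_le hy
  have hz : (r / ‖y‖) • y ∈ sphere (0 : X) r := by
    rw [mem_sphere_zero_iff_norm, norm_smul, Real.norm_of_nonneg (by positivity)]
    exact div_mul_cancel₀ _ hy0.ne'
  refine le_antisymm ((infDist_le_dist_of_mem hz).trans_eq ?_) ((le_infDist ⟨_, hz⟩).2 ?_)
  · have : y - (r / ‖y‖) • y = ((‖y‖ - r) / ‖y‖) • y := by
      rw [sub_div, div_self hy0.ne', sub_smul, one_smul]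
    rw [dist_eq_norm, this, norm_smul,
      Real.norm_of_nonneg (div_nonneg (by linarith) (norm_nonneg y))]
    exact div_mul_cancel₀ _ hy0.ne'
  · intro z hz
    rw [dist_eq_norm, ← mem_sphere_zero_iff_norm.1 hz]
    exact norm_sub_norm_le y z

end Scaling

/-- Lemma 4.1: for the flat annulus
`E = (B̄(0,2r) \ B(0,r)) ∩ (ℝⁿ × {0}) ⊂ ℝ^{n+1}` and a ball `B = B(y,ρ)` centered in
`E` with `ρ ≤ r/2` comparable (with constant `A`) to `dist(B, ∂B(0,r))`, the harmonic
measure of `Ω = ℝ^{n+1} \ E` with pole `0` satisfies `ω⁰(B) ≥ c (ρ/r)^{n-1/2}`,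
where `c > 0` depends only on `n` and `A`. -/
theorem stmt16 (n : ℕ) (hn : 1 < n) (A : ℝ) (hA : 1 ≤ A) :
    ∃ c : ℝ, 0 < c ∧
      ∀ r : ℝ, 0 < r →
        ∀ E : Set (EuclideanSpace ℝ (Fin (n + 1))),
          E = (Metric.closedBall (0 : EuclideanSpace ℝ (Fin (n + 1))) (2 * r) \
                Metric.ball 0 r) ∩ {x | x (Fin.last n) = 0} →
          ∀ y ∈ E, ∀ ρ : ℝ, 0 < ρ → ρ ≤ r / 2 →
            -- `ρ ≈ dist(B(y,ρ), ∂B(0,r))`, the latter being `infDist y ∂B(0,r) - ρ`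
            A⁻¹ * (Metric.infDist y
                (Metric.sphere (0 : EuclideanSpace ℝ (Fin (n + 1))) r) - ρ) ≤ ρ →
            ρ ≤ A * (Metric.infDist y
                (Metric.sphere (0 : EuclideanSpace ℝ (Fin (n + 1))) r) - ρ) →
            ∀ ω : Measure (EuclideanSpace ℝ (Fin (n + 1))),
              IsHarmonicMeasure Eᶜ 0 ω →
                c * (ρ / r) ^ ((n : ℝ) - 1 / 2) ≤ (ω (Metric.ball y ρ)).toReal := by
  obtain ⟨p, rfl⟩ : ∃ p, n = p + 1 := ⟨n - 1, by omega⟩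
  have hp : p ≠ 0 := by omega
  obtain ⟨c, hc, H⟩ := IsSwept.exists_le_measure_ball hp (zero_le_one.trans hA)
  refine ⟨c, hc, ?_⟩
  rintro r hr E rfl y hy ρ hρ hρr h1 h2 ω hω
  change y ∈ flatAnnulus (p + 1) r at hy
  obtain ⟨hy1, hy2, hy3⟩ := mem_flatAnnulus.1 hy
  have hA0 : 0 < A := by linarith
  rw [infDist_sphere_of_le_norm hr hy1] at h1 h2
  rw [inv_mul_le_iff₀ hA0] at h1
  have h3 : 0 < ‖y‖ - r - ρ := pos_of_mul_pos_right (hρ.trans_le h2) hA0.le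
  have hyn : ‖r⁻¹ • y‖ = ‖y‖ / r := by
    rw [norm_smul, norm_inv, Real.norm_of_nonneg hr.le, inv_mul_eq_div]
  have hy' : r⁻¹ • y ∈ flatAnnulus (p + 1) 1 := by
    rw [← inv_mul_cancel₀ hr.ne']
    exact (smul_mem_flatAnnulus_iff (inv_pos.2 hr)).2 hy
  have hsub : ‖y‖ / r - 1 = (‖y‖ - r) / r := by rw [sub_div, div_self hr.ne']
  have key := H _ (IsHarmonicMeasure.isSwept hp hr hω) (r⁻¹ • y) hy' (ρ / r) (by positivity)
    (by rw [div_le_iff₀ hr]; linarith)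
    (by rw [hyn, hsub]; gcongr; linarith)
    (by rw [hyn, hsub, ← mul_div_assoc]; gcongr; linarith)
  have hpre : (fun x => r⁻¹ • x) ⁻¹' ball (r⁻¹ • y) (ρ / r) = ball y ρ := by
    ext x
    rw [mem_preimage, mem_ball, mem_ball, dist_smul₀, norm_inv, Real.norm_of_nonneg hr.le,
      inv_mul_eq_div, div_lt_div_iff_of_pos_right hr]
  rw [Measure.map_apply (by fun_prop) measurableSet_ball, hpre] at key
  refine le_trans (le_of_eq ?_) key
  congr 1
  rw [Real.sqrt_eq_rpow, ← Real.rpow_natCast, ← Real.rpow_add (by positivity)]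
  congr 1
  push_cast
  ring
end
end
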